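/- Let M = {(z, w) ∈ ℂ² : z ≠ 0, w ≠ 0, and z + w ≠ 1}, the complement of the arrangement of the three hyperplanes x = 0, y = 0, x + y = 1 in ℂ², and fix a basepoint m ∈ M. Then the second homotopy group π₂(M, m) is a free abelian group of countably infinite rank; that is, π₂(M, m) is isomorphic (as an abelian group) to the direct sum of countably many copies of ℤ (equivalently, to the additive group of finitely supported functions ℕ → ℤ). -/

import Mathlib

open scoped Topology

namespace HattoriPiTwo

open Set Topology.Homotopy

section Classes

variable {X : Type*} [TopologicalSpace X] {x₀ : X}

/-- A continuous function on the plane is constant equal to `x₀` on the boundary of the unit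
square. -/
def BdryConst (x₀ : X) (g : ℝ × ℝ → X) : Prop :=
  ∀ x ∈ Icc (0 : ℝ) 1, ∀ y ∈ Icc (0 : ℝ) 1, (x = 0 ∨ x = 1 ∨ y = 0 ∨ y = 1) → g (x, y) = x₀

/-- The generalized loop given by the restriction of a function to the unit square. -/
def toGenLoop (g : C(ℝ × ℝ, X)) (hg : BdryConst x₀ g) : GenLoop (Fin 2) X x₀ :=
  ⟨⟨fun t => g ((t 0 : ℝ), (t 1 : ℝ)), by fun_prop⟩, by
    rintro t ⟨i, hi⟩
    refine hg _ (t 0).2 _ (t 1).2 ?_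
    fin_cases i <;> rcases hi with hi | hi <;> simp_all⟩

@[simp]
lemma toGenLoop_apply (g : C(ℝ × ℝ, X)) (hg : BdryConst x₀ g) (t : Fin 2 → unitInterval) :
    toGenLoop g hg t = g ((t 0 : ℝ), (t 1 : ℝ)) := rfl

/-- The class of a generalized loop in `π₂`, written additively. -/
def piMk (f : GenLoop (Fin 2) X x₀) : Additive (π_ 2 X x₀) :=
  Additive.ofMul (Quotient.mk (GenLoop.Homotopic.setoid (Fin 2) x₀) f)

lemma piMk_transAt (i : Fin 2) (f g : GenLoop (Fin 2) X x₀) :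
    piMk (GenLoop.transAt i f g) = piMk f + piMk g :=
  (HomotopyGroup.mul_spec (i := i) (p := g) (q := f)).symm.trans (mul_comm (G := π_ 2 X x₀) _ _)

lemma piMk_symmAt (i : Fin 2) (f : GenLoop (Fin 2) X x₀) :
    piMk (GenLoop.symmAt i f) = - piMk f :=
  (HomotopyGroup.inv_spec (i := i) (p := f)).symm

lemma piMk_const : piMk (GenLoop.const : GenLoop (Fin 2) X x₀) = 0 :=
  (HomotopyGroup.one_def (N := Fin 2) (X := X) (x := x₀)).symm

open Classical in
/-- The class in `π₂` of a square with constant boundary (and `0` for other squares). -/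
noncomputable def cl (x₀ : X) (g : C(ℝ × ℝ, X)) : Additive (π_ 2 X x₀) :=
  if h : BdryConst x₀ g then piMk (toGenLoop g h) else 0

lemma cl_eq (g : C(ℝ × ℝ, X)) (h : BdryConst x₀ g) :
    cl x₀ g = piMk (toGenLoop g h) :=
  dif_pos h

lemma cl_homotopy (K : C(ℝ × ℝ × ℝ, X))
    (hK : ∀ s ∈ Icc (0 : ℝ) 1, BdryConst x₀ fun p => K (s, p)) (g₀ g₁ : C(ℝ × ℝ, X))
    (h₀ : ∀ x ∈ Icc (0 : ℝ) 1, ∀ y ∈ Icc (0 : ℝ) 1, g₀ (x, y) = K (0, x, y))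
    (h₁ : ∀ x ∈ Icc (0 : ℝ) 1, ∀ y ∈ Icc (0 : ℝ) 1, g₁ (x, y) = K (1, x, y)) :
    cl x₀ g₀ = cl x₀ g₁ := by
  have b₀ : BdryConst x₀ g₀ := fun x hx y hy h => by
    rw [h₀ x hx y hy]; exact hK 0 (by simp) x hx y hy h
  have b₁ : BdryConst x₀ g₁ := fun x hx y hy h => by
    rw [h₁ x hx y hy]; exact hK 1 (by simp) x hx y hy h
  rw [cl_eq _ b₀, cl_eq _ b₁]
  refine congrArg Additive.ofMul <| Quotient.sound ⟨⟨⟨⟨fun p => K ((p.1 : ℝ), (p.2 0 : ℝ), (p.2 1 : ℝ)), by fun_prop⟩,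
    fun t => ?_, fun t => ?_⟩, ?_⟩⟩
  · exact (h₀ _ (t 0).2 _ (t 1).2).symm
  · exact (h₁ _ (t 0).2 _ (t 1).2).symm
  · rintro s t ⟨i, hi⟩
    have hb : (t 0 : ℝ) = 0 ∨ (t 0 : ℝ) = 1 ∨ (t 1 : ℝ) = 0 ∨ (t 1 : ℝ) = 1 := by
      fin_cases i <;> rcases hi with hi | hi <;> simp_all
    exact (hK _ s.2 _ (t 0).2 _ (t 1).2 hb).trans (b₀ _ (t 0).2 _ (t 1).2 hb).symm

lemma cl_congr {g₀ g₁ : C(ℝ × ℝ, X)} (b : BdryConst x₀ g₀)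
    (h : ∀ x ∈ Icc (0 : ℝ) 1, ∀ y ∈ Icc (0 : ℝ) 1, g₀ (x, y) = g₁ (x, y)) :
    cl x₀ g₀ = cl x₀ g₁ :=
  cl_homotopy ⟨fun p => g₀ p.2, by fun_prop⟩ (fun _ _ => b) _ _ (fun _ _ _ _ => rfl)
    fun x hx y hy => (h x hx y hy).symm

lemma cl_const (g : C(ℝ × ℝ, X))
    (h : ∀ x ∈ Icc (0 : ℝ) 1, ∀ y ∈ Icc (0 : ℝ) 1, g (x, y) = x₀) : cl x₀ g = 0 := by
  have b : BdryConst x₀ g := fun x hx y hy _ => h x hx y hy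
  rw [cl_eq _ b, ← piMk_const]
  congr 1
  ext t
  exact h _ (t 0).2 _ (t 1).2

lemma cl_add (i : Fin 2) (f g k : C(ℝ × ℝ, X)) (hf : BdryConst x₀ f) (hg : BdryConst x₀ g)
    (hk : BdryConst x₀ k)
    (h : ∀ t, GenLoop.transAt i (toGenLoop f hf) (toGenLoop g hg) t = toGenLoop k hk t) :
    cl x₀ k = cl x₀ f + cl x₀ g := by
  rw [cl_eq _ hf, cl_eq _ hg, cl_eq _ hk, ← piMk_transAt i]
  congr 1
  ext t
  exact (h t).symm

lemma cl_split_fst (k : C(ℝ × ℝ, X)) (hk : BdryConst x₀ k)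
    (hm : ∀ y ∈ Icc (0 : ℝ) 1, k (1 / 2, y) = x₀) :
    cl x₀ k = cl x₀ ⟨fun p => k (p.1 / 2, p.2), by fun_prop⟩ +
      cl x₀ ⟨fun p => k ((1 + p.1) / 2, p.2), by fun_prop⟩ := by
  refine cl_add 0 _ _ _ ?_ ?_ hk ?_
  · rintro x ⟨hx0, hx1⟩ y hy h
    simp only [ContinuousMap.coe_mk]
    rcases h with rfl | rfl | h | h
    · exact hk _ (by simp) _ hy (by simp)
    · exact hm y hy
    all_goals exact hk _ ⟨by linarith, by linarith⟩ _ hy (by simp [h])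
  · rintro x ⟨hx0, hx1⟩ y hy h
    simp only [ContinuousMap.coe_mk]
    rcases h with rfl | rfl | h | h
    · simpa using hm y hy
    · exact hk _ (by norm_num) _ hy (by norm_num)
    all_goals exact hk _ ⟨by linarith, by linarith⟩ _ hy (by simp [h])
  · intro t
    have h0 := (t 0).2.1
    have h1 := (t 0).2.2
    rw [GenLoop.transAt, GenLoop.coe_copy]
    split_ifs with ht
    · have := Set.coe_projIcc (a := (0 : ℝ)) (b := 1) zero_le_one (2 * (t 0 : ℝ))
      change k ((projIcc (0 : ℝ) 1 zero_le_one (2 * (t 0 : ℝ)) : ℝ) / 2, (t 1 : ℝ)) = k ((t 0 : ℝ), (t 1 : ℝ))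
      rw [this, min_eq_right (by linarith), max_eq_right (by linarith)]
      congr 2; ring
    · have := Set.coe_projIcc (a := (0 : ℝ)) (b := 1) zero_le_one (2 * (t 0 : ℝ) - 1)
      change k ((1 + (projIcc (0 : ℝ) 1 zero_le_one (2 * (t 0 : ℝ) - 1) : ℝ)) / 2, (t 1 : ℝ)) = k ((t 0 : ℝ), (t 1 : ℝ))
      rw [this, min_eq_right (by linarith), max_eq_right (by linarith)]
      congr 2; ring

lemma cl_split_snd (k : C(ℝ × ℝ, X)) (hk : BdryConst x₀ k)
    (hm : ∀ x ∈ Icc (0 : ℝ) 1, k (x, 1 / 2) = x₀) :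
    cl x₀ k = cl x₀ ⟨fun p => k (p.1, p.2 / 2), by fun_prop⟩ +
      cl x₀ ⟨fun p => k (p.1, (1 + p.2) / 2), by fun_prop⟩ := by
  refine cl_add 1 _ _ _ ?_ ?_ hk ?_
  · rintro x hx y ⟨hx0, hx1⟩ h
    simp only [ContinuousMap.coe_mk]
    rcases h with h | h | rfl | rfl
    · exact hk _ hx _ ⟨by linarith, by linarith⟩ (by simp [h])
    · exact hk _ hx _ ⟨by linarith, by linarith⟩ (by simp [h])
    · exact hk _ hx _ (by simp) (by simp)
    · exact hm x hx
  · rintro x hx y ⟨hx0, hx1⟩ h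
    simp only [ContinuousMap.coe_mk]
    rcases h with h | h | rfl | rfl
    · exact hk _ hx _ ⟨by linarith, by linarith⟩ (by simp [h])
    · exact hk _ hx _ ⟨by linarith, by linarith⟩ (by simp [h])
    · simpa using hm x hx
    · exact hk _ hx _ (by norm_num) (by norm_num)
  · intro t
    have h0 := (t 1).2.1
    have h1 := (t 1).2.2
    rw [GenLoop.transAt, GenLoop.coe_copy]
    split_ifs with ht
    · have := Set.coe_projIcc (a := (0 : ℝ)) (b := 1) zero_le_one (2 * (t 1 : ℝ))
      change k ((t 0 : ℝ), (projIcc (0 : ℝ) 1 zero_le_one (2 * (t 1 : ℝ)) : ℝ) / 2) = k ((t 0 : ℝ), (t 1 : ℝ))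
      rw [this, min_eq_right (by linarith), max_eq_right (by linarith)]
      congr 2; ring
    · have := Set.coe_projIcc (a := (0 : ℝ)) (b := 1) zero_le_one (2 * (t 1 : ℝ) - 1)
      change k ((t 0 : ℝ), (1 + (projIcc (0 : ℝ) 1 zero_le_one (2 * (t 1 : ℝ) - 1) : ℝ)) / 2) = k ((t 0 : ℝ), (t 1 : ℝ))
      rw [this, min_eq_right (by linarith), max_eq_right (by linarith)]
      congr 2; ring

lemma cl_rev (k k' : C(ℝ × ℝ, X)) (hk : BdryConst x₀ k)
    (h : ∀ x ∈ Icc (0 : ℝ) 1, ∀ y ∈ Icc (0 : ℝ) 1, k' (x, y) = k (1 - x, y)) :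
    cl x₀ k' = - cl x₀ k := by
  have hk' : BdryConst x₀ k' := fun x hx y hy hxy => by
    rw [h x hx y hy]
    refine hk _ ⟨by linarith [hx.2], by linarith [hx.1]⟩ _ hy ?_
    rcases hxy with rfl | rfl | h | h <;> simp_all
  rw [cl_eq _ hk, cl_eq _ hk', ← piMk_symmAt 0]
  congr 1
  ext t
  exact h _ (t 0).2 _ (t 1).2

end Classes

section PinnedCube

variable {X : Type*} [TopologicalSpace X] {x₀ : X}

lemma cl_split_fst₃ (k a b c : C(ℝ × ℝ, X)) (hk : BdryConst x₀ k)
    (h₁ : ∀ y ∈ Icc (0 : ℝ) 1, k (1 / 2, y) = x₀) (h₂ : ∀ y ∈ Icc (0 : ℝ) 1, k (3 / 4, y) = x₀)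
    (ha : ∀ x ∈ Icc (0 : ℝ) 1, ∀ y ∈ Icc (0 : ℝ) 1, k (x / 2, y) = a (x, y))
    (hb : ∀ x ∈ Icc (0 : ℝ) 1, ∀ y ∈ Icc (0 : ℝ) 1, k ((2 + x) / 4, y) = b (x, y))
    (hc : ∀ x ∈ Icc (0 : ℝ) 1, ∀ y ∈ Icc (0 : ℝ) 1, k ((3 + x) / 4, y) = c (x, y)) :
    cl x₀ k = cl x₀ a + cl x₀ b + cl x₀ c := by
  have B : ∀ u v : ℝ, 0 ≤ u → u ≤ v → v ≤ 1 → (∀ y ∈ Icc (0 : ℝ) 1, k (u, y) = x₀) →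
      (∀ y ∈ Icc (0 : ℝ) 1, k (v, y) = x₀) →
      BdryConst x₀ fun p : ℝ × ℝ => k (u + (v - u) * p.1, p.2) := by
    intro u v hu huv hv hu' hv' x hx y hy h
    have h0 : 0 ≤ (v - u) * x := mul_nonneg (by linarith) hx.1
    have h1 : (v - u) * x ≤ (v - u) * 1 := mul_le_mul_of_nonneg_left hx.2 (by linarith)
    rcases h with rfl | rfl | h | h
    · simpa using hu' y hy
    · simpa using hv' y hy
    all_goals exact hk _ ⟨by linarith, by linarith⟩ _ hy (by simp [h])
  have e0 : ∀ y ∈ Icc (0 : ℝ) 1, k (0, y) = x₀ := fun y hy => hk _ (by simp) _ hy (by simp)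
  have e1 : ∀ y ∈ Icc (0 : ℝ) 1, k (1, y) = x₀ := fun y hy => hk _ (by simp) _ hy (by simp)
  have Ba := B 0 (1 / 2) (by norm_num) (by norm_num) (by norm_num) e0 h₁
  have Br := B (1 / 2) 1 (by norm_num) (by norm_num) (by norm_num) h₁ e1
  have Bb := B (1 / 2) (3 / 4) (by norm_num) (by norm_num) (by norm_num) h₁ h₂
  have Bc := B (3 / 4) 1 (by norm_num) (by norm_num) (by norm_num) h₂ e1
  rw [cl_split_fst k hk h₁, cl_split_fst ⟨fun p => k ((1 + p.1) / 2, p.2), by fun_prop⟩, add_assoc]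
  · congr 1
    · refine cl_congr (fun x hx y hy h => ?_) fun x hx y hy => ha x hx y hy
      rw [← Ba x hx y hy h]; simp only [ContinuousMap.coe_mk]; congr 2; ring
    · congr 1
      · refine cl_congr (fun x hx y hy h => ?_) fun x hx y hy => ?_
        · rw [← Bb x hx y hy h]; simp only [ContinuousMap.coe_mk]; congr 2; ring
        · rw [← hb x hx y hy]; simp only [ContinuousMap.coe_mk]; congr 2; ring
      · refine cl_congr (fun x hx y hy h => ?_) fun x hx y hy => ?_
        · rw [← Bc x hx y hy h]; simp only [ContinuousMap.coe_mk]; congr 2; ring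
        · rw [← hc x hx y hy]; simp only [ContinuousMap.coe_mk]; congr 2; ring
  · intro x hx y hy h
    rw [← Br x hx y hy h]; simp only [ContinuousMap.coe_mk]; congr 2; ring
  · intro y hy
    rw [← h₂ y hy]; simp only [ContinuousMap.coe_mk]; congr 2; norm_num

lemma cl_split_snd₃ (k a b c : C(ℝ × ℝ, X)) (hk : BdryConst x₀ k)
    (h₁ : ∀ y ∈ Icc (0 : ℝ) 1, k (y, 1 / 2) = x₀) (h₂ : ∀ y ∈ Icc (0 : ℝ) 1, k (y, 3 / 4) = x₀)
    (ha : ∀ x ∈ Icc (0 : ℝ) 1, ∀ y ∈ Icc (0 : ℝ) 1, k (y, x / 2) = a (y, x))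
    (hb : ∀ x ∈ Icc (0 : ℝ) 1, ∀ y ∈ Icc (0 : ℝ) 1, k (y, (2 + x) / 4) = b (y, x))
    (hc : ∀ x ∈ Icc (0 : ℝ) 1, ∀ y ∈ Icc (0 : ℝ) 1, k (y, (3 + x) / 4) = c (y, x)) :
    cl x₀ k = cl x₀ a + cl x₀ b + cl x₀ c := by
  have B : ∀ u v : ℝ, 0 ≤ u → u ≤ v → v ≤ 1 → (∀ y ∈ Icc (0 : ℝ) 1, k (y, u) = x₀) →
      (∀ y ∈ Icc (0 : ℝ) 1, k (y, v) = x₀) →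
      BdryConst x₀ fun p : ℝ × ℝ => k (p.1, u + (v - u) * p.2) := by
    intro u v hu huv hv hu' hv' y hy x hx h
    have h0 : 0 ≤ (v - u) * x := mul_nonneg (by linarith) hx.1
    have h1 : (v - u) * x ≤ (v - u) * 1 := mul_le_mul_of_nonneg_left hx.2 (by linarith)
    rcases h with h | h | rfl | rfl
    · exact hk _ hy _ ⟨by linarith, by linarith⟩ (by simp [h])
    · exact hk _ hy _ ⟨by linarith, by linarith⟩ (by simp [h])
    · simpa using hu' y hy
    · simpa using hv' y hy
  have e0 : ∀ y ∈ Icc (0 : ℝ) 1, k (y, 0) = x₀ := fun y hy => hk _ hy _ (by simp) (by simp)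
  have e1 : ∀ y ∈ Icc (0 : ℝ) 1, k (y, 1) = x₀ := fun y hy => hk _ hy _ (by simp) (by simp)
  have Ba := B 0 (1 / 2) (by norm_num) (by norm_num) (by norm_num) e0 h₁
  have Br := B (1 / 2) 1 (by norm_num) (by norm_num) (by norm_num) h₁ e1
  have Bb := B (1 / 2) (3 / 4) (by norm_num) (by norm_num) (by norm_num) h₁ h₂
  have Bc := B (3 / 4) 1 (by norm_num) (by norm_num) (by norm_num) h₂ e1
  rw [cl_split_snd k hk h₁, cl_split_snd ⟨fun p => k (p.1, (1 + p.2) / 2), by fun_prop⟩, add_assoc]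
  · congr 1
    · refine cl_congr (fun x hx y hy h => ?_) fun x hx y hy => ha y hy x hx
      rw [← Ba x hx y hy h]; simp only [ContinuousMap.coe_mk]; congr 2; ring
    · congr 1
      · refine cl_congr (fun x hx y hy h => ?_) fun x hx y hy => ?_
        · rw [← Bb x hx y hy h]; simp only [ContinuousMap.coe_mk]; congr 2; ring
        · rw [← hb y hy x hx]; simp only [ContinuousMap.coe_mk]; congr 2; ring
      · refine cl_congr (fun x hx y hy h => ?_) fun x hx y hy => ?_
        · rw [← Bc x hx y hy h]; simp only [ContinuousMap.coe_mk]; congr 2; ring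
        · rw [← hc y hy x hx]; simp only [ContinuousMap.coe_mk]; congr 2; ring
  · intro x hx y hy h
    rw [← Br x hx y hy h]; simp only [ContinuousMap.coe_mk]; congr 2; ring
  · intro y hy
    rw [← h₂ y hy]; simp only [ContinuousMap.coe_mk]; congr 2; norm_num

/-- The tent function that measures the height above the front face in the unfolding of the
boundary of a cube. -/
noncomputable def tent (x : ℝ) : ℝ := min 1 (min (2 * x) (4 - 4 * x))

/-- The position function in the unfolding of the boundary of a cube. -/
noncomputable def pos (x : ℝ) : ℝ := max 0 (min 1 (4 * x - 2))

@[fun_prop]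
lemma continuous_tent : Continuous tent := by unfold tent; fun_prop

@[fun_prop]
lemma continuous_pos : Continuous pos := by unfold pos; fun_prop

lemma tent_left {x : ℝ} (hx : x ∈ Icc (0 : ℝ) 1) : tent (x / 2) = x := by
  unfold tent
  rw [min_eq_left (a := 2 * _) (by linarith [hx.2]), min_eq_right (by linarith [hx.2])]; ring

lemma tent_mid {x : ℝ} (hx : x ∈ Icc (0 : ℝ) 1) : tent ((2 + x) / 4) = 1 := by
  unfold tent
  exact min_eq_left (le_min (by linarith [hx.1]) (by linarith [hx.2]))

lemma tent_right {x : ℝ} (hx : x ∈ Icc (0 : ℝ) 1) : tent ((3 + x) / 4) = 1 - x := by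
  unfold tent
  rw [min_eq_right (a := 2 * _) (by linarith [hx.1]), min_eq_right (by linarith [hx.1])]; ring

lemma pos_left {x : ℝ} (hx : x ∈ Icc (0 : ℝ) 1) : pos (x / 2) = 0 := by
  unfold pos
  exact max_eq_left ((min_le_right _ _).trans (by linarith [hx.2]))

lemma pos_mid {x : ℝ} (hx : x ∈ Icc (0 : ℝ) 1) : pos ((2 + x) / 4) = x := by
  unfold pos
  rw [min_eq_right (by linarith [hx.2]), max_eq_right (by linarith [hx.1])]; ring

lemma pos_right {x : ℝ} (hx : x ∈ Icc (0 : ℝ) 1) : pos ((3 + x) / 4) = 1 := by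
  unfold pos
  rw [min_eq_left (by linarith [hx.1]), max_eq_right (by norm_num)]

lemma pos_mem (x : ℝ) : pos x ∈ Icc (0 : ℝ) 1 :=
  ⟨le_max_left _ _, max_le zero_le_one (min_le_left _ _)⟩

lemma tent_mem {x : ℝ} (hx : x ∈ Icc (0 : ℝ) 1) : tent x ∈ Icc (0 : ℝ) 1 :=
  ⟨le_min zero_le_one (le_min (by linarith [hx.1]) (by linarith [hx.2])), min_le_left _ _⟩

lemma tent_eq_one_or (x : ℝ) : tent x = 1 ∨ pos x = 0 ∨ pos x = 1 := by
  rcases le_total x (1 / 2) with h | h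
  · right; left; unfold pos
    exact max_eq_left ((min_le_right _ _).trans (by linarith))
  rcases le_total x (3 / 4) with h' | h'
  · left; unfold tent
    exact min_eq_left (le_min (by linarith) (by linarith))
  · right; right; unfold pos
    rw [min_eq_left (by linarith), max_eq_right (by norm_num)]

/-- A map of the cube that is constant on the edges. -/
def EdgeConst (x₀ : X) (Q : ℝ × ℝ × ℝ → X) : Prop :=
  ∀ t ∈ Icc (0 : ℝ) 1, ∀ x ∈ Icc (0 : ℝ) 1, ∀ y ∈ Icc (0 : ℝ) 1,
    ((t = 0 ∨ t = 1) ∧ (x = 0 ∨ x = 1) ∨ (t = 0 ∨ t = 1) ∧ (y = 0 ∨ y = 1) ∨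
      (x = 0 ∨ x = 1) ∧ (y = 0 ∨ y = 1)) → Q (t, x, y) = x₀

lemma cl_unfold (Q : C(ℝ × ℝ × ℝ, X)) (hQ : EdgeConst x₀ Q) :
    cl x₀ ⟨fun p => Q (0, p.1, p.2), by fun_prop⟩ =
      cl x₀ ⟨fun p => Q (p.1, 0, p.2), by fun_prop⟩ +
      (cl x₀ ⟨fun p => Q (p.2, p.1, 0), by fun_prop⟩ +
        cl x₀ ⟨fun p => Q (1, p.1, p.2), by fun_prop⟩ +
        cl x₀ ⟨fun p => Q (1 - p.2, p.1, 1), by fun_prop⟩) +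
      cl x₀ ⟨fun p => Q (1 - p.1, 1, p.2), by fun_prop⟩ := by
  set v : C(ℝ × ℝ, X) := ⟨fun p => Q (min (tent p.1) (tent p.2), pos p.1, pos p.2), by fun_prop⟩
    with hv
  have hmem : ∀ x ∈ Icc (0 : ℝ) 1, ∀ y ∈ Icc (0 : ℝ) 1,
      min (tent x) (tent y) ∈ Icc (0 : ℝ) 1 := fun x hx y hy =>
    ⟨le_min (tent_mem hx).1 (tent_mem hy).1, (min_le_left _ _).trans (tent_mem hx).2⟩
  have p01 : ∀ x : ℝ, (x = 0 ∨ x = 1 / 2 ∨ x = 3 / 4 ∨ x = 1) → pos x = 0 ∨ pos x = 1 := by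
    rintro x (rfl | rfl | rfl | rfl) <;> norm_num [pos]
  have t01 : ∀ x : ℝ, (x = 0 ∨ x = 1 / 2 ∨ x = 3 / 4 ∨ x = 1) → tent x = 0 ∨ tent x = 1 := by
    rintro x (rfl | rfl | rfl | rfl) <;> norm_num [tent]
  have hcorner : ∀ x ∈ Icc (0 : ℝ) 1, ∀ y ∈ Icc (0 : ℝ) 1, (pos x = 0 ∨ pos x = 1) →
      (pos y = 0 ∨ pos y = 1) → v (x, y) = x₀ := fun x hx y hy h h' =>
    hQ _ (hmem x hx y hy) _ (pos_mem _) _ (pos_mem _) (Or.inr (Or.inr ⟨h, h'⟩))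
  have hline : ∀ x ∈ Icc (0 : ℝ) 1, ∀ y ∈ Icc (0 : ℝ) 1,
      (x = 0 ∨ x = 1 / 2 ∨ x = 3 / 4 ∨ x = 1) ∨ (y = 0 ∨ y = 1 / 2 ∨ y = 3 / 4 ∨ y = 1) →
      v (x, y) = x₀ := by
    have key : ∀ a b : ℝ, a ∈ Icc (0 : ℝ) 1 → (a = 0 ∨ a = 1) → b = 1 →
        (min a b = 0 ∨ min a b = 1) ∧ (min b a = 0 ∨ min b a = 1) := by
      rintro a b ⟨_, h⟩ (rfl | rfl) rfl <;> simp
    rintro x hx y hy (h | h)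
    · rcases tent_eq_one_or y with h' | h'
      · exact hQ _ (hmem x hx y hy) _ (pos_mem _) _ (pos_mem _)
          (Or.inl ⟨(key _ _ (tent_mem hx) (t01 x h) h').1, p01 x h⟩)
      · exact hcorner x hx y hy (p01 x h) h'
    · rcases tent_eq_one_or x with h' | h'
      · exact hQ _ (hmem x hx y hy) _ (pos_mem _) _ (pos_mem _)
          (Or.inr (Or.inl ⟨(key _ _ (tent_mem hy) (t01 y h) h').2, p01 y h⟩))
      · exact hcorner x hx y hy h' (p01 y h)
  have hvb : BdryConst x₀ v := fun x hx y hy h => hline x hx y hy (by tauto)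
  have hI : ∀ s ∈ Icc (0 : ℝ) 1, ∀ a ∈ Icc (0 : ℝ) 1, ∀ b ∈ Icc (0 : ℝ) 1,
      (1 - s) * a + s * b ∈ Icc (0 : ℝ) 1 := fun s hs a ha b hb =>
    convex_Icc (0 : ℝ) 1 ha hb (by linarith [hs.2]) hs.1 (by ring)
  have c0 : pos 0 = 0 := by norm_num [pos]
  have c1 : pos 1 = 1 := by norm_num [pos]
  have d0 : tent 0 = 0 := by norm_num [tent]
  have d1 : tent 1 = 0 := by norm_num [tent]
  rw [cl_homotopy ⟨fun p => Q (p.1 * min (tent p.2.1) (tent p.2.2),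
      (1 - p.1) * p.2.1 + p.1 * pos p.2.1, (1 - p.1) * p.2.2 + p.1 * pos p.2.2), by fun_prop⟩
      ?_ _ v (fun x _ y _ => by simp) (fun x _ y _ => by simp [hv])]
  · have q0 : ∀ x ∈ Icc (0 : ℝ) 1, x / 2 ∈ Icc (0 : ℝ) 1 := fun x hx =>
      ⟨by linarith [hx.1], by linarith [hx.2]⟩
    have q1 : ∀ x ∈ Icc (0 : ℝ) 1, (2 + x) / 4 ∈ Icc (0 : ℝ) 1 := fun x hx =>
      ⟨by linarith [hx.1], by linarith [hx.2]⟩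
    have q2 : ∀ x ∈ Icc (0 : ℝ) 1, (3 + x) / 4 ∈ Icc (0 : ℝ) 1 := fun x hx =>
      ⟨by linarith [hx.1], by linarith [hx.2]⟩
    have h12 : (1 / 2 : ℝ) ∈ Icc (0 : ℝ) 1 := by norm_num
    have h34 : (3 / 4 : ℝ) ∈ Icc (0 : ℝ) 1 := by norm_num
    rw [cl_split_fst₃ v ⟨fun p => v (p.1 / 2, p.2), by fun_prop⟩
      ⟨fun p => v ((2 + p.1) / 4, p.2), by fun_prop⟩ ⟨fun p => v ((3 + p.1) / 4, p.2), by fun_prop⟩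
      hvb (fun y hy => hline _ h12 y hy (by simp)) (fun y hy => hline _ h34 y hy (by simp))
      (fun _ _ _ _ => rfl) (fun _ _ _ _ => rfl) (fun _ _ _ _ => rfl)]
    congr 1
    · congr 1
      · rw [cl_split_snd₃ _ (ContinuousMap.const _ x₀) ⟨fun p => Q (p.1, 0, p.2), by fun_prop⟩
          (ContinuousMap.const _ x₀)]
        · rw [cl_const (ContinuousMap.const _ x₀) (fun _ _ _ _ => rfl)]; simp
        · rintro x hx y hy (rfl | rfl | h | h)
          · exact hline _ (q0 _ hx) _ hy (by norm_num)
          · exact hline _ (q0 _ hx) _ hy (by norm_num)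
          · exact hline _ (q0 _ hx) _ hy (by simp [h])
          · exact hline _ (q0 _ hx) _ hy (by simp [h])
        · exact fun y hy => hline _ (q0 _ hy) _ h12 (by simp)
        · exact fun y hy => hline _ (q0 _ hy) _ h34 (by simp)
        · exact fun x hx y hy => hcorner _ (q0 _ hy) _ (q0 _ hx) (by simp [pos_left hy])
            (by simp [pos_left hx])
        · intro x hx y hy
          simp [hv, tent_left hy, tent_mid hx, pos_left hy, pos_mid hx, hy.2]
        · exact fun x hx y hy => hcorner _ (q0 _ hy) _ (q2 _ hx) (by simp [pos_left hy])
            (by simp [pos_right hx])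
      · apply cl_split_snd₃
        · rintro x hx y hy (rfl | rfl | h | h)
          · exact hline _ (q1 _ hx) _ hy (by norm_num)
          · exact hline _ (q1 _ hx) _ hy (by norm_num)
          · exact hline _ (q1 _ hx) _ hy (by simp [h])
          · exact hline _ (q1 _ hx) _ hy (by simp [h])
        · exact fun y hy => hline _ (q1 _ hy) _ h12 (by simp)
        · exact fun y hy => hline _ (q1 _ hy) _ h34 (by simp)
        · intro x hx y hy
          simp [hv, tent_mid hy, tent_left hx, pos_mid hy, pos_left hx, hx.2]
        · intro x hx y hy
          simp [hv, tent_mid hy, tent_mid hx, pos_mid hy, pos_mid hx]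
        · intro x hx y hy
          simp [hv, tent_mid hy, tent_right hx, pos_mid hy, pos_right hx, hx.1]
    · rw [cl_split_snd₃ _ (ContinuousMap.const _ x₀) ⟨fun p => Q (1 - p.1, 1, p.2), by fun_prop⟩
          (ContinuousMap.const _ x₀)]
      · rw [cl_const (ContinuousMap.const _ x₀) (fun _ _ _ _ => rfl)]; simp
      · rintro x hx y hy (rfl | rfl | h | h)
        · exact hline _ (q2 _ hx) _ hy (by norm_num)
        · exact hline _ (q2 _ hx) _ hy (by norm_num)
        · exact hline _ (q2 _ hx) _ hy (by simp [h])
        · exact hline _ (q2 _ hx) _ hy (by simp [h])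
      · exact fun y hy => hline _ (q2 _ hy) _ h12 (by simp)
      · exact fun y hy => hline _ (q2 _ hy) _ h34 (by simp)
      · exact fun x hx y hy => hcorner _ (q2 _ hy) _ (q0 _ hx) (by simp [pos_right hy])
          (by simp [pos_left hx])
      · intro x hx y hy
        simp [hv, tent_right hy, tent_mid hx, pos_right hy, pos_mid hx, hy.1]
      · exact fun x hx y hy => hcorner _ (q2 _ hy) _ (q2 _ hx) (by simp [pos_right hy])
          (by simp [pos_right hx])
  · rintro s hs x hx y hy h
    have hst : s * min (tent x) (tent y) ∈ Icc (0 : ℝ) 1 := by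
      have := hI s hs 0 (by simp) _ (hmem x hx y hy)
      simpa using this
    refine hQ _ hst _ (hI s hs _ hx _ (pos_mem x)) _ (hI s hs _ hy _ (pos_mem y)) ?_
    have tx := (tent_mem hx).1
    have ty := (tent_mem hy).1
    rcases h with rfl | rfl | rfl | rfl
    · left; simp [c0, d0, ty]
    · left; simp [c1, d1, ty]
    · right; left; simp [c0, d0, tx]
    · right; left; simp [c1, d1, tx]

lemma cl_swap (g : C(ℝ × ℝ, X)) (hg : BdryConst x₀ g) :
    cl x₀ ⟨fun p => g (p.2, p.1), by fun_prop⟩ = - cl x₀ g := by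
  have hQ : EdgeConst x₀ (⟨fun p => g (p.1, max p.2.1 p.2.2), by fun_prop⟩ : C(ℝ × ℝ × ℝ, X)) := by
    intro t ht x hx y hy h
    have hm : max x y ∈ Icc (0 : ℝ) 1 := ⟨le_max_of_le_left hx.1, max_le hx.2 hy.2⟩
    refine hg _ ht _ hm ?_
    rcases h with ⟨h, -⟩ | ⟨h, -⟩ | ⟨h, h'⟩
    · tauto
    · tauto
    · right; right
      rcases h with rfl | rfl <;> rcases h' with rfl | rfl <;> simp
  have hm : ∀ x ∈ Icc (0 : ℝ) 1, ∀ y ∈ Icc (0 : ℝ) 1, max x y ∈ Icc (0 : ℝ) 1 :=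
    fun x hx y hy => ⟨le_max_of_le_left hx.1, max_le hx.2 hy.2⟩
  have key := cl_unfold _ hQ
  simp only [ContinuousMap.coe_mk] at key
  have e1 : cl x₀ (⟨fun p => g (0, max p.1 p.2), by fun_prop⟩ : C(ℝ × ℝ, X)) = 0 :=
    cl_const _ fun x hx y hy => hg _ (by simp) _ (hm x hx y hy) (by simp)
  have e2 : cl x₀ (⟨fun p => g (1, max p.1 p.2), by fun_prop⟩ : C(ℝ × ℝ, X)) = 0 :=
    cl_const _ fun x hx y hy => hg _ (by simp) _ (hm x hx y hy) (by simp)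
  have e3 : cl x₀ (⟨fun p => g (1 - p.2, max p.1 1), by fun_prop⟩ : C(ℝ × ℝ, X)) = 0 :=
    cl_const _ fun x hx y hy => hg _ ⟨by linarith [hy.2], by linarith [hy.1]⟩ _
      (hm x hx 1 (by simp)) (by simp [hx.2])
  have e4 : cl x₀ (⟨fun p => g (1 - p.1, max 1 p.2), by fun_prop⟩ : C(ℝ × ℝ, X)) = 0 :=
    cl_const _ fun x hx y hy => hg _ ⟨by linarith [hx.2], by linarith [hx.1]⟩ _
      (hm 1 (by simp) y hy) (by simp [hy.2])
  have e5 : cl x₀ g = cl x₀ (⟨fun p => g (p.1, max 0 p.2), by fun_prop⟩ : C(ℝ × ℝ, X)) :=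
    cl_congr hg fun x _ y hy => by simp [hy.1]
  have e6 : cl x₀ (⟨fun p => g (p.2, p.1), by fun_prop⟩ : C(ℝ × ℝ, X)) =
      cl x₀ (⟨fun p => g (p.2, max p.1 0), by fun_prop⟩ : C(ℝ × ℝ, X)) :=
    cl_congr (fun x hx y hy h => hg _ hy _ hx (by tauto)) fun x hx y _ => by simp [hx.1]
  rw [e1, e2, e3, e4, ← e5, ← e6, add_zero, add_zero, add_zero, add_comm] at key
  exact eq_neg_of_add_eq_zero_left key.symm

/-- The cocycle relation for cubes that are constant on the edges. -/
lemma cl_cube (Q : C(ℝ × ℝ × ℝ, X)) (hQ : EdgeConst x₀ Q) :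
    cl x₀ ⟨fun p => Q (0, p.1, p.2), by fun_prop⟩ - cl x₀ ⟨fun p => Q (1, p.1, p.2), by fun_prop⟩ -
      cl x₀ ⟨fun p => Q (p.1, 0, p.2), by fun_prop⟩ + cl x₀ ⟨fun p => Q (p.1, 1, p.2), by fun_prop⟩ +
      cl x₀ ⟨fun p => Q (p.1, p.2, 0), by fun_prop⟩ - cl x₀ ⟨fun p => Q (p.1, p.2, 1), by fun_prop⟩
      = 0 := by
  have b1 : BdryConst x₀ (⟨fun p => Q (p.1, p.2, 0), by fun_prop⟩ : C(ℝ × ℝ, X)) :=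
    fun x hx y hy h => hQ _ hx _ hy _ (by simp) (by simp; tauto)
  have b2 : BdryConst x₀ (⟨fun p => Q (p.1, p.2, 1), by fun_prop⟩ : C(ℝ × ℝ, X)) :=
    fun x hx y hy h => hQ _ hx _ hy _ (by simp) (by simp; tauto)
  have b3 : BdryConst x₀ (⟨fun p => Q (p.1, 1, p.2), by fun_prop⟩ : C(ℝ × ℝ, X)) :=
    fun x hx y hy h => hQ _ hx _ (by simp) _ hy (by simp; tauto)
  have r1 : BdryConst x₀ (⟨fun p => Q (1 - p.1, p.2, 1), by fun_prop⟩ : C(ℝ × ℝ, X)) :=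
    fun x hx y hy h => b2 _ ⟨by linarith [hx.2], by linarith [hx.1]⟩ _ hy (by
      rcases h with rfl | rfl | rfl | rfl <;> simp)
  have s1 := cl_swap _ b1
  have s2 := cl_swap _ r1
  have s3 := cl_rev _ ⟨fun p => Q (1 - p.1, p.2, 1), by fun_prop⟩ b2 (fun _ _ _ _ => rfl)
  have s4 := cl_rev _ ⟨fun p => Q (1 - p.1, 1, p.2), by fun_prop⟩ b3 (fun _ _ _ _ => rfl)
  have := cl_unfold Q hQ
  simp only [ContinuousMap.coe_mk] at s1 s2 s3 s4 this
  rw [this, s1, s2, s3, s4]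
  abel

end PinnedCube

section Extension

/-- The bottom and the sides of the cylinder over the ball `‖2 • p - e‖ ≤ 1`. -/
def openBox {E : Type*} [NormedAddCommGroup E] [NormedSpace ℝ E] (e : E) : Set (ℝ × E) :=
  {q | q.1 = 0 ∧ ‖(2 : ℝ) • q.2 - e‖ ≤ 1 ∨ q.1 ∈ Icc (0 : ℝ) 1 ∧ ‖(2 : ℝ) • q.2 - e‖ = 1}

variable {E : Type*} [NormedAddCommGroup E] [NormedSpace ℝ E]

lemma isClosed_openBox (e : E) : IsClosed (openBox e) := by
  have h : Continuous fun q : ℝ × E => ‖(2 : ℝ) • q.2 - e‖ := by fun_prop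
  refine IsClosed.union (IsClosed.inter ?_ ?_) (IsClosed.inter ?_ ?_)
  · exact isClosed_eq continuous_fst continuous_const
  · exact isClosed_le h continuous_const
  · exact isClosed_Icc.preimage continuous_fst
  · exact isClosed_eq h continuous_const

lemma norm_div_max_le (u : E) : ‖(max 1 ‖u‖)⁻¹ • u‖ ≤ 1 := by
  have h : 0 < max 1 ‖u‖ := lt_max_of_lt_left one_pos
  rw [norm_smul, norm_inv, Real.norm_of_nonneg h.le, inv_mul_le_iff₀ h, mul_one]
  exact le_max_right _ _

lemma norm_div_max_eq (u : E) (hu : 1 ≤ ‖u‖) : ‖(max 1 ‖u‖)⁻¹ • u‖ = 1 := by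
  rw [max_eq_right hu, norm_smul, norm_inv, norm_norm, inv_mul_cancel₀ (by positivity)]

lemma exists_retraction_openBox (e : E) :
    ∃ r : C(ℝ × E, ℝ × E), (∀ q, r q ∈ openBox e) ∧ ∀ q ∈ openBox e, r q = q := by
  have hn : ∀ u : E, max 1 ‖u‖ ≠ 0 := fun u => (lt_max_of_lt_left one_pos).ne'
  let b : E → E := fun u => (max 1 ‖u‖)⁻¹ • u
  have hb : Continuous b := (Continuous.inv₀ (by fun_prop) hn).smul continuous_id
  let y : ℝ × E → E := fun q => (1 + max 0 (min 1 q.1)) • b ((2 : ℝ) • q.2 - e)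
  have hy : Continuous y := by fun_prop
  refine ⟨⟨fun q => (max 1 ‖y q‖ - 1, (2 : ℝ)⁻¹ • (b (y q) + e)), by fun_prop⟩, fun q => ?_, ?_⟩
  · have hs0 : 0 ≤ max 0 (min 1 q.1) := le_max_left _ _
    have hs1 : max 0 (min 1 q.1) ≤ 1 := max_le zero_le_one (min_le_left _ _)
    have e1 : (2 : ℝ) • (2 : ℝ)⁻¹ • (b (y q) + e) - e = b (y q) := by
      rw [smul_inv_smul₀ two_ne_zero, add_sub_cancel_right]
    have hyn : ‖y q‖ ≤ 2 := by
      have : ‖y q‖ = (1 + max 0 (min 1 q.1)) * ‖b ((2 : ℝ) • q.2 - e)‖ := by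
        rw [norm_smul, Real.norm_of_nonneg (by linarith)]
      have h1 : ‖b ((2 : ℝ) • q.2 - e)‖ ≤ 1 := norm_div_max_le _
      rw [this]
      nlinarith [norm_nonneg (b ((2 : ℝ) • q.2 - e))]
    simp only [openBox, mem_ofPred_eq, ContinuousMap.coe_mk, e1]
    rcases le_total ‖y q‖ 1 with h | h
    · left
      exact ⟨by rw [max_eq_left h, sub_self], norm_div_max_le _⟩
    · right
      refine ⟨?_, norm_div_max_eq _ h⟩
      rw [max_eq_right h]
      constructor <;> linarith
  · rintro ⟨s, p⟩ h
    have hb' : ∀ u : E, ‖u‖ ≤ 1 → b u = u := fun u hu => by simp [b, max_eq_left hu]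
    have hp : ‖(2 : ℝ) • p - e‖ ≤ 1 := by
      rcases h with h | h
      exacts [h.2, h.2.le]
    have hyp : y (s, p) = (1 + max 0 (min 1 s)) • ((2 : ℝ) • p - e) := by
      simp only [y]; rw [hb' _ hp]
    have hback : (2 : ℝ)⁻¹ • ((2 : ℝ) • p - e + e) = p := by
      rw [sub_add_cancel, inv_smul_smul₀ two_ne_zero]
    rcases h with ⟨h1, h2⟩ | ⟨h1, h2⟩
    · simp only at h1 h2
      subst h1
      have : y (0, p) = (2 : ℝ) • p - e := by rw [hyp]; simp
      simp only [ContinuousMap.coe_mk, this, hb' _ h2, hback, max_eq_left h2, sub_self]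
    · simp only at h1 h2
      have hs : max 0 (min 1 s) = s := by rw [min_eq_right h1.2, max_eq_right h1.1]
      rw [hs] at hyp
      have hny : ‖y (s, p)‖ = 1 + s := by
        rw [hyp, norm_smul, h2, Real.norm_of_nonneg (by linarith [h1.1]), mul_one]
      have hm : max 1 ‖y (s, p)‖ = 1 + s := by rw [hny]; exact max_eq_right (by linarith [h1.1])
      have hby : b (y (s, p)) = (2 : ℝ) • p - e := by
        simp only [b, hm]
        rw [hyp, inv_smul_smul₀ (by linarith [h1.1])]
      simp only [ContinuousMap.coe_mk, hby, hm, hback, add_sub_cancel_left]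

variable {X : Type*} [TopologicalSpace X]

/-- Compatible continuous maps on finitely many closed pieces of the bottom and the sides of a
cylinder extend to the cylinder. -/
lemma exists_filling (e : E) {ι : Type*} [Finite ι] [Nonempty ι] (C : ι → Set (ℝ × E))
    (hC : ∀ i, IsClosed (C i)) (f : ι → C(ℝ × E, X)) (hcov : openBox e ⊆ ⋃ i, C i)
    (hf : ∀ i j, ∀ q ∈ openBox e, q ∈ C i → q ∈ C j → f i q = f j q) :
    ∃ H : C(ℝ × E, X), ∀ i, ∀ q ∈ openBox e, q ∈ C i → H q = f i q := by
  classical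
  obtain ⟨r, hr, hr'⟩ := exists_retraction_openBox e
  have hex : ∀ q ∈ openBox e, ∃ i, q ∈ C i := fun q hq => mem_iUnion.1 (hcov hq)
  let F : ℝ × E → X := fun q =>
    if h : q ∈ openBox e then f (hex q h).choose q else f (Classical.arbitrary ι) q
  have hF : ∀ i, ∀ q ∈ openBox e, q ∈ C i → F q = f i q := fun i q hq hi => by
    simp only [F, dif_pos hq]
    exact hf _ _ q hq (hex q hq).choose_spec hi
  have hcont : ContinuousOn F (⋃ i, openBox e ∩ C i) :=
    (locallyFinite_of_finite _).continuousOn_iUnion (fun i => (isClosed_openBox e).inter (hC i))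
      fun i => (f i).continuous.continuousOn.congr fun q hq => hF i q hq.1 hq.2
  have hmem : ∀ q, r q ∈ ⋃ i, openBox e ∩ C i := fun q => by
    obtain ⟨i, hi⟩ := hex _ (hr q)
    exact mem_iUnion.2 ⟨i, hr q, hi⟩
  refine ⟨⟨fun q => F (r q), hcont.comp_continuous r.continuous hmem⟩, fun i q hq hi => ?_⟩
  simp only [ContinuousMap.coe_mk, hr' q hq]
  exact hF i q hq hi

lemma abs_two_mul_sub_one_le {x : ℝ} : |2 * x - 1| ≤ 1 ↔ x ∈ Icc (0 : ℝ) 1 := by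
  rw [abs_le, mem_Icc]
  constructor <;> rintro ⟨h1, h2⟩ <;> constructor <;> linarith

lemma abs_two_mul_sub_one_eq {x : ℝ} : |2 * x - 1| = 1 ↔ x = 0 ∨ x = 1 := by
  rw [abs_eq zero_le_one]
  constructor
  · rintro (h | h)
    exacts [Or.inr (by linarith), Or.inl (by linarith)]
  · rintro (rfl | rfl) <;> norm_num

lemma max_eq_one_iff {a b : ℝ} : max a b = 1 ↔ (a = 1 ∧ b ≤ 1) ∨ (b = 1 ∧ a ≤ 1) := by
  constructor
  · intro h
    rcases le_total a b with h' | h'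
    · rw [max_eq_right h'] at h; exact Or.inr ⟨h, h ▸ h'⟩
    · rw [max_eq_left h'] at h; exact Or.inl ⟨h, h ▸ h'⟩
  · rintro (⟨rfl, h⟩ | ⟨rfl, h⟩)
    exacts [max_eq_left h, max_eq_right h]

lemma mem_openBox_one {s t : ℝ} : (s, t) ∈ openBox (1 : ℝ) ↔
    (s = 0 ∧ t ∈ Icc (0 : ℝ) 1) ∨ (s ∈ Icc (0 : ℝ) 1 ∧ (t = 0 ∨ t = 1)) := by
  simp only [openBox, mem_ofPred_eq, smul_eq_mul, Real.norm_eq_abs, abs_two_mul_sub_one_le,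
    abs_two_mul_sub_one_eq]

lemma mem_openBox_two {s x y : ℝ} : (s, x, y) ∈ openBox (1 : ℝ × ℝ) ↔
    (s = 0 ∧ x ∈ Icc (0 : ℝ) 1 ∧ y ∈ Icc (0 : ℝ) 1) ∨
    (s ∈ Icc (0 : ℝ) 1 ∧ x ∈ Icc (0 : ℝ) 1 ∧ y ∈ Icc (0 : ℝ) 1 ∧
      (x = 0 ∨ x = 1 ∨ y = 0 ∨ y = 1)) := by
  simp only [openBox, mem_ofPred_eq, Prod.norm_def, Prod.fst_sub, Prod.snd_sub, Prod.smul_fst,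
    Prod.smul_snd, Prod.fst_one, Prod.snd_one, smul_eq_mul, Real.norm_eq_abs, max_le_iff,
    abs_two_mul_sub_one_le, max_eq_one_iff, abs_two_mul_sub_one_eq]
  have : ∀ x : ℝ, (x = 0 ∨ x = 1) → x ∈ Icc (0 : ℝ) 1 := by rintro x (rfl | rfl) <;> simp
  have hx := this x
  have hy := this y
  tauto

lemma mem_openBox_three {s t x y : ℝ} : (s, t, x, y) ∈ openBox (1 : ℝ × ℝ × ℝ) ↔
    (s = 0 ∧ t ∈ Icc (0 : ℝ) 1 ∧ x ∈ Icc (0 : ℝ) 1 ∧ y ∈ Icc (0 : ℝ) 1) ∨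
    (s ∈ Icc (0 : ℝ) 1 ∧ t ∈ Icc (0 : ℝ) 1 ∧ x ∈ Icc (0 : ℝ) 1 ∧ y ∈ Icc (0 : ℝ) 1 ∧
      (t = 0 ∨ t = 1 ∨ x = 0 ∨ x = 1 ∨ y = 0 ∨ y = 1)) := by
  simp only [openBox, mem_ofPred_eq, Prod.norm_def, Prod.fst_sub, Prod.snd_sub, Prod.smul_fst,
    Prod.smul_snd, Prod.fst_one, Prod.snd_one, smul_eq_mul, Real.norm_eq_abs, max_le_iff,
    abs_two_mul_sub_one_le, max_eq_one_iff, abs_two_mul_sub_one_eq]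
  have : ∀ x : ℝ, (x = 0 ∨ x = 1) → x ∈ Icc (0 : ℝ) 1 := by rintro x (rfl | rfl) <;> simp
  have ht := this t
  have hx := this x
  have hy := this y
  tauto

end Extension

section Cocycle

variable {X : Type*} [TopologicalSpace X] {x₀ : X}

/-- Compatible choices of paths to the base point and of homotopies from paths to the constant
path at the base point. -/
structure Straightening (X : Type*) [TopologicalSpace X] (x₀ : X) where
  /-- The chosen path from a point to the base point. -/
  τ : X → C(ℝ, X)
  /-- The chosen homotopy from a path to the constant path. -/
  h : C(ℝ, X) → C(ℝ × ℝ, X)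
  τ_base : ∀ s ∈ Icc (0 : ℝ) 1, τ x₀ s = x₀
  h_zero : ∀ e, ∀ t ∈ Icc (0 : ℝ) 1, h e (0, t) = e t
  h_one : ∀ e, ∀ t ∈ Icc (0 : ℝ) 1, h e (1, t) = x₀
  h_left : ∀ e, ∀ s ∈ Icc (0 : ℝ) 1, h e (s, 0) = τ (e 0) s
  h_right : ∀ e, ∀ s ∈ Icc (0 : ℝ) 1, h e (s, 1) = τ (e 1) s
  h_const : ∀ x, ∀ s ∈ Icc (0 : ℝ) 1, ∀ t ∈ Icc (0 : ℝ) 1, h (ContinuousMap.const ℝ x) (s, t) = τ x s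

/-- Every point can be joined to the base point, and loops at the base point are null-homotopic. -/
structure SimplyConn (X : Type*) [TopologicalSpace X] (x₀ : X) : Prop where
  path : ∀ x, ∃ τ : C(ℝ, X), τ 0 = x ∧ τ 1 = x₀
  null : ∀ γ : C(ℝ, X), γ 0 = x₀ → γ 1 = x₀ → ∃ N : C(ℝ × ℝ, X),
    (∀ t ∈ Icc (0 : ℝ) 1, N (0, t) = γ t ∧ N (1, t) = x₀) ∧
    ∀ s ∈ Icc (0 : ℝ) 1, N (s, 0) = x₀ ∧ N (s, 1) = x₀

lemma exists_square_of_simplyConn (hX : SimplyConn X x₀) (τ : X → C(ℝ, X))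
    (hτ0 : ∀ x, τ x 0 = x) (hτ1 : ∀ x s, 1 / 2 ≤ s → τ x s = x₀) (e : C(ℝ, X)) :
    ∃ h : C(ℝ × ℝ, X), (∀ t ∈ Icc (0 : ℝ) 1, h (0, t) = e t ∧ h (1, t) = x₀) ∧
      ∀ s ∈ Icc (0 : ℝ) 1, h (s, 0) = τ (e 0) s ∧ h (s, 1) = τ (e 1) s := by
  obtain ⟨G, hG⟩ := exists_filling (1 : ℝ)
    ![{q : ℝ × ℝ | q.1 = 0}, {q : ℝ × ℝ | q.2 = 0}, {q : ℝ × ℝ | q.2 = 1}]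
    (by
      intro i
      fin_cases i
      exacts [isClosed_eq continuous_fst continuous_const,
        isClosed_eq continuous_snd continuous_const, isClosed_eq continuous_snd continuous_const])
    ![⟨fun q => e q.2, by fun_prop⟩, ⟨fun q => τ (e 0) (q.1 / 2), by fun_prop⟩,
      ⟨fun q => τ (e 1) (q.1 / 2), by fun_prop⟩]
    (by
      rintro ⟨s, t⟩ hq
      rw [mem_openBox_one] at hq
      rw [mem_iUnion]
      rcases hq with h | ⟨-, h | h⟩
      exacts [⟨0, h.1⟩, ⟨1, h⟩, ⟨2, h⟩])
    (by
      rintro i j ⟨s, t⟩ - hi hj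
      fin_cases i <;> fin_cases j <;> simp at hi hj ⊢ <;> subst_vars <;> simp_all)
  have g0 : ∀ t ∈ Icc (0 : ℝ) 1, G (0, t) = e t := fun t ht =>
    hG 0 (0, t) (mem_openBox_one.2 (Or.inl ⟨rfl, ht⟩)) rfl
  have gl : ∀ s ∈ Icc (0 : ℝ) 1, G (s, 0) = τ (e 0) (s / 2) := fun s hs =>
    hG 1 (s, 0) (mem_openBox_one.2 (Or.inr ⟨hs, Or.inl rfl⟩)) rfl
  have gr : ∀ s ∈ Icc (0 : ℝ) 1, G (s, 1) = τ (e 1) (s / 2) := fun s hs =>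
    hG 2 (s, 1) (mem_openBox_one.2 (Or.inr ⟨hs, Or.inr rfl⟩)) rfl
  obtain ⟨N, hN1, hN2⟩ := hX.null ⟨fun t => G (1, max 0 (min 1 t)), by fun_prop⟩
    (by simp [gl 1, hτ1]) (by simp [gr 1, hτ1])
  let C : ℝ → ℝ := fun t => max 0 (min 1 t)
  have hC : Continuous C := by fun_prop
  have hCe : ∀ t ∈ Icc (0 : ℝ) 1, C t = t := fun t ht => by
    simp only [C]; rw [min_eq_right ht.2, max_eq_right ht.1]
  have hCm : ∀ t, C t ∈ Icc (0 : ℝ) 1 := fun t =>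
    ⟨le_max_left _ _, max_le zero_le_one (min_le_left _ _)⟩
  refine ⟨⟨fun q => if q.1 ≤ 1 / 2 then G (2 * q.1, C q.2) else N (2 * q.1 - 1, C q.2),
    Continuous.if_le (by fun_prop) (by fun_prop) continuous_fst continuous_const ?_⟩, ?_, ?_⟩
  · rintro ⟨s, t⟩ hs
    simp only at hs
    subst hs
    norm_num
    have := (hN1 _ (hCm t)).1
    simp only [ContinuousMap.coe_mk] at this
    rw [this]
    change _ = G (1, C (C t))
    rw [hCe _ (hCm t)]
  · intro t ht
    simp only [ContinuousMap.coe_mk, hCe t ht]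
    norm_num
    exact ⟨g0 t ht, (hN1 t ht).2⟩
  · intro s hs
    simp only [ContinuousMap.coe_mk, hCe 0 (by simp), hCe 1 (by simp)]
    split_ifs with h
    · rw [gl _ ⟨by linarith [hs.1], by linarith⟩, gr _ ⟨by linarith [hs.1], by linarith⟩]
      simp
    · rw [hτ1 _ s (by linarith), hτ1 _ s (by linarith)]
      exact hN2 _ ⟨by linarith, by linarith [hs.2]⟩

lemma nonempty_straightening (hX : SimplyConn X x₀) : Nonempty (Straightening X x₀) := by
  classical
  have hτ : ∀ x, ∃ τ : C(ℝ, X), τ 0 = x ∧ (∀ s, 1 / 2 ≤ s → τ s = x₀) ∧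
      (x = x₀ → ∀ s, τ s = x₀) := fun x => by
    by_cases hx : x = x₀
    · exact ⟨ContinuousMap.const ℝ x₀, by simp [hx], by simp, by simp⟩
    · obtain ⟨τ, h0, h1⟩ := hX.path x
      refine ⟨⟨fun s => τ (min 1 (2 * s)), by fun_prop⟩, by simp [h0], fun s hs => ?_,
        fun h => absurd h hx⟩
      simp only [ContinuousMap.coe_mk]
      rw [min_eq_left (by linarith), h1]
  choose τ h0 h1 hb using hτ
  choose h hh1 hh2 using exists_square_of_simplyConn hX τ h0 h1
  refine ⟨⟨τ, fun e => if e = ContinuousMap.const ℝ (e 0) then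
    ⟨fun q => τ (e 0) q.1, by fun_prop⟩ else h e, fun s _ => hb _ rfl s, ?_, ?_, ?_, ?_, ?_⟩⟩
  · intro e t ht
    split_ifs with he
    · rw [he]; simp [h0]
    · exact (hh1 e t ht).1
  · intro e t ht
    split_ifs with he
    · exact h1 _ 1 (by norm_num)
    · exact (hh1 e t ht).2
  · intro e s hs
    split_ifs with he
    · rfl
    · exact (hh2 e s hs).1
  · intro e s hs
    split_ifs with he
    · rw [he]; rfl
    · exact (hh2 e s hs).2
  · intro x s _ t _
    simp

variable (S : Straightening X x₀)

/-- `H` deforms the square `σ` to one with constant boundary, as prescribed by `S`. -/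
structure IsFiller (σ : C(ℝ × ℝ, X)) (H : C(ℝ × ℝ × ℝ, X)) : Prop where
  zero : ∀ x ∈ Icc (0 : ℝ) 1, ∀ y ∈ Icc (0 : ℝ) 1, H (0, x, y) = σ (x, y)
  left : ∀ s ∈ Icc (0 : ℝ) 1, ∀ t ∈ Icc (0 : ℝ) 1,
    H (s, 0, t) = S.h ⟨fun t => σ (0, t), by fun_prop⟩ (s, t)
  right : ∀ s ∈ Icc (0 : ℝ) 1, ∀ t ∈ Icc (0 : ℝ) 1,
    H (s, 1, t) = S.h ⟨fun t => σ (1, t), by fun_prop⟩ (s, t)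
  bot : ∀ s ∈ Icc (0 : ℝ) 1, ∀ t ∈ Icc (0 : ℝ) 1,
    H (s, t, 0) = S.h ⟨fun t => σ (t, 0), by fun_prop⟩ (s, t)
  top : ∀ s ∈ Icc (0 : ℝ) 1, ∀ t ∈ Icc (0 : ℝ) 1,
    H (s, t, 1) = S.h ⟨fun t => σ (t, 1), by fun_prop⟩ (s, t)

variable {S}

lemma IsFiller.bdryConst {σ : C(ℝ × ℝ, X)} {H : C(ℝ × ℝ × ℝ, X)} (hH : IsFiller S σ H) :
    BdryConst x₀ fun p : ℝ × ℝ => H (1, p) := by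
  intro x hx y hy h
  have h1 : (1 : ℝ) ∈ Icc (0 : ℝ) 1 := by simp
  change H (1, x, y) = x₀
  rcases h with rfl | rfl | rfl | rfl
  · rw [hH.left 1 h1 y hy, S.h_one _ y hy]
  · rw [hH.right 1 h1 y hy, S.h_one _ y hy]
  · rw [hH.bot 1 h1 x hx, S.h_one _ x hx]
  · rw [hH.top 1 h1 x hx, S.h_one _ x hx]

lemma IsFiller.eq_of_mem {σ : C(ℝ × ℝ, X)} {H H' : C(ℝ × ℝ × ℝ, X)} (hH : IsFiller S σ H)
    (hH' : IsFiller S σ H') {q : ℝ × ℝ × ℝ} (hq : q ∈ openBox (1 : ℝ × ℝ)) : H q = H' q := by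
  obtain ⟨s, x, y⟩ := q
  rcases mem_openBox_two.1 hq with ⟨rfl, hx, hy⟩ | ⟨hs, hx, hy, rfl | rfl | rfl | rfl⟩
  · rw [hH.zero x hx y hy, hH'.zero x hx y hy]
  · rw [hH.left s hs y hy, hH'.left s hs y hy]
  · rw [hH.right s hs y hy, hH'.right s hs y hy]
  · rw [hH.bot s hs x hx, hH'.bot s hs x hx]
  · rw [hH.top s hs x hx, hH'.top s hs x hx]

lemma IsFiller.cl_eq {σ : C(ℝ × ℝ, X)} {H H' : C(ℝ × ℝ × ℝ, X)} (hH : IsFiller S σ H)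
    (hH' : IsFiller S σ H') :
    cl x₀ ⟨fun p => H (1, p), by fun_prop⟩ = cl x₀ ⟨fun p => H' (1, p), by fun_prop⟩ := by
  obtain ⟨r, hr, hr'⟩ := exists_retraction_openBox (1 : ℝ × ℝ)
  have key : ∀ H : C(ℝ × ℝ × ℝ, X), IsFiller S σ H → cl x₀ ⟨fun p => H (1, p), by fun_prop⟩ =
      cl x₀ ⟨fun p => H (r (1, p)), by fun_prop⟩ := fun H hH => by
    refine cl_homotopy ⟨fun p => H ((1 - p.1) • (1, p.2) + p.1 • r (1, p.2)), by fun_prop⟩ ?_ _ _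
      (fun x _ y _ => by simp only [ContinuousMap.coe_mk, sub_zero, one_smul, zero_smul, add_zero])
      (fun x _ y _ => by simp only [ContinuousMap.coe_mk, sub_self, zero_smul, zero_add, one_smul])
    intro s hs x hx y hy h
    have : r (1, x, y) = (1, x, y) := hr' _ (mem_openBox_two.2 (Or.inr ⟨by simp, hx, hy, h⟩))
    simp only [ContinuousMap.coe_mk, this]
    rw [← add_smul, sub_add_cancel, one_smul]
    exact hH.bdryConst x hx y hy h
  rw [key H hH, key H' hH']
  congr 2
  ext p
  exact hH.eq_of_mem hH' (hr _)

variable (S)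

lemma exists_isFiller (σ : C(ℝ × ℝ, X)) : ∃ H, IsFiller S σ H := by
  have hI : ∀ {x : ℝ}, (x = 0 ∨ x = 1) → x ∈ Icc (0 : ℝ) 1 := by rintro x (rfl | rfl) <;> simp
  obtain ⟨H, hH⟩ := exists_filling (1 : ℝ × ℝ)
    ![{q : ℝ × ℝ × ℝ | q.1 = 0}, {q | q.2.1 = 0}, {q | q.2.1 = 1}, {q | q.2.2 = 0}, {q | q.2.2 = 1}]
    (by
      intro i
      fin_cases i
      exacts [isClosed_eq continuous_fst continuous_const,
        isClosed_eq (by fun_prop) continuous_const, isClosed_eq (by fun_prop) continuous_const,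
        isClosed_eq (by fun_prop) continuous_const, isClosed_eq (by fun_prop) continuous_const])
    ![⟨fun q => σ q.2, by fun_prop⟩,
      ⟨fun q => S.h ⟨fun t => σ (0, t), by fun_prop⟩ (q.1, q.2.2), by fun_prop⟩,
      ⟨fun q => S.h ⟨fun t => σ (1, t), by fun_prop⟩ (q.1, q.2.2), by fun_prop⟩,
      ⟨fun q => S.h ⟨fun t => σ (t, 0), by fun_prop⟩ (q.1, q.2.1), by fun_prop⟩,
      ⟨fun q => S.h ⟨fun t => σ (t, 1), by fun_prop⟩ (q.1, q.2.1), by fun_prop⟩]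
    (by
      rintro ⟨s, x, y⟩ hq
      rw [mem_openBox_two] at hq
      rw [mem_iUnion]
      rcases hq with h | ⟨-, -, -, h | h | h | h⟩
      exacts [⟨0, h.1⟩, ⟨1, h⟩, ⟨2, h⟩, ⟨3, h⟩, ⟨4, h⟩])
    (by
      rintro i j ⟨s, x, y⟩ hq hi hj
      have hs : s ∈ Icc (0 : ℝ) 1 ∧ x ∈ Icc (0 : ℝ) 1 ∧ y ∈ Icc (0 : ℝ) 1 := by
        rcases mem_openBox_two.1 hq with ⟨rfl, h1, h2⟩ | ⟨h0, h1, h2, -⟩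
        exacts [⟨by simp, h1, h2⟩, ⟨h0, h1, h2⟩]
      obtain ⟨hs, hx, hy⟩ := hs
      fin_cases i <;> fin_cases j <;> simp at hi hj ⊢ <;> subst_vars <;>
        simp_all [S.h_zero, S.h_left, S.h_right])
  refine ⟨H, ?_, ?_, ?_, ?_, ?_⟩
  · exact fun x hx y hy => hH 0 (0, x, y) (mem_openBox_two.2 (Or.inl ⟨rfl, hx, hy⟩)) rfl
  · exact fun s hs t ht => hH 1 (s, 0, t) (mem_openBox_two.2 (Or.inr ⟨hs, by simp, ht, by simp⟩)) rfl
  · exact fun s hs t ht => hH 2 (s, 1, t) (mem_openBox_two.2 (Or.inr ⟨hs, by simp, ht, by simp⟩)) rfl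
  · exact fun s hs t ht => hH 3 (s, t, 0) (mem_openBox_two.2 (Or.inr ⟨hs, ht, by simp, by simp⟩)) rfl
  · exact fun s hs t ht => hH 4 (s, t, 1) (mem_openBox_two.2 (Or.inr ⟨hs, ht, by simp, by simp⟩)) rfl

end Cocycle

section CocycleExistence

variable {X : Type*} [TopologicalSpace X] {x₀ : X}

/-- A normalized cubical `2`-cocycle. -/
structure IsCocycle {A : Type*} [AddCommGroup A] (c : C(ℝ × ℝ, X) → A) : Prop where
  fst : ∀ e : C(ℝ, X), c ⟨fun p => e p.1, by fun_prop⟩ = 0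
  snd : ∀ e : C(ℝ, X), c ⟨fun p => e p.2, by fun_prop⟩ = 0
  cube : ∀ Q : C(ℝ × ℝ × ℝ, X),
    c ⟨fun p => Q (0, p.1, p.2), by fun_prop⟩ - c ⟨fun p => Q (1, p.1, p.2), by fun_prop⟩ -
      c ⟨fun p => Q (p.1, 0, p.2), by fun_prop⟩ + c ⟨fun p => Q (p.1, 1, p.2), by fun_prop⟩ +
      c ⟨fun p => Q (p.1, p.2, 0), by fun_prop⟩ - c ⟨fun p => Q (p.1, p.2, 1), by fun_prop⟩ = 0

lemma exists_cube_filler (S : Straightening X x₀) (Q : C(ℝ × ℝ × ℝ, X))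
    (T₀ T₁ U₀ U₁ V₀ V₁ : C(ℝ × ℝ × ℝ, X))
    (hT₀ : IsFiller S ⟨fun p => Q (0, p.1, p.2), by fun_prop⟩ T₀)
    (hT₁ : IsFiller S ⟨fun p => Q (1, p.1, p.2), by fun_prop⟩ T₁)
    (hU₀ : IsFiller S ⟨fun p => Q (p.1, 0, p.2), by fun_prop⟩ U₀)
    (hU₁ : IsFiller S ⟨fun p => Q (p.1, 1, p.2), by fun_prop⟩ U₁)
    (hV₀ : IsFiller S ⟨fun p => Q (p.1, p.2, 0), by fun_prop⟩ V₀)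
    (hV₁ : IsFiller S ⟨fun p => Q (p.1, p.2, 1), by fun_prop⟩ V₁) :
    ∃ H : C(ℝ × ℝ × ℝ × ℝ, X), ∀ s ∈ Icc (0 : ℝ) 1, ∀ x ∈ Icc (0 : ℝ) 1, ∀ y ∈ Icc (0 : ℝ) 1,
      (H (s, 0, x, y) = T₀ (s, x, y) ∧ H (s, 1, x, y) = T₁ (s, x, y)) ∧
      (H (s, x, 0, y) = U₀ (s, x, y) ∧ H (s, x, 1, y) = U₁ (s, x, y)) ∧
      (H (s, x, y, 0) = V₀ (s, x, y) ∧ H (s, x, y, 1) = V₁ (s, x, y)) := by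
  obtain ⟨H, hH⟩ := exists_filling (1 : ℝ × ℝ × ℝ)
    ![{q : ℝ × ℝ × ℝ × ℝ | q.1 = 0}, {q | q.2.1 = 0}, {q | q.2.1 = 1}, {q | q.2.2.1 = 0},
      {q | q.2.2.1 = 1}, {q | q.2.2.2 = 0}, {q | q.2.2.2 = 1}]
    (by
      intro i
      fin_cases i
      exacts [isClosed_eq continuous_fst continuous_const,
        isClosed_eq (by fun_prop) continuous_const, isClosed_eq (by fun_prop) continuous_const,
        isClosed_eq (by fun_prop) continuous_const, isClosed_eq (by fun_prop) continuous_const,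
        isClosed_eq (by fun_prop) continuous_const, isClosed_eq (by fun_prop) continuous_const])
    ![⟨fun q => Q q.2, by fun_prop⟩,
      ⟨fun q => T₀ (q.1, q.2.2), by fun_prop⟩,
      ⟨fun q => T₁ (q.1, q.2.2), by fun_prop⟩,
      ⟨fun q => U₀ (q.1, q.2.1, q.2.2.2), by fun_prop⟩,
      ⟨fun q => U₁ (q.1, q.2.1, q.2.2.2), by fun_prop⟩,
      ⟨fun q => V₀ (q.1, q.2.1, q.2.2.1), by fun_prop⟩,
      ⟨fun q => V₁ (q.1, q.2.1, q.2.2.1), by fun_prop⟩]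
    (by
      rintro ⟨s, t, x, y⟩ hq
      rw [mem_openBox_three] at hq
      rw [mem_iUnion]
      rcases hq with h | ⟨-, -, -, -, h | h | h | h | h | h⟩
      exacts [⟨0, h.1⟩, ⟨1, h⟩, ⟨2, h⟩, ⟨3, h⟩, ⟨4, h⟩, ⟨5, h⟩, ⟨6, h⟩])
    (by
      rintro i j ⟨s, t, x, y⟩ hq hi hj
      have hs : s ∈ Icc (0 : ℝ) 1 ∧ t ∈ Icc (0 : ℝ) 1 ∧ x ∈ Icc (0 : ℝ) 1 ∧ y ∈ Icc (0 : ℝ) 1 := by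
        rcases mem_openBox_three.1 hq with ⟨rfl, h1, h2, h3⟩ | ⟨h0, h1, h2, h3, -⟩
        exacts [⟨by simp, h1, h2, h3⟩, ⟨h0, h1, h2, h3⟩]
      clear hq
      obtain ⟨hs, ht, hx, hy⟩ := hs
      fin_cases i <;> fin_cases j <;> simp at hi hj ⊢ <;> subst_vars <;>
        first
        | (exfalso; revert hj; norm_num)
        | simp [hT₀.zero, hT₁.zero, hU₀.zero, hU₁.zero, hV₀.zero, hV₁.zero, ht, hx, hy,
            -mem_Icc]
        | simp [hT₀.left, hT₁.left, hU₀.left, hU₁.left, hV₀.left, hV₁.left, hT₀.right, hT₁.right,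
            hU₀.right, hU₁.right, hV₀.right, hV₁.right, hT₀.bot, hT₁.bot, hU₀.bot, hU₁.bot, hV₀.bot,
            hV₁.bot, hT₀.top, hT₁.top, hU₀.top, hU₁.top, hV₀.top, hV₁.top, hs, ht, hx, hy, -mem_Icc])
  have key : ∀ s ∈ Icc (0 : ℝ) 1, ∀ t ∈ Icc (0 : ℝ) 1, ∀ x ∈ Icc (0 : ℝ) 1, ∀ y ∈ Icc (0 : ℝ) 1,
      (t = 0 ∨ t = 1 ∨ x = 0 ∨ x = 1 ∨ y = 0 ∨ y = 1) → (s, t, x, y) ∈ openBox (1 : ℝ × ℝ × ℝ) :=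
    fun s hs t ht x hx y hy h => mem_openBox_three.2 (Or.inr ⟨hs, ht, hx, hy, h⟩)
  exact ⟨H, fun s hs x hx y hy =>
    ⟨⟨hH 1 _ (key s hs 0 (by simp) x hx y hy (by simp)) rfl,
      hH 2 _ (key s hs 1 (by simp) x hx y hy (by simp)) rfl⟩,
    ⟨hH 3 _ (key s hs x hx 0 (by simp) y hy (by simp)) rfl,
      hH 4 _ (key s hs x hx 1 (by simp) y hy (by simp)) rfl⟩,
    ⟨hH 5 _ (key s hs x hx y hy 0 (by simp) (by simp)) rfl,
      hH 6 _ (key s hs x hx y hy 1 (by simp) (by simp)) rfl⟩⟩⟩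

theorem exists_cocycle (hX : SimplyConn X x₀) :
    ∃ c : C(ℝ × ℝ, X) → Additive (π_ 2 X x₀), IsCocycle c ∧
      ∀ g : C(ℝ × ℝ, X), (∀ t, g (0, t) = x₀ ∧ g (1, t) = x₀ ∧ g (t, 0) = x₀ ∧ g (t, 1) = x₀) →
        c g = cl x₀ g := by
  obtain ⟨S⟩ := nonempty_straightening hX
  choose F hF using exists_isFiller S
  have h1 : (1 : ℝ) ∈ Icc (0 : ℝ) 1 := by simp
  refine ⟨fun σ => cl x₀ ⟨fun p => F σ (1, p), by fun_prop⟩, ⟨fun e => ?_, fun e => ?_, fun Q => ?_⟩,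
    fun g hg => ?_⟩
  · have h : IsFiller S ⟨fun p => e p.1, by fun_prop⟩ ⟨fun q => S.h e (q.1, q.2.1), by fun_prop⟩ := by
      refine ⟨fun x hx y hy => S.h_zero e x hx, fun s hs t ht => ?_, fun s hs t ht => ?_,
        fun s _ t _ => rfl, fun s _ t _ => rfl⟩
      · exact (S.h_left e s hs).trans (S.h_const (e 0) s hs t ht).symm
      · exact (S.h_right e s hs).trans (S.h_const (e 1) s hs t ht).symm
    rw [(hF _).cl_eq h]
    exact cl_const _ fun x hx y hy => S.h_one e x hx
  · have h : IsFiller S ⟨fun p => e p.2, by fun_prop⟩ ⟨fun q => S.h e (q.1, q.2.2), by fun_prop⟩ := by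
      refine ⟨fun x hx y hy => S.h_zero e y hy, fun s _ t _ => rfl, fun s _ t _ => rfl,
        fun s hs t ht => ?_, fun s hs t ht => ?_⟩
      · exact (S.h_left e s hs).trans (S.h_const (e 0) s hs t ht).symm
      · exact (S.h_right e s hs).trans (S.h_const (e 1) s hs t ht).symm
    rw [(hF _).cl_eq h]
    exact cl_const _ fun x hx y hy => S.h_one e y hy
  · obtain ⟨H, hH⟩ := exists_cube_filler S Q _ _ _ _ _ _ (hF _) (hF _) (hF _) (hF _) (hF _) (hF _)
    have hb := fun σ => (hF σ).bdryConst
    rw [← cl_cube (x₀ := x₀) ⟨fun q => H (1, q), by fun_prop⟩]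
    · simp only [ContinuousMap.coe_mk]
      congr 1
      · congr 1
        · congr 1
          · congr 1
            · congr 1
              · exact cl_congr (hb _) fun x hx y hy => (hH 1 h1 x hx y hy).1.1.symm
              · exact cl_congr (hb _) fun x hx y hy => (hH 1 h1 x hx y hy).1.2.symm
            · exact cl_congr (hb _) fun x hx y hy => (hH 1 h1 x hx y hy).2.1.1.symm
          · exact cl_congr (hb _) fun x hx y hy => (hH 1 h1 x hx y hy).2.1.2.symm
        · exact cl_congr (hb _) fun x hx y hy => (hH 1 h1 x hx y hy).2.2.1.symm
      · exact cl_congr (hb _) fun x hx y hy => (hH 1 h1 x hx y hy).2.2.2.symm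
    · rintro t ht x hx y hy (⟨rfl | rfl, h⟩ | ⟨rfl | rfl, h⟩ | ⟨rfl | rfl, h⟩)
      · exact ((hH 1 h1 x hx y hy).1.1).trans (hb _ x hx y hy (by tauto))
      · exact ((hH 1 h1 x hx y hy).1.2).trans (hb _ x hx y hy (by tauto))
      · exact ((hH 1 h1 x hx y hy).1.1).trans (hb _ x hx y hy (by tauto))
      · exact ((hH 1 h1 x hx y hy).1.2).trans (hb _ x hx y hy (by tauto))
      · exact ((hH 1 h1 t ht y hy).2.1.1).trans (hb _ t ht y hy (by tauto))
      · exact ((hH 1 h1 t ht y hy).2.1.2).trans (hb _ t ht y hy (by tauto))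
  · have hc : ∀ e : C(ℝ, X), (∀ t, e t = x₀) → ∀ s ∈ Icc (0 : ℝ) 1, ∀ t ∈ Icc (0 : ℝ) 1,
        x₀ = S.h e (s, t) := fun e he s hs t ht => by
      have : e = ContinuousMap.const ℝ x₀ := by ext t; exact he t
      rw [this, S.h_const _ s hs t ht, S.τ_base s hs]
    have h : IsFiller S g ⟨fun q => g q.2, by fun_prop⟩ := by
      refine ⟨fun x _ y _ => rfl, fun s hs t ht => ?_, fun s hs t ht => ?_, fun s hs t ht => ?_,
        fun s hs t ht => ?_⟩
      · exact (hg t).1.trans (hc _ (fun t => (hg t).1) s hs t ht)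
      · exact (hg t).2.1.trans (hc _ (fun t => (hg t).2.1) s hs t ht)
      · exact (hg t).2.2.1.trans (hc _ (fun t => (hg t).2.2.1) s hs t ht)
      · exact (hg t).2.2.2.trans (hc _ (fun t => (hg t).2.2.2) s hs t ht)
    exact (hF _).cl_eq h

end CocycleExistence

section Primitives

variable {X : Type*} [TopologicalSpace X] {T : Type*} [TopologicalSpace T]
  {A : Type*} [AddCommGroup A]

/-- The map `κ` is locally constant on `Y` and its fibers in `Y` are contractible. -/
structure ContractibleFibers (Y : Set X) (κ : X → T) (H : ℝ × X → X) : Prop where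
  cont : ContinuousOn κ Y
  contH : ContinuousOn H (univ ×ˢ Y)
  zero : ∀ x ∈ Y, H (0, x) = x
  one : ∀ x ∈ Y, ∀ x' ∈ Y, κ x = κ x' → H (1, x) = H (1, x')
  mem : ∀ s, ∀ x ∈ Y, H (s, x) ∈ Y

variable {Y : Set X} {κ : X → T} {H : ℝ × X → X}

lemma ContractibleFibers.continuous_comp (hY : ContractibleFibers Y κ H) {B : Type*}
    [TopologicalSpace B] {a : B → ℝ} {f : B → X} (ha : Continuous a) (hf : Continuous f)
    (hfY : ∀ b, f b ∈ Y) : Continuous fun b => H (a b, f b) :=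
  hY.contH.comp_continuous (ha.prodMk hf) fun b => ⟨mem_univ _, hfY b⟩

lemma ContractibleFibers.const_one [DiscreteTopology T] (hY : ContractibleFibers Y κ H) {B : Type*}
    [TopologicalSpace B] [PreconnectedSpace B] {f : B → X} (hf : Continuous f)
    (hfY : ∀ b, f b ∈ Y) (b b' : B) : H (1, f b) = H (1, f b') :=
  hY.one _ (hfY b) _ (hfY b') <|
    PreconnectedSpace.constant inferInstance (hY.cont.comp_continuous hf hfY)

/-- The coboundary of a function on paths. -/
def coboundary (η : C(ℝ, X) → A) (σ : C(ℝ × ℝ, X)) : A :=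
  η ⟨fun t => σ (t, 0), by fun_prop⟩ + η ⟨fun t => σ (1, t), by fun_prop⟩ -
    η ⟨fun t => σ (t, 1), by fun_prop⟩ - η ⟨fun t => σ (0, t), by fun_prop⟩

lemma exists_primitive_two [DiscreteTopology T] (hY : ContractibleFibers Y κ H) {c : C(ℝ × ℝ, X) → A}
    (hc : IsCocycle c) : ∃ η : C(ℝ, X) → A, (∀ x, η (ContinuousMap.const ℝ x) = 0) ∧
      ∀ σ : C(ℝ × ℝ, X), (∀ p, σ p ∈ Y) → c σ = coboundary η σ := by
  classical
  refine ⟨fun e => if he : ∀ t, e t ∈ Y then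
    - c ⟨fun p => H (p.1, e p.2), hY.continuous_comp (by fun_prop) (by fun_prop) fun p => he _⟩
    else 0, fun x => ?_, fun σ hσ => ?_⟩
  · dsimp only
    split_ifs with he
    · rw [neg_eq_zero]
      exact hc.fst ⟨fun s => H (s, x), hY.continuous_comp continuous_id continuous_const fun _ => he 0⟩
    · rfl
  · have key := hc.cube ⟨fun q => H (q.1, σ q.2),
      hY.continuous_comp (by fun_prop) (by fun_prop) fun q => hσ _⟩
    have h0 : (⟨fun p => H (0, σ (p.1, p.2)),
        hY.continuous_comp (by fun_prop) (by fun_prop) fun q => hσ _⟩ : C(ℝ × ℝ, X)) = σ := by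
      ext p; exact hY.zero _ (hσ p)
    have h1 : c (⟨fun p => H (1, σ (p.1, p.2)),
        hY.continuous_comp (by fun_prop) (by fun_prop) fun q => hσ _⟩ : C(ℝ × ℝ, X)) = 0 := by
      rw [← hc.fst (ContinuousMap.const ℝ (H (1, σ 0)))]
      congr 1
      ext p
      exact hY.const_one σ.continuous hσ p 0
    simp only [ContinuousMap.coe_mk, h0, h1] at key
    simp only [coboundary, ContinuousMap.coe_mk, hσ, implies_true, dite_true]
    rw [← sub_eq_zero, ← key]
    abel

lemma exists_primitive_one [DiscreteTopology T] (hY : ContractibleFibers Y κ H) {θ : C(ℝ, X) → A}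
    (h0 : ∀ x, θ (ContinuousMap.const ℝ x) = 0)
    (hθ : ∀ σ : C(ℝ × ℝ, X), (∀ p, σ p ∈ Y) → coboundary θ σ = 0) :
    ∃ ξ : X → A, ∀ e : C(ℝ, X), (∀ t, e t ∈ Y) → θ e = ξ (e 1) - ξ (e 0) := by
  classical
  refine ⟨fun x => if hx : x ∈ Y then
    - θ ⟨fun s => H (s, x), hY.continuous_comp continuous_id continuous_const fun _ => hx⟩ else 0,
    fun e he => ?_⟩
  have key := hθ ⟨fun p => H (p.1, e p.2), hY.continuous_comp (by fun_prop) (by fun_prop) fun _ => he _⟩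
    fun p => hY.mem _ _ (he _)
  have e0 : (⟨fun t => H (0, e t), hY.continuous_comp (by fun_prop) (by fun_prop) fun _ => he _⟩ :
      C(ℝ, X)) = e := by
    ext p; exact hY.zero _ (he p)
  have e1 : θ (⟨fun t => H (1, e t), hY.continuous_comp (by fun_prop) (by fun_prop) fun _ => he _⟩ :
      C(ℝ, X)) = 0 := by
    rw [← h0 (H (1, e 0))]
    congr 1
    ext p
    exact hY.const_one e.continuous he p 0
  simp only [coboundary, ContinuousMap.coe_mk, e0, e1] at key
  simp only [he, dite_true]
  rw [← sub_eq_zero, ← neg_eq_zero, ← key]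
  abel

lemma exists_primitive_zero {B : Type*} [Nonempty B] (hY : ContractibleFibers Y κ H) {ξ : X → B}
    (hξ : ∀ e : C(ℝ, X), (∀ t, e t ∈ Y) → ξ (e 0) = ξ (e 1)) :
    ∃ G : T → B, ∀ x ∈ Y, ξ x = G (κ x) := by
  classical
  refine ⟨fun k => if h : ∃ x ∈ Y, κ x = k then ξ h.choose else Classical.arbitrary B, fun x hx => ?_⟩
  have h : ∃ x' ∈ Y, κ x' = κ x := ⟨x, hx, rfl⟩
  simp only [dif_pos h]
  have key : ∀ x ∈ Y, ξ x = ξ (H (1, x)) := fun x hx => by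
    have := hξ ⟨fun s => H (s, x), hY.continuous_comp continuous_id continuous_const fun _ => hx⟩
      fun s => hY.mem _ _ hx
    simpa [hY.zero x hx] using this
  rw [key x hx, key _ h.choose_spec.1, hY.one _ hx _ h.choose_spec.1 h.choose_spec.2.symm]

end Primitives

section Cover

variable {X : Type*} [TopologicalSpace X] {A : Type*} [AddCommGroup A]

/-- Three open sets covering `X`, with integer-valued locally constant functions on them, such that
the fibers of these functions on all intersections are contractible and nonempty. -/
structure GoodCover (U : Fin 3 → Set X) (K : Fin 3 → X → ℤ) : Prop where
  isOpen : ∀ j, IsOpen (U j)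
  cover : ∀ x, ∃ j, x ∈ U j
  cont : ∀ j, ContinuousOn (K j) (U j)
  contractible : ∀ J : Finset (Fin 3), J.Nonempty → ∃ H : ℝ × X → X,
    ContractibleFibers {x | ∀ j ∈ J, x ∈ U j} (fun x j => if j ∈ J then K j x else 0) H
  nonempty : ∀ k : Fin 3 → ℤ, ∃ x, ∀ j, x ∈ U j ∧ K j x = k j

variable {U : Fin 3 → Set X} {K : Fin 3 → X → ℤ}

lemma GoodCover.exists_primitives (hU : GoodCover U K) {c : C(ℝ × ℝ, X) → A} (hc : IsCocycle c) :
    ∃ (η : Fin 3 → C(ℝ, X) → A) (ξ : Fin 3 → Fin 3 → X → A) (G : (Fin 3 → ℤ) → A),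
      (∀ j x, η j (ContinuousMap.const ℝ x) = 0) ∧
      (∀ j σ, (∀ p, σ p ∈ U j) → c σ = coboundary (η j) σ) ∧
      (∀ i j e, (∀ t, e t ∈ U i) → (∀ t, e t ∈ U j) →
        η i e - η j e = ξ i j (e 1) - ξ i j (e 0)) ∧
      (∀ i j x, ξ i j x = - ξ j i x) ∧ (∀ i x, ξ i i x = 0) ∧
      ∀ x, (∀ j, x ∈ U j) → ξ 0 1 x + ξ 1 2 x - ξ 0 2 x = G fun j => K j x := by
  have hη : ∀ j : Fin 3, ∃ η : C(ℝ, X) → A, (∀ x, η (ContinuousMap.const ℝ x) = 0) ∧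
      ∀ σ : C(ℝ × ℝ, X), (∀ p, σ p ∈ U j) → c σ = coboundary η σ := fun j => by
    obtain ⟨H, hH⟩ := hU.contractible {j} (by simp)
    obtain ⟨η, h0, h1⟩ := exists_primitive_two hH hc
    exact ⟨η, h0, fun σ hσ => h1 σ fun p => by simpa using hσ p⟩
  choose η hη0 hη using hη
  have hξ : ∀ i j : Fin 3, ∃ ξ : X → A, ∀ e : C(ℝ, X), (∀ t, e t ∈ U i) → (∀ t, e t ∈ U j) →
      η i e - η j e = ξ (e 1) - ξ (e 0) := fun i j => by
    obtain ⟨H, hH⟩ := hU.contractible {i, j} (by simp)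
    obtain ⟨ξ, h⟩ := exists_primitive_one hH (θ := fun e => η i e - η j e)
      (fun x => by simp [hη0]) fun σ hσ => by
        have hi := hη i σ fun p => hσ p i (by simp)
        have hj := hη j σ fun p => hσ p j (by simp)
        rw [hi, ← sub_eq_zero] at hj
        rw [← hj]
        simp only [coboundary]
        abel
    exact ⟨ξ, fun e hi hj => h e fun t l hl => by
      rcases Finset.mem_insert.1 hl with rfl | hl
      · exact hi t
      · rw [Finset.mem_singleton.1 hl]; exact hj t⟩
  choose ξ hξ using hξ
  obtain ⟨H, hH⟩ := hU.contractible Finset.univ (by simp)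
  obtain ⟨G, hG⟩ := exists_primitive_zero hH (ξ := fun x => ξ 0 1 x + ξ 1 2 x - ξ 0 2 x)
    fun e he => by
      have he' : ∀ j t, e t ∈ U j := fun j t => he t j (by simp)
      have h01 := hξ 0 1 e (he' 0) (he' 1)
      have h12 := hξ 1 2 e (he' 1) (he' 2)
      have h02 := hξ 0 2 e (he' 0) (he' 2)
      rw [eq_comm, ← sub_eq_zero]
      calc _ = (ξ 0 1 (e 1) - ξ 0 1 (e 0)) + (ξ 1 2 (e 1) - ξ 1 2 (e 0)) -
            (ξ 0 2 (e 1) - ξ 0 2 (e 0)) := by abel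
        _ = 0 := by rw [← h01, ← h12, ← h02]; abel
  refine ⟨η, fun i j x => if i < j then ξ i j x else if j < i then - ξ j i x else 0, G,
    hη0, hη, fun i j e hi hj => ?_, fun i j x => ?_, fun i x => by simp, fun x hx => ?_⟩
  · rcases lt_trichotomy i j with h | h | h
    · simp only [h, if_true]; exact hξ i j e hi hj
    · subst h; simp
    · simp only [h, h.not_gt, if_true, if_false]
      have := hξ j i e hj hi
      rw [← neg_sub, this]; abel
  · rcases lt_trichotomy i j with h | h | h
    · simp [h, h.not_gt]
    · subst h; simp
    · simp [h, h.not_gt]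
  · have := hG x fun j _ => hx j
    simpa using this

end Cover

section Subdivision

variable {X : Type*} [TopologicalSpace X] {A : Type*} [AddCommGroup A] {x₀ : X}

/-- The retraction of the real line onto the unit interval. -/
def clamp (t : ℝ) : ℝ := max 0 (min 1 t)

@[fun_prop]
lemma continuous_clamp : Continuous clamp := by unfold clamp; fun_prop

@[simp] lemma clamp_zero : clamp 0 = 0 := by simp [clamp]

@[simp] lemma clamp_one : clamp 1 = 1 := by simp [clamp]

/-- A rectangle of the map `g`, reparametrized by the unit square. -/
def rect (g : C(ℝ × ℝ, X)) (a b c d : ℝ) : C(ℝ × ℝ, X) :=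
  ⟨fun p => g (a + clamp p.1 * (b - a), c + clamp p.2 * (d - c)), by fun_prop⟩

/-- A degenerate square of the map `g` inside a horizontal line. -/
def degFst (g : C(ℝ × ℝ, X)) (a b b' y : ℝ) : C(ℝ × ℝ, X) :=
  ⟨fun p => g (a + clamp p.2 * (b - a + clamp p.1 * (b' - b)), y), by fun_prop⟩

/-- A degenerate square of the map `g` inside a vertical line. -/
def degSnd (g : C(ℝ × ℝ, X)) (a b b' x : ℝ) : C(ℝ × ℝ, X) :=
  ⟨fun p => g (x, a + clamp p.2 * (b - a + clamp p.1 * (b' - b))), by fun_prop⟩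

variable {c : C(ℝ × ℝ, X) → A}

lemma IsCocycle.const (hc : IsCocycle c) (σ : C(ℝ × ℝ, X)) (hσ : ∀ p, σ p = x₀) : c σ = 0 := by
  rw [← hc.fst (ContinuousMap.const ℝ x₀)]
  congr 1
  ext p
  exact hσ p

lemma IsCocycle.rect_fst (hc : IsCocycle c) (g : C(ℝ × ℝ, X)) (a b b' y y' : ℝ) :
    c (rect g a b' y y') = c (rect g a b y y') + c (rect g b b' y y') +
      c (degFst g a b b' y) - c (degFst g a b b' y') := by
  have key := hc.cube ⟨fun q => g (a + clamp q.2.1 * (b - a + clamp q.1 * (b' - b)),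
    y + clamp q.2.2 * (y' - y)), by fun_prop⟩
  have h := hc.snd ⟨fun t => g (a, y + clamp t * (y' - y)), by fun_prop⟩
  simp only [ContinuousMap.coe_mk, clamp_zero, clamp_one, zero_mul, one_mul, add_zero] at key h
  rw [h] at key
  have e1 : b - a + (b' - b) = b' - a := by ring
  have e2 : ∀ s, a + (b - a + s) = b + s := fun s => by ring
  have e3 : y + (y' - y) = y' := by ring
  simp only [e1, e2, e3] at key
  rw [← sub_eq_zero, ← neg_eq_zero, ← key]
  simp only [rect, degFst]
  abel

lemma IsCocycle.rect_snd (hc : IsCocycle c) (g : C(ℝ × ℝ, X)) (a b b' x x' : ℝ) :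
    c (rect g x x' a b') = c (rect g x x' a b) + c (rect g x x' b b') -
      c (degSnd g a b b' x) + c (degSnd g a b b' x') := by
  have key := hc.cube ⟨fun q => g (x + clamp q.1 * (x' - x),
    a + clamp q.2.2 * (b - a + clamp q.2.1 * (b' - b))), by fun_prop⟩
  have h := hc.fst ⟨fun t => g (x + clamp t * (x' - x), a), by fun_prop⟩
  simp only [ContinuousMap.coe_mk, clamp_zero, clamp_one, zero_mul, one_mul, add_zero] at key h
  rw [h] at key
  have e1 : b - a + (b' - b) = b' - a := by ring
  have e2 : ∀ s, a + (b - a + s) = b + s := fun s => by ring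
  have e3 : x + (x' - x) = x' := by ring
  simp only [e1, e2, e3] at key
  rw [← sub_eq_zero, ← key]
  simp only [rect, degSnd]
  abel

/-- The map `g` is constant outside the open unit square. -/
def ConstOutside (x₀ : X) (g : C(ℝ × ℝ, X)) : Prop :=
  ∀ x y, (x ≤ 0 ∨ 1 ≤ x ∨ y ≤ 0 ∨ 1 ≤ y) → g (x, y) = x₀

lemma clamp_cases (x : ℝ) : (x ≤ 0 ∧ clamp x = 0) ∨ (1 ≤ x ∧ clamp x = 1) ∨ clamp x = x := by
  unfold clamp
  rcases le_total x 0 with h | h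
  · left; exact ⟨h, by rw [max_eq_left]; exact (min_le_right _ _).trans h⟩
  rcases le_total 1 x with h' | h'
  · right; left; exact ⟨h', by rw [min_eq_left h']; simp⟩
  · right; right; rw [min_eq_right h', max_eq_right h]

lemma ConstOutside.rect_eq {g : C(ℝ × ℝ, X)} (hg : ConstOutside x₀ g) : rect g 0 1 0 1 = g := by
  ext ⟨x, y⟩
  simp only [rect, ContinuousMap.coe_mk, sub_zero, mul_one, zero_add]
  rcases clamp_cases x with ⟨h, e⟩ | ⟨h, e⟩ | e
  · rw [hg x y (by simp [h]), e, hg _ _ (by simp)]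
  · rw [hg x y (by simp [h]), e, hg _ _ (by simp)]
  rcases clamp_cases y with ⟨h, e'⟩ | ⟨h, e'⟩ | e'
  · rw [hg x y (by simp [h]), e', hg _ _ (by simp)]
  · rw [hg x y (by simp [h]), e', hg _ _ (by simp)]
  · rw [e, e']

lemma IsCocycle.eq_sum_rect (hc : IsCocycle c) {g : C(ℝ × ℝ, X)} (hg : ConstOutside x₀ g)
    (u v : ℕ → ℝ) (M N : ℕ) (hu : u 0 = 0) (hv : v 0 = 0) (huM : u M = 1) (hvN : v N = 1) :
    c g = ∑ n ∈ Finset.range N, ∑ m ∈ Finset.range M,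
      c (rect g (u m) (u (m + 1)) (v n) (v (n + 1))) := by
  have hrow : ∀ n k, c (rect g 0 1 (v n) (v k)) = ∑ m ∈ Finset.range M,
      (c (rect g (u m) (u (m + 1)) (v n) (v k)) + (c (degFst g 0 (u m) (u (m + 1)) (v n)) -
        c (degFst g 0 (u m) (u (m + 1)) (v k)))) := fun n k => by
    rw [← huM]
    generalize M = m
    induction m with
    | zero =>
      rw [hu, Finset.sum_range_zero]
      have h := hc.snd ⟨fun t => g (0, v n + clamp t * (v k - v n)), by fun_prop⟩
      convert h using 2
      ext p
      simp [rect]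
    | succ m ih => rw [Finset.sum_range_succ, ← ih, hc.rect_fst g 0 (u m)]; abel
  have hcol : c g = ∑ n ∈ Finset.range N, c (rect g 0 1 (v n) (v (n + 1))) := by
    suffices h : ∀ n, c (rect g 0 1 0 (v n)) =
        ∑ k ∈ Finset.range n, c (rect g 0 1 (v k) (v (k + 1))) by
      rw [← h N, hvN, hg.rect_eq]
    intro n
    induction n with
    | zero =>
      rw [hv, Finset.sum_range_zero]
      have h := hc.fst ⟨fun t => g (clamp t, 0), by fun_prop⟩
      convert h using 2
      ext p
      simp [rect]
    | succ n ih =>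
      rw [Finset.sum_range_succ, ← ih, hc.rect_snd g 0 (v n),
        hc.const (degSnd g _ _ _ 0) fun p => hg _ _ (by simp),
        hc.const (degSnd g _ _ _ 1) fun p => hg _ _ (by simp)]
      abel
  rw [hcol]
  simp only [hrow, Finset.sum_add_distrib, Finset.sum_sub_distrib]
  rw [add_eq_left, ← Finset.sum_sub_distrib,
    Finset.sum_range_sub' (fun n => ∑ m ∈ Finset.range M, c (degFst g 0 (u m) (u (m + 1)) (v n))) N,
    hv, hvN, ← Finset.sum_sub_distrib]
  exact Finset.sum_eq_zero fun m _ => by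
    rw [hc.const (degFst g _ _ _ 0) fun p => hg _ _ (by simp),
      hc.const (degFst g _ _ _ 1) fun p => hg _ _ (by simp), sub_zero]

end Subdivision

section Finsum

variable {B : Type*} [AddCommGroup B]

lemma finsum_eq_sum_range {f : ℤ × ℤ → B} {M N : ℕ}
    (hf : ∀ m n, f (m, n) ≠ 0 → 0 ≤ m ∧ m < M ∧ 0 ≤ n ∧ n < N) :
    ∑ᶠ p, f p = ∑ n ∈ Finset.range N, ∑ m ∈ Finset.range M, f ((m : ℤ), (n : ℤ)) := by
  rw [finsum_eq_sum_of_support_subset f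
    (s := (Finset.range M ×ˢ Finset.range N).image fun q : ℕ × ℕ => ((q.1 : ℤ), (q.2 : ℤ)))]
  · rw [Finset.sum_image, Finset.sum_product_right]
    rintro ⟨a, b⟩ - ⟨a', b'⟩ - h
    simpa using h
  · rintro ⟨m, n⟩ h
    obtain ⟨h1, h2, h3, h4⟩ := hf m n h
    simp only [Finset.coe_image, Set.mem_image, Finset.mem_coe, Finset.mem_product,
      Finset.mem_range]
    exact ⟨(m.toNat, n.toNat), ⟨by grind, by grind⟩, by grind⟩

lemma finite_support_of_box {f : ℤ × ℤ → B} {a b a' b' : ℤ}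
    (hf : ∀ m n, f (m, n) ≠ 0 → a ≤ m ∧ m ≤ b ∧ a' ≤ n ∧ n ≤ b') :
    (Function.support f).Finite :=
  (Set.finite_Icc (a, a') (b, b')).subset fun ⟨m, n⟩ h => by
    obtain ⟨h1, h2, h3, h4⟩ := hf m n h
    exact ⟨⟨h1, h3⟩, ⟨h2, h4⟩⟩

lemma finite_support_shift {f : ℤ × ℤ → B} (hf : (Function.support f).Finite) (e : ℤ × ℤ) :
    (Function.support fun p => f (p + e)).Finite :=
  hf.preimage (f := fun p => p + e) (add_left_injective e).injOn

lemma finite_support_add {f f' : ℤ × ℤ → B} (hf : (Function.support f).Finite)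
    (hf' : (Function.support f').Finite) : (Function.support fun p => f p + f' p).Finite :=
  (hf.union hf').subset (Function.support_add f f')

lemma finite_support_sub {f f' : ℤ × ℤ → B} (hf : (Function.support f).Finite)
    (hf' : (Function.support f').Finite) : (Function.support fun p => f p - f' p).Finite :=
  (hf.union hf').subset (Function.support_sub f f')

lemma finsum_shift_sub {f : ℤ × ℤ → B} (hf : (Function.support f).Finite) (e : ℤ × ℤ) :
    ∑ᶠ p, (f (p + e) - f p) = 0 := by
  rw [finsum_sub_distrib (finite_support_shift hf e) hf, sub_eq_zero]
  exact finsum_comp_equiv (Equiv.addRight e)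

end Finsum

/-- The alternating function on labels which is supported on the labels `1` and `2`. -/
def mu (i j : Fin 3) : ℤ := if i = 1 ∧ j = 2 then 1 else if i = 2 ∧ j = 1 then -1 else 0

/-- The turning number of the labels around a vertex. -/
def turn (a b c d : Fin 3) : ℤ := mu a b + mu b c + mu c d + mu d a

lemma turn_ne_zero : ∀ {a b c d : Fin 3}, turn a b c d ≠ 0 →
    ∀ j, j = a ∨ j = b ∨ j = c ∨ j = d := by
  decide

lemma turn_smul {B : Type*} [AddCommGroup B] {ξ : Fin 3 → Fin 3 → B} (h : ∀ i j, ξ i j = - ξ j i)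
    (h0 : ∀ i, ξ i i = 0) (a b c d : Fin 3) :
    ξ a b + ξ b c + ξ c d + ξ d a = turn a b c d • (ξ 0 1 + ξ 1 2 - ξ 0 2) := by
  have key : ∀ i j, ξ i j = ξ 0 j - ξ 0 i + mu i j • (ξ 0 1 + ξ 1 2 - ξ 0 2) := fun i j => by
    fin_cases i <;> fin_cases j <;> simp [mu, h0, h 1 0, h 2 0, h 2 1]
  rw [key a b, key b c, key c d, key d a, turn]
  simp only [add_smul]
  abel

section Labelings

variable {X : Type*} [TopologicalSpace X] {A : Type*} [AddCommGroup A] {x₀ : X}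
  {U : Fin 3 → Set X} {K : Fin 3 → X → ℤ}

/-- A labeling of the cells of a rectangular grid on the plane by elements of the cover. -/
structure IsLabeling (U : Fin 3 → Set X) (g : C(ℝ × ℝ, X)) (N₁ N₂ : ℕ) (L : ℤ → ℤ → Fin 3) :
    Prop where
  pos_fst : 0 < N₁
  pos_snd : 0 < N₂
  mem : ∀ (m n : ℤ) (x y : ℝ), m ≤ N₁ * x → N₁ * x ≤ m + 1 → n ≤ N₂ * y → N₂ * y ≤ n + 1 →
    g (x, y) ∈ U (L m n)
  ring : ∀ m n, L m n ≠ 0 → 0 < m ∧ m + 1 < N₁ ∧ 0 < n ∧ n + 1 < N₂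

/-- The turning number of a labeling at a vertex. -/
def vturn (L : ℤ → ℤ → Fin 3) (m n : ℤ) : ℤ :=
  turn (L (m - 1) (n - 1)) (L m (n - 1)) (L m n) (L (m - 1) n)

/-- The chain given by the turning numbers of a labeling at all vertices. -/
noncomputable def chain (K : Fin 3 → X → ℤ) (g : C(ℝ × ℝ, X)) (N₁ N₂ : ℕ) (L : ℤ → ℤ → Fin 3) :
    (Fin 3 → ℤ) →₀ ℤ :=
  ∑ᶠ p : ℤ × ℤ, Finsupp.single (fun j => K j (g (p.1 / N₁, p.2 / N₂))) (vturn L p.1 p.2)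

variable {g : C(ℝ × ℝ, X)} {N₁ N₂ : ℕ} {L : ℤ → ℤ → Fin 3}

lemma IsLabeling.mem_vertex (hL : IsLabeling U g N₁ N₂ L) {m n m' n' : ℤ}
    (hm : m' = m ∨ m' = m - 1) (hn : n' = n ∨ n' = n - 1) :
    g (m / N₁, n / N₂) ∈ U (L m' n') := by
  have h1 : (0 : ℝ) < N₁ := by exact_mod_cast hL.pos_fst
  have h2 : (0 : ℝ) < N₂ := by exact_mod_cast hL.pos_snd
  apply hL.mem <;> rw [mul_div_cancel₀ _ (by positivity)]
  · rcases hm with rfl | rfl <;> simp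
  · rcases hm with rfl | rfl <;> simp
  · rcases hn with rfl | rfl <;> simp
  · rcases hn with rfl | rfl <;> simp

lemma IsLabeling.mem_of_vturn (hL : IsLabeling U g N₁ N₂ L) {m n : ℤ} (h : vturn L m n ≠ 0)
    (j : Fin 3) : g (m / N₁, n / N₂) ∈ U j := by
  rcases turn_ne_zero h j with rfl | rfl | rfl | rfl <;> apply hL.mem_vertex <;> simp

lemma IsLabeling.box_of_ne (hL : IsLabeling U g N₁ N₂ L) {m n m' n' : ℤ} (hm : m - m' ≤ 1)
    (hm' : m' ≤ m) (hn : n - n' ≤ 1) (hn' : n' ≤ n) (h : L m' n' ≠ 0) :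
    0 < m ∧ m < N₁ ∧ 0 < n ∧ n < N₂ := by
  have := hL.ring m' n' h
  omega

lemma IsLabeling.box_of_vturn (hL : IsLabeling U g N₁ N₂ L) {m n : ℤ} (h : vturn L m n ≠ 0) :
    0 < m ∧ m < N₁ ∧ 0 < n ∧ n < N₂ := by
  have key : ∀ {m' n' : ℤ}, 1 = L m' n' → L m' n' ≠ 0 := fun h => by rw [← h]; decide
  rcases turn_ne_zero h 1 with h | h | h | h <;>
    exact hL.box_of_ne (by omega) (by omega) (by omega) (by omega) (key h)

/-- The part of a horizontal grid line between two vertices. -/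
noncomputable def horEdge (g : C(ℝ × ℝ, X)) (N₁ N₂ : ℕ) (m n : ℤ) : C(ℝ, X) :=
  ⟨fun t => g ((m + clamp t) / N₁, n / N₂), by fun_prop⟩

/-- The part of a vertical grid line between two vertices. -/
noncomputable def verEdge (g : C(ℝ × ℝ, X)) (N₁ N₂ : ℕ) (m n : ℤ) : C(ℝ, X) :=
  ⟨fun t => g (m / N₁, (n + clamp t) / N₂), by fun_prop⟩

lemma clamp_nonneg (t : ℝ) : 0 ≤ clamp t := le_max_left _ _

lemma clamp_le_one (t : ℝ) : clamp t ≤ 1 := max_le zero_le_one (min_le_left _ _)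

lemma IsLabeling.horEdge_mem (hL : IsLabeling U g N₁ N₂ L) {m n n' : ℤ}
    (hn : n' = n ∨ n' = n - 1) (t : ℝ) : horEdge g N₁ N₂ m n t ∈ U (L m n') := by
  have h1 : (0 : ℝ) < N₁ := by exact_mod_cast hL.pos_fst
  have h2 : (0 : ℝ) < N₂ := by exact_mod_cast hL.pos_snd
  have := clamp_nonneg t
  have := clamp_le_one t
  apply hL.mem <;> rw [mul_div_cancel₀ _ (by positivity)]
  · linarith
  · linarith
  · rcases hn with rfl | rfl <;> simp
  · rcases hn with rfl | rfl <;> simp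

lemma IsLabeling.verEdge_mem (hL : IsLabeling U g N₁ N₂ L) {m n m' : ℤ}
    (hm : m' = m ∨ m' = m - 1) (t : ℝ) : verEdge g N₁ N₂ m n t ∈ U (L m' n) := by
  have h1 : (0 : ℝ) < N₁ := by exact_mod_cast hL.pos_fst
  have h2 : (0 : ℝ) < N₂ := by exact_mod_cast hL.pos_snd
  have := clamp_nonneg t
  have := clamp_le_one t
  apply hL.mem <;> rw [mul_div_cancel₀ _ (by positivity)]
  · rcases hm with rfl | rfl <;> simp
  · rcases hm with rfl | rfl <;> simp
  · linarith
  · linarith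

/-- A grid cell, reparametrized by the unit square. -/
noncomputable def cell (g : C(ℝ × ℝ, X)) (N₁ N₂ : ℕ) (m n : ℤ) : C(ℝ × ℝ, X) :=
  ⟨fun p => g ((m + clamp p.1) / N₁, (n + clamp p.2) / N₂), by fun_prop⟩

lemma IsLabeling.cell_mem (hL : IsLabeling U g N₁ N₂ L) (m n : ℤ) (p : ℝ × ℝ) :
    cell g N₁ N₂ m n p ∈ U (L m n) := by
  have h1 : (0 : ℝ) < N₁ := by exact_mod_cast hL.pos_fst
  have h2 : (0 : ℝ) < N₂ := by exact_mod_cast hL.pos_snd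
  have := clamp_nonneg p.1
  have := clamp_le_one p.1
  have := clamp_nonneg p.2
  have := clamp_le_one p.2
  apply hL.mem <;> rw [mul_div_cancel₀ _ (by positivity)] <;> linarith

lemma coboundary_cell (η : C(ℝ, X) → A) (m n : ℤ) :
    coboundary η (cell g N₁ N₂ m n) = η (horEdge g N₁ N₂ m n) + η (verEdge g N₁ N₂ (m + 1) n) -
      η (horEdge g N₁ N₂ m (n + 1)) - η (verEdge g N₁ N₂ m n) := by
  simp [coboundary, cell, horEdge, verEdge]

lemma ConstOutside.eq_of_box (hg : ConstOutside x₀ g) (h1 : 0 < N₁) (h2 : 0 < N₂) {x y : ℝ}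
    (h : x ≤ 0 ∨ (N₁ : ℝ) ≤ x ∨ y ≤ 0 ∨ (N₂ : ℝ) ≤ y) : g (x / N₁, y / N₂) = x₀ := by
  have h1 : (0 : ℝ) < N₁ := by exact_mod_cast h1
  have h2 : (0 : ℝ) < N₂ := by exact_mod_cast h2
  refine hg _ _ ?_
  rw [one_le_div h1, one_le_div h2]
  exact h.imp (div_nonpos_of_nonpos_of_nonneg · h1.le)
    (Or.imp_right (Or.imp_left (div_nonpos_of_nonpos_of_nonneg · h2.le)))

lemma ConstOutside.horEdge_box (hg : ConstOutside x₀ g) (h1 : 0 < N₁) (h2 : 0 < N₂)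
    {η : Fin 3 → C(ℝ, X) → A} (hη : ∀ j x, η j (ContinuousMap.const ℝ x) = 0) {m n : ℤ} {j : Fin 3}
    (h : η j (horEdge g N₁ N₂ m n) ≠ 0) : 0 ≤ m ∧ m ≤ N₁ ∧ 0 ≤ n ∧ n ≤ N₂ := by
  by_contra hbox
  refine h ?_
  rw [← hη j x₀]
  congr 1
  ext t
  have := clamp_nonneg t
  have := clamp_le_one t
  refine hg.eq_of_box h1 h2 ?_
  have : m + 1 ≤ 0 ∨ N₁ ≤ m ∨ n ≤ 0 ∨ N₂ ≤ n := by omega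
  rify at this
  rcases this with h | h | h | h
  · left; linarith
  · right; left; linarith
  · right; right; left; linarith
  · right; right; right; linarith

lemma ConstOutside.verEdge_box (hg : ConstOutside x₀ g) (h1 : 0 < N₁) (h2 : 0 < N₂)
    {η : Fin 3 → C(ℝ, X) → A} (hη : ∀ j x, η j (ContinuousMap.const ℝ x) = 0) {m n : ℤ} {j : Fin 3}
    (h : η j (verEdge g N₁ N₂ m n) ≠ 0) : 0 ≤ m ∧ m ≤ N₁ ∧ 0 ≤ n ∧ n ≤ N₂ := by
  by_contra hbox
  refine h ?_
  rw [← hη j x₀]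
  congr 1
  ext t
  have := clamp_nonneg t
  have := clamp_le_one t
  refine hg.eq_of_box h1 h2 ?_
  have : m ≤ 0 ∨ N₁ ≤ m ∨ n + 1 ≤ 0 ∨ N₂ ≤ n := by omega
  rify at this
  rcases this with h | h | h | h
  · left; linarith
  · right; left; linarith
  · right; right; left; linarith
  · right; right; right; linarith

lemma ConstOutside.finsum_cell (hg : ConstOutside x₀ g) (h1 : 0 < N₁) (h2 : 0 < N₂)
    {c : C(ℝ × ℝ, X) → A} (hc : IsCocycle c) : c g = ∑ᶠ p : ℤ × ℤ, c (cell g N₁ N₂ p.1 p.2) := by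
  have h1' : (0 : ℝ) < N₁ := by exact_mod_cast h1
  have h2' : (0 : ℝ) < N₂ := by exact_mod_cast h2
  rw [finsum_eq_sum_range (M := N₁) (N := N₂) fun m n h => ?_,
    hc.eq_sum_rect hg (fun m => m / N₁) (fun n => n / N₂) N₁ N₂ (by simp) (by simp)
      (div_self h1'.ne') (div_self h2'.ne')]
  · refine Finset.sum_congr rfl fun n _ => Finset.sum_congr rfl fun m _ => congrArg c ?_
    ext p
    simp only [rect, cell, ContinuousMap.coe_mk]
    congr 2
    · push_cast; ring
    · push_cast; ring
  · by_contra hbox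
    refine h (hc.const (x₀ := x₀) _ fun p => ?_)
    have := clamp_nonneg p.1
    have := clamp_le_one p.1
    have := clamp_nonneg p.2
    have := clamp_le_one p.2
    refine hg.eq_of_box h1 h2 ?_
    have : m + 1 ≤ 0 ∨ N₁ ≤ m ∨ n + 1 ≤ 0 ∨ N₂ ≤ n := by omega
    rify at this
    rcases this with h | h | h | h
    · left; linarith
    · right; left; linarith
    · right; right; left; linarith
    · right; right; right; linarith

theorem exists_cocycle_eq_chain (hU : GoodCover U K) {c : C(ℝ × ℝ, X) → A} (hc : IsCocycle c) :
    ∃ G : ((Fin 3 → ℤ) →₀ ℤ) →+ A, ∀ (g : C(ℝ × ℝ, X)) (N₁ N₂ : ℕ) (L : ℤ → ℤ → Fin 3),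
      ConstOutside x₀ g → IsLabeling U g N₁ N₂ L → c g = G (chain K g N₁ N₂ L) := by
  obtain ⟨η, ξ, G, hη0, hη, hξ, hξ1, hξ0, hG⟩ := hU.exists_primitives hc
  refine ⟨(Finsupp.linearCombination ℤ G).toAddMonoidHom, fun g N₁ N₂ L hg hL => ?_⟩
  have hp1 := hL.pos_fst
  have hp2 := hL.pos_snd
  let h₁ : ℤ × ℤ → A := fun p => η (L p.1 (p.2 - 1)) (horEdge g N₁ N₂ p.1 p.2)
  let h₂ : ℤ × ℤ → A := fun p => η (L (p.1 - 1) p.2) (verEdge g N₁ N₂ p.1 p.2)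
  let h₃ : ℤ × ℤ → A := fun p => ξ (L (p.1 - 1) p.2) (L (p.1 - 1) (p.2 - 1)) (g (p.1 / N₁, p.2 / N₂))
  let h₄ : ℤ × ℤ → A := fun p => ξ (L p.1 (p.2 - 1)) (L (p.1 - 1) (p.2 - 1)) (g (p.1 / N₁, p.2 / N₂))
  have f₁ : (Function.support h₁).Finite :=
    finite_support_of_box fun m n h => hg.horEdge_box hp1 hp2 hη0 h
  have f₂ : (Function.support h₂).Finite :=
    finite_support_of_box fun m n h => hg.verEdge_box hp1 hp2 hη0 h
  have hne : ∀ {i j x}, ξ i j x ≠ 0 → i ≠ 0 ∨ j ≠ 0 := fun {i j x} h => by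
    by_contra! hij
    exact h (by rw [hij.1, hij.2, hξ0])
  have f₃ : (Function.support h₃).Finite :=
    finite_support_of_box (a := 0) (a' := 0) (b := N₁) (b' := N₂) fun m n h => by
      rcases hne h with h | h
      · have := hL.ring _ _ h; omega
      · have := hL.ring _ _ h; omega
  have f₄ : (Function.support h₄).Finite :=
    finite_support_of_box (a := 0) (a' := 0) (b := N₁) (b' := N₂) fun m n h => by
      rcases hne h with h | h
      · have := hL.ring _ _ h; omega
      · have := hL.ring _ _ h; omega
  have fv : (Function.support fun p : ℤ × ℤ =>
      Finsupp.single (fun j => K j (g (p.1 / N₁, p.2 / N₂))) (vturn L p.1 p.2)).Finite :=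
    finite_support_of_box (a := 0) (a' := 0) (b := N₁) (b' := N₂) fun m n h => by
      have := hL.box_of_vturn (m := m) (n := n) fun h0 => h (by simp [h0])
      omega
  have key : ∀ p : ℤ × ℤ, c (cell g N₁ N₂ p.1 p.2) =
      (Finsupp.linearCombination ℤ G) (Finsupp.single (fun j => K j (g (p.1 / N₁, p.2 / N₂)))
        (vturn L p.1 p.2)) + ((h₃ (p + (1, 0)) - h₃ p) - (h₄ (p + (0, 1)) - h₄ p) -
          (h₁ (p + (0, 1)) - h₁ p) + (h₂ (p + (1, 0)) - h₂ p)) := by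
    rintro ⟨m, n⟩
    have e1 := hξ (L m n) (L m (n - 1)) (horEdge g N₁ N₂ m n) (hL.horEdge_mem (by simp))
      (hL.horEdge_mem (by simp))
    have e2 := hξ (L m n) (L (m - 1) n) (verEdge g N₁ N₂ m n) (hL.verEdge_mem (by simp))
      (hL.verEdge_mem (by simp))
    have e3 := turn_smul (ξ := fun i j => ξ i j (g (m / N₁, n / N₂))) (fun i j => hξ1 i j _)
      (fun i => hξ0 i _) (L (m - 1) (n - 1)) (L m (n - 1)) (L m n) (L (m - 1) n)
    have e4 : (Finsupp.linearCombination ℤ G) (Finsupp.single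
        (fun j => K j (g (m / N₁, n / N₂))) (vturn L m n)) =
        ξ (L (m - 1) (n - 1)) (L m (n - 1)) (g (m / N₁, n / N₂)) +
        ξ (L m (n - 1)) (L m n) (g (m / N₁, n / N₂)) +
        ξ (L m n) (L (m - 1) n) (g (m / N₁, n / N₂)) +
        ξ (L (m - 1) n) (L (m - 1) (n - 1)) (g (m / N₁, n / N₂)) := by
      rw [Finsupp.linearCombination_single]
      by_cases h0 : vturn L m n = 0
      · rw [h0, zero_smul, ← zero_smul ℤ (ξ 0 1 (g (m / N₁, n / N₂)) + ξ 1 2 (g (m / N₁, n / N₂)) -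
          ξ 0 2 (g (m / N₁, n / N₂))), ← h0]
        exact e3.symm
      · rw [← hG _ (hL.mem_of_vturn h0)]
        exact e3.symm
    rw [e4, hη _ _ (hL.cell_mem m n), coboundary_cell]
    simp only [h₁, h₂, h₃, h₄, Prod.mk_add_mk, add_sub_cancel_right, add_zero, Int.cast_add,
      Int.cast_one]
    simp only [horEdge, ContinuousMap.coe_mk, clamp_zero, clamp_one, add_zero] at e1
    simp only [verEdge, ContinuousMap.coe_mk, clamp_zero, clamp_one, add_zero] at e2
    rw [sub_eq_iff_eq_add] at e1 e2
    simp only [horEdge, verEdge] at e1 e2 ⊢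
    rw [e1, e2, hξ1 (L m (n - 1)) (L (m - 1) (n - 1)) (g (m / N₁, n / N₂)),
      hξ1 (L m n) (L m (n - 1)) (g (m / N₁, n / N₂))]
    abel
  have s₁ := finite_support_sub (finite_support_shift f₁ (0, 1)) f₁
  have s₂ := finite_support_sub (finite_support_shift f₂ (1, 0)) f₂
  have s₃ := finite_support_sub (finite_support_shift f₃ (1, 0)) f₃
  have s₄ := finite_support_sub (finite_support_shift f₄ (0, 1)) f₄
  have sv : (Function.support fun p : ℤ × ℤ => Finsupp.linearCombination ℤ G
      (Finsupp.single (fun j => K j (g (p.1 / N₁, p.2 / N₂))) (vturn L p.1 p.2))).Finite :=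
    fv.subset fun p h h0 => h (by simp only [h0, map_zero])
  rw [hg.finsum_cell hp1 hp2 hc, finsum_congr key, chain, AddMonoidHom.map_finsum _ fv,
    finsum_add_distrib sv (finite_support_add (finite_support_sub
      (finite_support_sub s₃ s₄) s₁) s₂),
    finsum_add_distrib (finite_support_sub (finite_support_sub s₃ s₄) s₁) s₂,
    finsum_sub_distrib (finite_support_sub s₃ s₄) s₁, finsum_sub_distrib s₃ s₄,
    finsum_shift_sub f₁, finsum_shift_sub f₂, finsum_shift_sub f₃, finsum_shift_sub f₄]
  simp

end Labelings

/-- The difference of the alternating functions of two pairs of labels. -/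
def muDiff (i j i' j' : Fin 3) : ℤ := mu i j - mu i' j' + mu j j' - mu i i'

lemma muDiff_ne_zero : ∀ {i j i' j' : Fin 3}, muDiff i j i' j' ≠ 0 →
    ∀ l, l = i ∨ l = j ∨ l = i' ∨ l = j' := by
  decide

lemma turn_sub_turn (a b c d a' b' c' d' : Fin 3) : turn a b c d - turn a' b' c' d' =
    muDiff a b a' b' - muDiff d c d' c' + (muDiff b c b' c' - muDiff a d a' d') := by
  have h : ∀ i j, mu i j = - mu j i := by decide
  rw [turn, turn, h c d, h d a, h c' d', h d' a']
  simp only [muDiff]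
  ring

lemma turn_degenerate : ∀ a b : Fin 3, turn a a b b = 0 ∧ turn a b b a = 0 := by
  decide

section Labelings

variable {X : Type*} [TopologicalSpace X] {x₀ : X}
  {U : Fin 3 → Set X} {K : Fin 3 → X → ℤ}
  {g : C(ℝ × ℝ, X)} {N₁ N₂ : ℕ} {L L' : ℤ → ℤ → Fin 3}

lemma GoodCover.const_of_path (hU : GoodCover U K) (e : C(ℝ, X)) (he : ∀ j t, e t ∈ U j) (t t' : ℝ) :
    (fun j => K j (e t)) = fun j => K j (e t') :=
  funext fun j => PreconnectedSpace.constant inferInstance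
    ((hU.cont j).comp_continuous e.continuous (he j))

lemma finite_support_chain (hL : IsLabeling U g N₁ N₂ L) : (Function.support fun p : ℤ × ℤ =>
    Finsupp.single (fun j => K j (g (p.1 / N₁, p.2 / N₂))) (vturn L p.1 p.2)).Finite :=
  finite_support_of_box (a := 0) (a' := 0) (b := N₁) (b' := N₂) fun m n h => by
    have := hL.box_of_vturn (m := m) (n := n) fun h0 => h (by simp [h0])
    omega

lemma chain_unique (hU : GoodCover U K) (hL : IsLabeling U g N₁ N₂ L)
    (hL' : IsLabeling U g N₁ N₂ L') : chain K g N₁ N₂ L = chain K g N₁ N₂ L' := by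
  let k : ℤ → ℤ → Fin 3 → ℤ := fun m n j => K j (g (m / N₁, n / N₂))
  let P : ℤ → ℤ → ℤ := fun m n => muDiff (L (m - 1) n) (L m n) (L' (m - 1) n) (L' m n)
  let Q : ℤ → ℤ → ℤ := fun m n => muDiff (L m (n - 1)) (L m n) (L' m (n - 1)) (L' m n)
  have hP : ∀ m n, P m n ≠ 0 → k m n = k m (n + 1) := fun m n h => by
    have := hU.const_of_path (verEdge g N₁ N₂ m n) (fun j t => by
      rcases muDiff_ne_zero h j with rfl | rfl | rfl | rfl
      · exact hL.verEdge_mem (by simp) t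
      · exact hL.verEdge_mem (by simp) t
      · exact hL'.verEdge_mem (by simp) t
      · exact hL'.verEdge_mem (by simp) t) 0 1
    simpa [verEdge, k] using this
  have hQ : ∀ m n, Q m n ≠ 0 → k m n = k (m + 1) n := fun m n h => by
    have := hU.const_of_path (horEdge g N₁ N₂ m n) (fun j t => by
      rcases muDiff_ne_zero h j with rfl | rfl | rfl | rfl
      · exact hL.horEdge_mem (by simp) t
      · exact hL.horEdge_mem (by simp) t
      · exact hL'.horEdge_mem (by simp) t
      · exact hL'.horEdge_mem (by simp) t) 0 1
    simpa [horEdge, k] using this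
  let s₁ : ℤ × ℤ → (Fin 3 → ℤ) →₀ ℤ := fun p => Finsupp.single (k p.1 p.2) (P p.1 p.2)
  let s₂ : ℤ × ℤ → (Fin 3 → ℤ) →₀ ℤ := fun p => Finsupp.single (k p.1 p.2) (Q p.1 p.2)
  have hne : ∀ {i j i' j'}, muDiff i j i' j' ≠ 0 → i ≠ 0 ∨ j ≠ 0 ∨ i' ≠ 0 ∨ j' ≠ 0 := by decide
  have f₁ : (Function.support s₁).Finite :=
    finite_support_of_box (a := 0) (a' := 0) (b := N₁) (b' := N₂) fun m n h => by
      have h : P m n ≠ 0 := fun h0 => h (by simp [s₁, h0])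
      rcases hne h with h | h | h | h
      · have := hL.ring _ _ h; omega
      · have := hL.ring _ _ h; omega
      · have := hL'.ring _ _ h; omega
      · have := hL'.ring _ _ h; omega
  have f₂ : (Function.support s₂).Finite :=
    finite_support_of_box (a := 0) (a' := 0) (b := N₁) (b' := N₂) fun m n h => by
      have h : Q m n ≠ 0 := fun h0 => h (by simp [s₂, h0])
      rcases hne h with h | h | h | h
      · have := hL.ring _ _ h; omega
      · have := hL.ring _ _ h; omega
      · have := hL'.ring _ _ h; omega
      · have := hL'.ring _ _ h; omega
  rw [← sub_eq_zero, chain, chain,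
    ← finsum_sub_distrib (finite_support_chain hL) (finite_support_chain hL')]
  have key : ∀ p : ℤ × ℤ, Finsupp.single (fun j => K j (g (p.1 / N₁, p.2 / N₂))) (vturn L p.1 p.2) -
      Finsupp.single (fun j => K j (g (p.1 / N₁, p.2 / N₂))) (vturn L' p.1 p.2) =
      (s₁ (p + (0, -1)) - s₁ p) - (s₂ (p + (-1, 0)) - s₂ p) := by
    rintro ⟨m, n⟩
    have e1 : s₁ (m, n - 1) = Finsupp.single (k m n) (P m (n - 1)) := by
      by_cases h : P m (n - 1) = 0
      · simp [s₁, h]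
      · simp [s₁, hP _ _ h]
    have e2 : s₂ (m - 1, n) = Finsupp.single (k m n) (Q (m - 1) n) := by
      by_cases h : Q (m - 1) n = 0
      · simp [s₂, h]
      · simp [s₂, hQ _ _ h]
    rw [← Finsupp.single_sub, vturn, vturn, turn_sub_turn]
    simp only [Prod.mk_add_mk, add_zero, ← sub_eq_add_neg, e1, e2]
    simp only [s₁, s₂, ← Finsupp.single_sub]
    congr 1
    ring
  rw [finsum_congr key, finsum_sub_distrib
    (finite_support_sub (finite_support_shift f₁ (0, -1)) f₁)
    (finite_support_sub (finite_support_shift f₂ (-1, 0)) f₂), finsum_shift_sub f₁,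
    finsum_shift_sub f₂, sub_zero]

lemma IsLabeling.refine (hL : IsLabeling U g N₁ N₂ L) {M₁ M₂ : ℕ} (h₁ : 0 < M₁) (h₂ : 0 < M₂) :
    IsLabeling U g (N₁ * M₁) (N₂ * M₂) fun m n => L (m / M₁) (n / M₂) where
  pos_fst := Nat.mul_pos hL.pos_fst h₁
  pos_snd := Nat.mul_pos hL.pos_snd h₂
  mem m n x y hm hm' hn hn' := by
    have aux : ∀ (M N : ℕ) (m : ℤ) (x : ℝ), 0 < M → m ≤ (N * M : ℕ) * x → (N * M : ℕ) * x ≤ m + 1 →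
        ((m / M : ℤ) : ℝ) ≤ N * x ∧ N * x ≤ (m / M : ℤ) + 1 := fun M N m x hM h h' => by
      have hM' : (0 : ℝ) < M := by exact_mod_cast hM
      have hM'' : (0 : ℤ) < M := by exact_mod_cast hM
      have e1 : (m / M) * M ≤ m := Int.ediv_mul_le _ hM''.ne'
      have e2 : m + 1 ≤ (m / M + 1) * M := Int.lt_ediv_add_one_mul_self m hM''
      rify at e1 e2
      push_cast at h h'
      constructor
      · refine le_of_mul_le_mul_right (a := (M : ℝ)) ?_ hM'
        linarith
      · refine le_of_mul_le_mul_right (a := (M : ℝ)) ?_ hM'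
        linarith
    obtain ⟨a, b⟩ := aux M₁ N₁ m x h₁ hm hm'
    obtain ⟨c, d⟩ := aux M₂ N₂ n y h₂ hn hn'
    exact hL.mem _ _ _ _ a b c d
  ring m n h := by
    have aux : ∀ (M N : ℕ) (m : ℤ), 0 < M → 0 < m / M → m / M + 1 < N →
        0 < m ∧ m + 1 < (N * M : ℕ) := fun M N m hM h h' => by
      have hM'' : (0 : ℤ) < M := by exact_mod_cast hM
      have e1 : (m / M) * M ≤ m := Int.ediv_mul_le _ hM''.ne'
      have e2 : m + 1 ≤ (m / M + 1) * M := Int.lt_ediv_add_one_mul_self m hM''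
      push_cast
      constructor <;> nlinarith
    obtain ⟨a, b, c, d⟩ := hL.ring _ _ h
    obtain ⟨a', b'⟩ := aux M₁ N₁ m h₁ a b
    obtain ⟨c', d'⟩ := aux M₂ N₂ n h₂ c d
    exact ⟨a', b', c', d'⟩

lemma chain_refine {M₁ M₂ : ℕ} (h₁ : 0 < M₁) (h₂ : 0 < M₂) :
    chain K g (N₁ * M₁) (N₂ * M₂) (fun m n => L (m / M₁) (n / M₂)) = chain K g N₁ N₂ L := by
  have h₁' : (0 : ℤ) < M₁ := by exact_mod_cast h₁
  have h₂' : (0 : ℤ) < M₂ := by exact_mod_cast h₂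
  have r₁ : (M₁ : ℝ) ≠ 0 := by exact_mod_cast h₁.ne'
  have r₂ : (M₂ : ℝ) ≠ 0 := by exact_mod_cast h₂.ne'
  have aux : ∀ (M : ℤ) (m : ℤ), 0 < M → (m - 1) / M ≠ m / M → ∃ k, k * M = m := fun M m hM h => by
    refine ⟨m / M, ?_⟩
    by_contra hne
    refine h ?_
    have e1 := Int.mul_ediv_add_emod m M
    have e2 := Int.emod_nonneg m hM.ne'
    have e3 := Int.emod_lt_of_pos m hM
    have e4 : m % M ≠ 0 := fun h0 => hne (by rw [h0] at e1; linarith)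
    rw [Int.ediv_eq_iff_of_pos hM]
    constructor <;> nlinarith [lt_of_le_of_ne e2 e4.symm]
  let ι : ℤ × ℤ → ℤ × ℤ := fun p => (p.1 * M₁, p.2 * M₂)
  have hι : Function.Injective ι := fun p q h => by
    simp only [ι, Prod.mk.injEq, mul_eq_mul_right_iff, h₁'.ne', h₂'.ne', or_false] at h
    exact Prod.ext h.1 h.2
  rw [chain, chain, ← finsum_mem_univ,
    ← finsum_mem_inter_support_eq' _ (Set.range ι), finsum_mem_range hι]
  · refine finsum_congr fun p => ?_
    have e : ∀ (M : ℤ) (k : ℤ), 0 < M → (k * M - 1) / M = k - 1 := fun M k hM => by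
      rw [Int.ediv_eq_iff_of_pos hM]
      constructor <;> nlinarith
    simp only [ι, vturn, e _ _ h₁', e _ _ h₂', Int.mul_ediv_cancel _ h₁'.ne',
      Int.mul_ediv_cancel _ h₂'.ne', Int.cast_mul, Int.cast_natCast, Nat.cast_mul,
      mul_div_mul_right _ _ r₁, mul_div_mul_right _ _ r₂]
  · rintro ⟨m, n⟩ h
    refine ⟨fun _ => trivial, fun _ => ?_⟩
    have h : vturn (fun m n => L (m / M₁) (n / M₂)) m n ≠ 0 := fun h0 => h (by simp [h0])
    obtain ⟨k, hk⟩ := aux M₁ m h₁' fun h0 => h (by simp [vturn, h0, turn_degenerate])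
    obtain ⟨l, hl⟩ := aux M₂ n h₂' fun h0 => h (by simp [vturn, h0, turn_degenerate])
    exact ⟨(k, l), Prod.ext hk hl⟩

end Labelings

section Chains

variable {X : Type*} [TopologicalSpace X] {x₀ : X}
  {U : Fin 3 → Set X} {K : Fin 3 → X → ℤ} {g : C(ℝ × ℝ, X)}

lemma exists_isLabeling (hU : GoodCover U K) (h0 : x₀ ∈ U 0) (hg : ConstOutside x₀ g) :
    ∃ N₀ : ℕ, ∀ N ≥ N₀, ∃ L, IsLabeling U g N N L := by
  classical
  let c : Fin 3 → Set (ℝ × ℝ) := fun j => g ⁻¹' U j ∩ {p | j = 0 ∨ p ∈ Ioo (0 : ℝ) 1 ×ˢ Ioo (0 : ℝ) 1}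
  have hcop : ∀ j, IsOpen (c j) := fun j => by
    refine ((hU.isOpen j).preimage g.continuous).inter ?_
    by_cases hj : j = 0
    · simp [hj]
    · simp only [hj, false_or]
      exact isOpen_Ioo.prod isOpen_Ioo
  obtain ⟨δ, hδ, hball⟩ := lebesgue_number_lemma_of_metric
    (s := Icc (0 : ℝ) 1 ×ˢ Icc (0 : ℝ) 1) (isCompact_Icc.prod isCompact_Icc) hcop (by
      rintro ⟨x, y⟩ ⟨hx, hy⟩
      rw [mem_iUnion]
      by_cases hp : (x, y) ∈ Ioo (0 : ℝ) 1 ×ˢ Ioo (0 : ℝ) 1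
      · obtain ⟨j, hj⟩ := hU.cover (g (x, y))
        exact ⟨j, hj, Or.inr hp⟩
      · refine ⟨0, ?_, Or.inl rfl⟩
        rw [mem_preimage, hg]
        · exact h0
        · simp only [mem_prod, mem_Ioo] at hp
          by_contra! h
          exact hp ⟨⟨h.1, h.2.1⟩, ⟨h.2.2.1, h.2.2.2⟩⟩)
  obtain ⟨N₀, hN₀⟩ := exists_nat_gt (1 / δ)
  refine ⟨N₀, fun N hN => ?_⟩
  have hNr : 1 / δ < N := hN₀.trans_le (by exact_mod_cast hN)
  have hN0 : (0 : ℝ) < N := (by positivity : 0 < 1 / δ).trans hNr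
  have hNδ : 1 / N < δ := by
    rw [div_lt_iff₀ hδ] at hNr
    rw [div_lt_iff₀ hN0]
    linarith
  let C : ℤ → ℤ → Set (ℝ × ℝ) := fun m n =>
    {p | m ≤ N * p.1 ∧ N * p.1 ≤ m + 1 ∧ n ≤ N * p.2 ∧ N * p.2 ≤ n + 1}
  have hC : ∀ m n : ℤ, 0 ≤ m → m < N → 0 ≤ n → n < N → ∃ j, C m n ⊆ c j := fun m n h1 h2 h3 h4 => by
    have h2 : m + 1 ≤ N := h2
    have h4 : n + 1 ≤ N := h4
    rify at h1 h2 h3 h4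
    obtain ⟨j, hj⟩ := hball (m / N, n / N) ⟨⟨by positivity, by rw [div_le_one hN0]; linarith⟩,
      ⟨by positivity, by rw [div_le_one hN0]; linarith⟩⟩
    refine ⟨j, fun p hp => hj ?_⟩
    have aux : ∀ (k : ℤ) (x : ℝ), k ≤ N * x → N * x ≤ k + 1 → |x - k / N| < δ := fun k x h h' => by
      refine lt_of_le_of_lt ?_ hNδ
      rw [abs_le, ← mul_le_mul_iff_right₀ hN0, ← mul_le_mul_iff_right₀ hN0 (b := x - k / N)]
      constructor
      · field_simp; linarith
      · field_simp; linarith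
    rw [Metric.mem_ball, Prod.dist_eq, Real.dist_eq, Real.dist_eq]
    exact max_lt (aux _ _ hp.1 hp.2.1) (aux _ _ hp.2.2.1 hp.2.2.2)
  let L : ℤ → ℤ → Fin 3 := fun m n =>
    if h : (0 ≤ m ∧ m < N ∧ 0 ≤ n ∧ n < N) ∧ ∃ j, C m n ⊆ c j then h.2.choose else 0
  refine ⟨L, by exact_mod_cast hN0, by exact_mod_cast hN0, fun m n x y hm hm' hn hn' => ?_,
    fun m n hne => ?_⟩
  · by_cases hbox : 0 ≤ m ∧ m < N ∧ 0 ≤ n ∧ n < N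
    · have h : (0 ≤ m ∧ m < N ∧ 0 ≤ n ∧ n < N) ∧ ∃ j, C m n ⊆ c j :=
        ⟨hbox, hC m n hbox.1 hbox.2.1 hbox.2.2.1 hbox.2.2.2⟩
      have hmem : (x, y) ∈ C m n := ⟨hm, hm', hn, hn'⟩
      simp only [L, dif_pos h]
      exact (h.2.choose_spec hmem).1
    · have h : ¬ ((0 ≤ m ∧ m < N ∧ 0 ≤ n ∧ n < N) ∧ ∃ j, C m n ⊆ c j) := fun h => hbox h.1
      simp only [L, dif_neg h]
      rw [hg]
      · exact h0
      · have : m + 1 ≤ 0 ∨ N ≤ m ∨ n + 1 ≤ 0 ∨ N ≤ n := by omega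
        rify at this
        rcases this with h | h | h | h
        · left; by_contra! hx; nlinarith
        · right; left; by_contra! hx; nlinarith
        · right; right; left; by_contra! hx; nlinarith
        · right; right; right; by_contra! hx; nlinarith
  · by_cases h : (0 ≤ m ∧ m < N ∧ 0 ≤ n ∧ n < N) ∧ ∃ j, C m n ⊆ c j
    · simp only [L, dif_pos h] at hne
      have h1 : ((m / N : ℝ), (n / N : ℝ)) ∈ C m n := by
        simp [C, mul_div_cancel₀ _ hN0.ne']
      have h2 : (((m + 1) / N : ℝ), ((n + 1) / N : ℝ)) ∈ C m n := by
        simp [C, mul_div_cancel₀ _ hN0.ne']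
      obtain ⟨⟨a1, -⟩, ⟨a2, -⟩⟩ := (h.2.choose_spec h1).2.resolve_left hne
      obtain ⟨⟨-, b1⟩, ⟨-, b2⟩⟩ := (h.2.choose_spec h2).2.resolve_left hne
      simp only [div_lt_one hN0] at a1 a2 b1 b2
      refine ⟨?_, ?_, ?_, ?_⟩
      · have := (div_pos_iff_of_pos_right hN0).1 a1
        exact_mod_cast this
      · exact_mod_cast b1
      · have := (div_pos_iff_of_pos_right hN0).1 a2
        exact_mod_cast this
      · exact_mod_cast b2
    · simp only [L, dif_neg h, ne_eq, not_true_eq_false] at hne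

lemma chain_unique' (hU : GoodCover U K) {N₁ N₂ N₁' N₂' : ℕ} {L L' : ℤ → ℤ → Fin 3}
    (hL : IsLabeling U g N₁ N₂ L) (hL' : IsLabeling U g N₁' N₂' L') :
    chain K g N₁ N₂ L = chain K g N₁' N₂' L' := by
  rw [← chain_refine hL'.pos_fst hL'.pos_snd, ← chain_refine (L := L') hL.pos_fst hL.pos_snd]
  have h := hL'.refine hL.pos_fst hL.pos_snd
  rw [mul_comm N₁' N₁, mul_comm N₂' N₂] at h ⊢
  exact chain_unique hU (hL.refine hL'.pos_fst hL'.pos_snd) h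

open Classical in
/-- The chain of a map, computed with an arbitrary labeling. -/
noncomputable def chainOf (U : Fin 3 → Set X) (K : Fin 3 → X → ℤ) (g : C(ℝ × ℝ, X)) :
    (Fin 3 → ℤ) →₀ ℤ :=
  if h : ∃ q : (ℕ × ℕ) × (ℤ → ℤ → Fin 3), IsLabeling U g q.1.1 q.1.2 q.2 then
    chain K g h.choose.1.1 h.choose.1.2 h.choose.2 else 0

lemma chainOf_eq (hU : GoodCover U K) {N₁ N₂ : ℕ} {L : ℤ → ℤ → Fin 3}
    (hL : IsLabeling U g N₁ N₂ L) : chainOf U K g = chain K g N₁ N₂ L := by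
  have h : ∃ q : (ℕ × ℕ) × (ℤ → ℤ → Fin 3), IsLabeling U g q.1.1 q.1.2 q.2 :=
    ⟨((N₁, N₂), L), hL⟩
  rw [chainOf, dif_pos h]
  exact chain_unique' hU h.choose_spec hL

lemma chainOf_homotopy (hU : GoodCover U K) (h0 : x₀ ∈ U 0) (G : C(ℝ × ℝ × ℝ, X))
    (g : ℝ → C(ℝ × ℝ, X)) (hGg : ∀ s p, g s p = G (s, p)) (hG : ∀ s, ConstOutside x₀ (g s))
    (s s' : ℝ) : chainOf U K (g s) = chainOf U K (g s') := by
  refine IsLocallyConstant.apply_eq_of_isPreconnected (s := univ) ?_ isPreconnected_univ trivial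
    trivial (f := fun s => chainOf U K (g s))
  rw [IsLocallyConstant.iff_eventually_eq]
  intro s
  obtain ⟨N, hN⟩ := exists_isLabeling hU h0 (hG s)
  obtain ⟨L, hL⟩ := hN N le_rfl
  have hNr : (0 : ℝ) < N := by exact_mod_cast hL.pos_fst
  have h1 : ∀ᶠ t in 𝓝 s, ∀ q ∈ Icc ((0 : ℤ), (0 : ℤ)) (N, N), ∀ p ∈ Icc ((q.1 : ℝ) / N) ((q.1 + 1) / N) ×ˢ
      Icc ((q.2 : ℝ) / N) ((q.2 + 1) / N), g t p ∈ U (L q.1 q.2) := by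
    rw [Filter.eventually_all_finite (Set.finite_Icc _ _)]
    rintro ⟨m, n⟩ -
    refine IsCompact.eventually_forall_of_forall_eventually
      (isCompact_Icc.prod isCompact_Icc) fun p hp => ?_
    simp only [hGg]
    refine ((hU.isOpen _).preimage G.continuous).mem_nhds ?_
    simp only [mem_preimage, ← hGg]
    obtain ⟨⟨a, b⟩, ⟨c, d⟩⟩ := hp
    rw [div_le_iff₀' hNr] at a c
    rw [le_div_iff₀' hNr] at b d
    exact hL.mem m n p.1 p.2 a b c d
  have h2 : ∀ᶠ t in 𝓝 s, ∀ q ∈ Icc ((0 : ℤ), (0 : ℤ)) (N, N), ∀ j, vturn L q.1 q.2 ≠ 0 →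
      K j (g t (q.1 / N, q.2 / N)) = K j (g s (q.1 / N, q.2 / N)) := by
    rw [Filter.eventually_all_finite (Set.finite_Icc _ _)]
    rintro ⟨m, n⟩ -
    rw [Filter.eventually_all]
    intro j
    by_cases hv : vturn L m n = 0
    · simp [hv]
    have hm := hL.mem_of_vturn hv j
    simp only [hGg] at hm ⊢
    have hc : ContinuousAt (fun t => K j (G (t, m / N, n / N))) s :=
      ContinuousAt.comp (f := fun t => G (t, (m : ℝ) / N, (n : ℝ) / N)) (g := K j)
        ((hU.cont j).continuousAt ((hU.isOpen j).mem_nhds hm)) (by fun_prop)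
    have := hc.preimage_mem_nhds ((isOpen_discrete {_}).mem_nhds rfl)
    filter_upwards [this] with t ht _ using ht
  filter_upwards [h1, h2] with t h1 h2
  have hLt : IsLabeling U (g t) N N L := by
    refine ⟨hL.pos_fst, hL.pos_snd, fun m n x y a b c d => ?_, hL.ring⟩
    by_cases hbox : (m, n) ∈ Icc ((0 : ℤ), (0 : ℤ)) (N, N)
    · refine h1 (m, n) hbox (x, y) ⟨⟨?_, ?_⟩, ⟨?_, ?_⟩⟩
      · rwa [div_le_iff₀' hNr]
      · rwa [le_div_iff₀' hNr]
      · rwa [div_le_iff₀' hNr]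
      · rwa [le_div_iff₀' hNr]
    · have hout : m + 1 ≤ 0 ∨ N ≤ m ∨ n + 1 ≤ 0 ∨ N ≤ n := by
        simp only [Set.mem_Icc, Prod.mk_le_mk] at hbox
        omega
      have hL0 : L m n = 0 := by
        by_contra h
        have := hL.ring m n h
        omega
      rw [hL0, hG t]
      · exact h0
      · rify at hout
        rcases hout with h | h | h | h
        · left; by_contra! hx; nlinarith
        · right; left; by_contra! hx; nlinarith
        · right; right; left; by_contra! hx; nlinarith
        · right; right; right; by_contra! hx; nlinarith
  rw [chainOf_eq hU hL, chainOf_eq hU hLt, chain, chain]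
  refine finsum_congr fun q => ?_
  by_cases hv : vturn L q.1 q.2 = 0
  · simp [hv]
  congr 1
  funext j
  have := hL.box_of_vturn hv
  exact h2 q ⟨⟨by simpa using this.1.le, by simpa using this.2.2.1.le⟩,
    ⟨this.2.1.le, this.2.2.2.le⟩⟩ j hv

end Chains

section ChainHom

variable {X : Type*} [TopologicalSpace X] {x₀ : X}
  {U : Fin 3 → Set X} {K : Fin 3 → X → ℤ}

lemma IsLabeling.concat {f g h : C(ℝ × ℝ, X)} {N : ℕ} {L L' : ℤ → ℤ → Fin 3}
    (hL : IsLabeling U f N N L) (hL' : IsLabeling U g N N L')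
    (h1 : ∀ x y, x ≤ 1 / 2 → h (x, y) = f (2 * x, y))
    (h2 : ∀ x y, 1 / 2 ≤ x → h (x, y) = g (2 * x - 1, y)) :
    IsLabeling U h (2 * N) N fun m n => if m < N then L m n else L' (m - N) n where
  pos_fst := by have := hL.pos_fst; omega
  pos_snd := hL.pos_snd
  mem m n x y a b c d := by
    have hN : (0 : ℝ) < N := by exact_mod_cast hL.pos_fst
    push_cast at a b
    split_ifs with hm
    · have hm' : m + 1 ≤ (N : ℤ) := hm
      rify at hm'
      rw [h1 x y (by nlinarith)]
      exact hL.mem _ _ _ _ (by linarith) (by linarith) c d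
    · push Not at hm
      rify at hm
      rw [h2 x y (by nlinarith)]
      exact hL'.mem _ _ _ _ (by push_cast; linarith) (by push_cast; linarith) c d
  ring m n hne := by
    have := hL.pos_fst
    split_ifs at hne with hm
    · have := hL.ring _ _ hne
      push_cast
      omega
    · have := hL'.ring _ _ hne
      push_cast
      omega

lemma chain_concat {f g h : C(ℝ × ℝ, X)} {N : ℕ} {L L' : ℤ → ℤ → Fin 3}
    (hL : IsLabeling U f N N L) (hL' : IsLabeling U g N N L')
    (h1 : ∀ x y, x ≤ 1 / 2 → h (x, y) = f (2 * x, y))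
    (h2 : ∀ x y, 1 / 2 ≤ x → h (x, y) = g (2 * x - 1, y)) :
    chain K h (2 * N) N (fun m n => if m < N then L m n else L' (m - N) n) =
      chain K f N N L + chain K g N N L' := by
  have hN : (0 : ℝ) < N := by exact_mod_cast hL.pos_fst
  have f1 := finite_support_chain (K := K) hL
  have f2 := finite_support_chain (K := K) hL'
  have e2 : chain K g N N L' = ∑ᶠ p : ℤ × ℤ, Finsupp.single
      (fun j => K j (g ((p + (-(N : ℤ), 0) : ℤ × ℤ).1 / N, (p + (-(N : ℤ), 0) : ℤ × ℤ).2 / N)))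
      (vturn L' (p + (-(N : ℤ), 0) : ℤ × ℤ).1 (p + (-(N : ℤ), 0) : ℤ × ℤ).2) :=
    (finsum_comp_equiv (Equiv.addRight (-(N : ℤ), (0 : ℤ)))).symm
  rw [e2, chain, chain, ← finsum_add_distrib f1 (finite_support_shift f2 _)]
  refine finsum_congr ?_
  rintro ⟨m, n⟩
  simp only [Prod.mk_add_mk, add_zero, ← sub_eq_add_neg]
  have bf := hL.box_of_vturn (m := m) (n := n)
  have bg := hL'.box_of_vturn (m := m - N) (n := n)
  rcases lt_trichotomy m (N : ℤ) with hm | hm | hm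
  · have v : vturn L' (m - N) n = 0 := by
      by_contra hv
      have := bg hv
      omega
    rw [v, Finsupp.single_zero, add_zero]
    have hm' := hm
    rify at hm'
    have : vturn (fun m n => if m < N then L m n else L' (m - N) n) m n = vturn L m n := by
      simp [vturn, hm, hm.trans' (sub_one_lt m)]
    rw [this]
    congr 2
    funext j
    push_cast
    rw [h1]
    · congr 3
      field_simp
    · rw [div_le_iff₀ (by positivity)]; linarith
  · have v : vturn L' (m - N) n = 0 := by
      by_contra hv
      have := bg hv
      omega
    have v' : vturn L m n = 0 := by
      by_contra hv
      have := bf hv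
      omega
    have z : ∀ k, L (N - 1) k = 0 := fun k => by
      by_contra hk
      have := hL.ring _ _ hk
      omega
    have z' : ∀ k, L' 0 k = 0 := fun k => by
      by_contra hk
      have := hL'.ring _ _ hk
      omega
    have : vturn (fun m n => if m < N then L m n else L' (m - N) n) m n = 0 := by
      subst hm
      simp [vturn, z, z', turn, mu]
    rw [v, v', this]
    simp
  · have v : vturn L m n = 0 := by
      by_contra hv
      have := bf hv
      omega
    rw [v, Finsupp.single_zero, zero_add]
    have hm' := hm
    rify at hm'
    have : vturn (fun m n => if m < N then L m n else L' (m - N) n) m n = vturn L' (m - N) n := by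
      have a1 : ¬ m < N := by omega
      have a2 : ¬ m - 1 < N := by omega
      simp only [vturn, if_neg a1, if_neg a2]
      rw [sub_right_comm]
    rw [this]
    congr 2
    funext j
    push_cast
    rw [h2]
    · congr 3
      field_simp
    · rw [le_div_iff₀ (by positivity)]; linarith

lemma chainOf_concat (hU : GoodCover U K) (h0 : x₀ ∈ U 0) {f g h : C(ℝ × ℝ, X)}
    (hf : ConstOutside x₀ f) (hg : ConstOutside x₀ g)
    (h1 : ∀ x y, x ≤ 1 / 2 → h (x, y) = f (2 * x, y))
    (h2 : ∀ x y, 1 / 2 ≤ x → h (x, y) = g (2 * x - 1, y)) :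
    chainOf U K h = chainOf U K f + chainOf U K g := by
  obtain ⟨N, hN⟩ := exists_isLabeling hU h0 hf
  obtain ⟨N', hN'⟩ := exists_isLabeling hU h0 hg
  obtain ⟨L, hL⟩ := hN (max N N') (le_max_left _ _)
  obtain ⟨L', hL'⟩ := hN' (max N N') (le_max_right _ _)
  rw [chainOf_eq hU hL, chainOf_eq hU hL', chainOf_eq hU (hL.concat hL' h1 h2),
    chain_concat hL hL' h1 h2]

/-- The projection of the plane to the unit square. -/
noncomputable def squareProj : C(ℝ × ℝ, Fin 2 → unitInterval) :=
  ⟨fun p => ![projIcc 0 1 zero_le_one p.1, projIcc 0 1 zero_le_one p.2], by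
    have := continuous_projIcc (a := (0 : ℝ)) (b := 1) (h := zero_le_one)
    refine continuous_pi fun i => ?_
    fin_cases i
    · exact this.comp continuous_fst
    · exact this.comp continuous_snd⟩

/-- The extension of a generalized loop to the plane. -/
noncomputable def extend (f : GenLoop (Fin 2) X x₀) : C(ℝ × ℝ, X) :=
  (f : C(Fin 2 → unitInterval, X)).comp squareProj

lemma extend_apply (f : GenLoop (Fin 2) X x₀) (p : ℝ × ℝ) :
    extend f p = f ![projIcc 0 1 zero_le_one p.1, projIcc 0 1 zero_le_one p.2] := rfl

lemma squareProj_mem {p : ℝ × ℝ} (h : p.1 ≤ 0 ∨ 1 ≤ p.1 ∨ p.2 ≤ 0 ∨ 1 ≤ p.2) :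
    squareProj p ∈ Cube.boundary (Fin 2) := by
  rcases h with h | h | h | h
  · exact ⟨0, Or.inl (projIcc_of_le_left zero_le_one h)⟩
  · exact ⟨0, Or.inr (projIcc_of_right_le zero_le_one h)⟩
  · exact ⟨1, Or.inl (projIcc_of_le_left zero_le_one h)⟩
  · exact ⟨1, Or.inr (projIcc_of_right_le zero_le_one h)⟩

lemma constOutside_extend (f : GenLoop (Fin 2) X x₀) : ConstOutside x₀ (extend f) :=
  fun _ _ h => f.2 _ (squareProj_mem h)

lemma ConstOutside.bdryConst {g : C(ℝ × ℝ, X)} (hg : ConstOutside x₀ g) : BdryConst x₀ g := by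
  rintro x - y - h
  refine hg _ _ ?_
  rcases h with rfl | rfl | rfl | rfl <;> simp

lemma cl_extend (f : GenLoop (Fin 2) X x₀) : cl x₀ (extend f) = piMk f := by
  rw [cl_eq _ (constOutside_extend f).bdryConst]
  congr 1
  ext t
  rw [toGenLoop_apply, extend_apply]
  congr 1
  funext i
  fin_cases i
  · exact projIcc_val zero_le_one (t 0)
  · exact projIcc_val zero_le_one (t 1)

lemma extend_toGenLoop {g : C(ℝ × ℝ, X)} (hg : ConstOutside x₀ g) :
    extend (toGenLoop g hg.bdryConst) = g := by
  ext ⟨x, y⟩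
  rw [extend_apply, toGenLoop_apply]
  simp only [Matrix.cons_val_zero, Matrix.cons_val_one]
  rw [coe_projIcc, coe_projIcc]
  change g (clamp x, clamp y) = _
  rcases clamp_cases x with ⟨h, h'⟩ | ⟨h, h'⟩ | h
  · rw [h', hg _ _ (Or.inl le_rfl), hg _ _ (Or.inl h)]
  · rw [h', hg _ _ (Or.inr (Or.inl le_rfl)), hg _ _ (Or.inr (Or.inl h))]
  rw [h]
  rcases clamp_cases y with ⟨h, h'⟩ | ⟨h, h'⟩ | h
  · rw [h', hg _ _ (by simp), hg _ _ (by simp [h])]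
  · rw [h', hg _ _ (by simp), hg _ _ (by simp [h])]
  rw [h]

lemma exists_extend_homotopy {f f' : GenLoop (Fin 2) X x₀} (h : GenLoop.Homotopic f f') :
    ∃ G : C(ℝ × ℝ × ℝ, X), (∀ s x y, (x ≤ 0 ∨ 1 ≤ x ∨ y ≤ 0 ∨ 1 ≤ y) → G (s, x, y) = x₀) ∧
      (∀ p, G (0, p) = extend f p) ∧ ∀ p, G (1, p) = extend f' p := by
  obtain ⟨H⟩ := h
  refine ⟨⟨fun p => H (projIcc 0 1 zero_le_one p.1, squareProj p.2), by
    have := continuous_projIcc (a := (0 : ℝ)) (b := 1) (h := zero_le_one)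
    fun_prop⟩, fun s x y hxy => ?_, fun p => ?_, fun p => ?_⟩
  · exact (H.eq_fst _ (squareProj_mem (p := (x, y)) hxy)).trans
      (f.2 _ (squareProj_mem (p := (x, y)) hxy))
  · change H (projIcc 0 1 zero_le_one 0, squareProj p) = f (squareProj p)
    rw [projIcc_left]
    exact H.apply_zero _
  · change H (projIcc 0 1 zero_le_one 1, squareProj p) = f' (squareProj p)
    rw [projIcc_right]
    exact H.apply_one _

lemma chainOf_extend_homotopic (hU : GoodCover U K) (h0 : x₀ ∈ U 0)
    {f f' : GenLoop (Fin 2) X x₀} (h : GenLoop.Homotopic f f') :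
    chainOf U K (extend f) = chainOf U K (extend f') := by
  obtain ⟨G, hG, G0, G1⟩ := exists_extend_homotopy h
  let γ : ℝ → C(ℝ × ℝ, X) := fun s => ⟨fun p => G (s, p), by fun_prop⟩
  have e0 : γ 0 = extend f := ContinuousMap.ext G0
  have e1 : γ 1 = extend f' := ContinuousMap.ext G1
  rw [← e0, ← e1]
  exact chainOf_homotopy hU h0 G γ (fun _ _ => rfl) hG 0 1

lemma extend_transAt (f f' : GenLoop (Fin 2) X x₀) (x y : ℝ) :
    extend (GenLoop.transAt 0 f f') (x, y) =
      if x ≤ 1 / 2 then extend f (2 * x, y) else extend f' (2 * x - 1, y) := by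
  have h0 := Set.coe_projIcc (a := (0 : ℝ)) (b := 1) zero_le_one x
  have aux : ∀ (h : GenLoop (Fin 2) X x₀) (a b : ℝ), clamp a = clamp b →
      h (Function.update ![projIcc 0 1 zero_le_one x, projIcc 0 1 zero_le_one y] 0
        (projIcc 0 1 zero_le_one a)) = extend h (b, y) := by
    intro h a b hab
    rw [extend_apply]
    congr 1
    have : projIcc (0 : ℝ) 1 zero_le_one a = projIcc 0 1 zero_le_one b := by
      ext
      rw [coe_projIcc, coe_projIcc]
      exact hab
    funext i
    fin_cases i <;> simp [this]
  rw [extend_apply, GenLoop.transAt, GenLoop.coe_copy]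
  change (if ((projIcc (0 : ℝ) 1 zero_le_one x : ℝ)) ≤ 1 / 2 then _ else _) = _
  rw [h0]
  by_cases hx : x ≤ 1 / 2
  · have hx' : max 0 (min 1 x) ≤ 1 / 2 := max_le (by norm_num) ((min_le_right _ _).trans hx)
    rw [if_pos hx, if_pos hx']
    refine aux f _ _ ?_
    change clamp (2 * (projIcc (0 : ℝ) 1 zero_le_one x : ℝ)) = clamp (2 * x)
    rw [h0]
    rcases le_total x 0 with h | h
    · simp [clamp, min_eq_right (h.trans zero_le_one),
        min_eq_right (show 2 * x ≤ 1 by linarith), show x ≤ 0 from h,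
        show 2 * x ≤ 0 by linarith]
    · rw [min_eq_right (by linarith), max_eq_right h]
  · push Not at hx
    have hx' : ¬ max 0 (min 1 x) ≤ 1 / 2 :=
      not_le.2 ((lt_min (by norm_num) hx).trans_le (le_max_right _ _))
    rw [if_neg (not_le.2 hx), if_neg hx']
    refine aux f' _ _ ?_
    change clamp (2 * (projIcc (0 : ℝ) 1 zero_le_one x : ℝ) - 1) = clamp (2 * x - 1)
    rw [h0, max_eq_right (le_min zero_le_one (by linarith))]
    rcases le_total x 1 with h | h
    · rw [min_eq_right h]
    · rw [min_eq_left h, clamp, clamp, min_eq_left (by norm_num), min_eq_left (by linarith)]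

theorem exists_chain_hom (hU : GoodCover U K) (h0 : x₀ ∈ U 0) (hX : SimplyConn X x₀) :
    ∃ Φ : Additive (π_ 2 X x₀) →+ ((Fin 3 → ℤ) →₀ ℤ), Function.Injective Φ ∧
      ∀ g N₁ N₂ L, ConstOutside x₀ g → IsLabeling U g N₁ N₂ L →
        Φ (cl x₀ g) = chain K g N₁ N₂ L := by
  let F : Additive (π_ 2 X x₀) → ((Fin 3 → ℤ) →₀ ℤ) := fun a => Quotient.lift
    (fun f : GenLoop (Fin 2) X x₀ => chainOf U K (extend f))
    (fun _ _ h => chainOf_extend_homotopic hU h0 h) a.toMul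
  have hF : ∀ f, F (piMk f) = chainOf U K (extend f) := fun f => rfl
  have hsurj : ∀ a : Additive (π_ 2 X x₀), ∃ f, piMk f = a := fun a =>
    Quotient.exists_rep (s := GenLoop.Homotopic.setoid (Fin 2) x₀) a.toMul
  let Φ : Additive (π_ 2 X x₀) →+ ((Fin 3 → ℤ) →₀ ℤ) := AddMonoidHom.mk' F fun a b => by
    obtain ⟨f, rfl⟩ := hsurj a
    obtain ⟨f', rfl⟩ := hsurj b
    rw [← piMk_transAt 0, hF, hF, hF]
    refine chainOf_concat hU h0 (constOutside_extend f) (constOutside_extend f') ?_ ?_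
    · intro x y hx
      rw [extend_transAt, if_pos hx]
    · intro x y hx
      rw [extend_transAt]
      split_ifs with h
      · obtain rfl : x = 1 / 2 := le_antisymm h hx
        rw [constOutside_extend f _ _ (by norm_num), constOutside_extend f' _ _ (by norm_num)]
      · rfl
  have hΦ : ∀ f, Φ (piMk f) = chainOf U K (extend f) := hF
  refine ⟨Φ, ?_, ?_⟩
  · rw [injective_iff_map_eq_zero]
    intro a ha
    obtain ⟨f, rfl⟩ := hsurj a
    obtain ⟨c, hc, hcl⟩ := exists_cocycle hX
    obtain ⟨G, hG⟩ := exists_cocycle_eq_chain (x₀ := x₀) hU hc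
    obtain ⟨N, hN⟩ := exists_isLabeling hU h0 (constOutside_extend f)
    obtain ⟨L, hL⟩ := hN N le_rfl
    rw [hΦ, chainOf_eq hU hL] at ha
    rw [← cl_extend, ← hcl, hG _ _ _ _ (constOutside_extend f) hL, ha, map_zero]
    intro t
    refine ⟨?_, ?_, ?_, ?_⟩ <;> exact constOutside_extend f _ _ (by simp)
  · intro g N₁ N₂ L hg hL
    rw [← chainOf_eq hU hL, cl_eq _ hg.bdryConst, hΦ, extend_toGenLoop hg]

end ChainHom

section PathCocycle

variable {X : Type*} [TopologicalSpace X] {A : Type*} [Group A]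

/-- A function on paths with values in a group which behaves like a flat parallel transport. -/
structure IsPathCocycle (c : C(ℝ, X) → A) : Prop where
  const : ∀ x, c (ContinuousMap.const ℝ x) = 1
  square : ∀ σ : C(ℝ × ℝ, X),
    c ⟨fun t => σ (t, 0), by fun_prop⟩ * c ⟨fun t => σ (1, t), by fun_prop⟩ =
      c ⟨fun t => σ (0, t), by fun_prop⟩ * c ⟨fun t => σ (t, 1), by fun_prop⟩

/-- A piece of a path, reparametrized by the unit interval. -/
def piece (e : C(ℝ, X)) (a b : ℝ) : C(ℝ, X) :=
  ⟨fun t => e (a + clamp t * (b - a)), by fun_prop⟩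

variable {c : C(ℝ, X) → A}

lemma IsPathCocycle.piece_mul (hc : IsPathCocycle c) (e : C(ℝ, X)) (a b d : ℝ) :
    c (piece e a b) * c (piece e b d) = c (piece e a d) := by
  have h := hc.square
    ⟨fun p => e (a + clamp p.1 * (b - a) + clamp p.1 * clamp p.2 * (d - b)), by fun_prop⟩
  have h1 : (c ⟨fun t => e (a + clamp 0 * (b - a) + clamp 0 * clamp t * (d - b)), by fun_prop⟩) = 1 := by
    rw [← hc.const (e a)]; congr 1; ext t; simp
  simp only [ContinuousMap.coe_mk] at h
  rw [h1, one_mul] at h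
  convert h using 2
  · congr 1; ext t; simp [piece]
  · congr 1; ext t; simp [piece]
  · ext t; simp only [piece, ContinuousMap.coe_mk, clamp_one]; congr 1; ring

variable {U : Fin 3 → Set X} {K : Fin 3 → X → ℤ}

lemma GoodCover.exists_local_potential (hU : GoodCover U K) (hc : IsPathCocycle c) (j : Fin 3) :
    ∃ l : X → A, ∀ e : C(ℝ, X), (∀ t, e t ∈ U j) → c e = l (e 0) * (l (e 1))⁻¹ := by
  classical
  obtain ⟨H, hH⟩ := hU.contractible {j} (Finset.singleton_nonempty j)
  refine ⟨fun x => if hx : x ∈ {x | ∀ i ∈ ({j} : Finset (Fin 3)), x ∈ U i} then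
    c ⟨fun s => H (s, x), hH.continuous_comp continuous_id continuous_const fun _ => hx⟩ else 1,
    fun e he => ?_⟩
  have he' : ∀ t, e t ∈ {x | ∀ i ∈ ({j} : Finset (Fin 3)), x ∈ U i} := by simpa using he
  have key := hc.square ⟨fun p => H (p.1, e p.2),
    hH.continuous_comp (by fun_prop) (by fun_prop) fun _ => he' _⟩
  have e0 : (⟨fun t => H (0, e t),
      hH.continuous_comp (by fun_prop) (by fun_prop) fun _ => he' _⟩ : C(ℝ, X)) = e := by
    ext p; exact hH.zero _ (he' p)
  have e1 : c (⟨fun t => H (1, e t),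
      hH.continuous_comp (by fun_prop) (by fun_prop) fun _ => he' _⟩ : C(ℝ, X)) = 1 := by
    rw [← hc.const (H (1, e 0))]
    congr 1
    ext p
    exact hH.const_one e.continuous he' p 0
  simp only [ContinuousMap.coe_mk, e0, e1, mul_one] at key
  simp only [dif_pos (he' _)]
  rw [key, mul_inv_cancel_right]

lemma GoodCover.exists_transition (hU : GoodCover U K) {l : Fin 3 → X → A}
    (hl : ∀ j, ∀ e : C(ℝ, X), (∀ t, e t ∈ U j) → c e = l j (e 0) * (l j (e 1))⁻¹) (i j : Fin 3) :
    ∃ g : (Fin 3 → ℤ) → A, (∀ x ∈ U i, x ∈ U j → (l i x)⁻¹ * l j x = g fun j => K j x) ∧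
      ∀ k k', k i = k' i → k j = k' j → g k = g k' := by
  obtain ⟨H, hH⟩ := hU.contractible {i, j} ⟨i, by simp⟩
  obtain ⟨g, hg⟩ := exists_primitive_zero hH (ξ := fun x => (l i x)⁻¹ * l j x) (fun e he => by
    have h1 := hl i e fun t => he t i (by simp)
    have h2 := hl j e fun t => he t j (by simp)
    have h := h1.symm.trans h2
    calc (l i (e 0))⁻¹ * l j (e 0) = (l i (e 0))⁻¹ * (l j (e 0) * (l j (e 1))⁻¹) * l j (e 1) := by group
      _ = (l i (e 1))⁻¹ * l j (e 1) := by rw [← h]; group)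
  refine ⟨fun k => g fun m => if m ∈ ({i, j} : Finset (Fin 3)) then k m else 0, fun x hi hj => ?_,
    fun k k' hi hj => ?_⟩
  · exact hg x (by simp [hi, hj])
  · dsimp only
    congr 1
    funext m
    split_ifs with hm
    · rw [Finset.mem_insert, Finset.mem_singleton] at hm
      rcases hm with rfl | rfl <;> assumption
    · rfl

lemma exists_trivialization {g : Fin 3 → Fin 3 → (Fin 3 → ℤ) → A}
    (hg : ∀ i j l k, g i j k * g j l k = g i l k)
    (hk : ∀ i j k k', k i = k' i → k j = k' j → g i j k = g i j k') :
    ∃ r : Fin 3 → ℤ → A, ∀ i j k, g i j k = (r i (k i))⁻¹ * r j (k j) := by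
  have hii : ∀ i k, g i i k = 1 := fun i k => by simpa using hg i i i k
  have hinv : ∀ i j k, (g i j k)⁻¹ = g j i k := fun i j k => by
    rw [inv_eq_iff_mul_eq_one, hg, hii]
  let r : Fin 3 → ℤ → A := ![fun k => g 0 1 0 * g 1 0 ![k, 0, 0], fun k => g 0 1 ![0, k, 0],
    fun k => g 0 2 ![0, 0, k]]
  have h12 : ∀ k, g 1 2 k = (r 1 (k 1))⁻¹ * r 2 (k 2) := fun k => by
    change _ = (g 0 1 ![0, k 1, 0])⁻¹ * g 0 2 ![0, 0, k 2]
    rw [hinv, hk 1 2 k ![0, k 1, k 2] rfl rfl, hk 1 0 ![0, k 1, 0] ![0, k 1, k 2] rfl rfl,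
      hk 0 2 ![0, 0, k 2] ![0, k 1, k 2] rfl rfl, hg]
  have h02 : ∀ k, g 0 2 k = (r 0 (k 0))⁻¹ * r 2 (k 2) := fun k => by
    change _ = (g 0 1 0 * g 1 0 ![k 0, 0, 0])⁻¹ * g 0 2 ![0, 0, k 2]
    rw [mul_inv_rev, hinv, hinv, mul_assoc, hk 1 0 0 ![0, 0, k 2] rfl rfl, hg,
      hk 1 2 ![0, 0, k 2] ![k 0, 0, k 2] rfl rfl, hk 0 1 ![k 0, 0, 0] ![k 0, 0, k 2] rfl rfl, hg,
      hk 0 2 k ![k 0, 0, k 2] rfl rfl]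
  have h01 : ∀ k, g 0 1 k = (r 0 (k 0))⁻¹ * r 1 (k 1) := fun k => by
    rw [← hg 0 2 1 k, ← hinv 1 2, h02, h12]
    group
  refine ⟨r, fun i j k => ?_⟩
  have hsymm : ∀ i j, g i j k = (r i (k i))⁻¹ * r j (k j) → g j i k = (r j (k j))⁻¹ * r i (k i) :=
    fun i j h => by rw [← hinv, h]; group
  have hself : ∀ i, g i i k = (r i (k i))⁻¹ * r i (k i) := fun i => by rw [hii]; group
  fin_cases i <;> fin_cases j
  · exact hself 0
  · exact h01 k
  · exact h02 k
  · exact hsymm _ _ (h01 k)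
  · exact hself 1
  · exact h12 k
  · exact hsymm _ _ (h02 k)
  · exact hsymm _ _ (h12 k)
  · exact hself 2

lemma GoodCover.exists_potential (hU : GoodCover U K) (hc : IsPathCocycle c) :
    ∃ V : X → A, ∀ j, ∀ e : C(ℝ, X), (∀ t, e t ∈ U j) → c e = V (e 0) * (V (e 1))⁻¹ := by
  choose l hl using hU.exists_local_potential hc
  choose g hg hk using hU.exists_transition hl
  obtain ⟨r, hr⟩ := exists_trivialization (g := g) (fun i j m k => by
    obtain ⟨x, hx⟩ := hU.nonempty k
    have e : (fun j => K j x) = k := funext fun j => (hx j).2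
    rw [← e, ← hg i j x (hx i).1 (hx j).1, ← hg j m x (hx j).1 (hx m).1,
      ← hg i m x (hx i).1 (hx m).1]
    group) hk
  choose J hJ using hU.cover
  have key : ∀ j, ∀ x ∈ U j, l (J x) x * (r (J x) (K (J x) x))⁻¹ = l j x * (r j (K j x))⁻¹ := by
    intro j x hx
    have := hg (J x) j x (hJ x) hx
    rw [hr, inv_mul_eq_iff_eq_mul] at this
    rw [this]
    group
  refine ⟨fun x => l (J x) x * (r (J x) (K (J x) x))⁻¹, fun j e he => ?_⟩
  dsimp only
  rw [key j _ (he 0), key j _ (he 1), hl j e he]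
  have : K j (e 0) = K j (e 1) := PreconnectedSpace.constant inferInstance
    ((hU.cont j).comp_continuous e.continuous he)
  rw [this]
  group

lemma GoodCover.exists_global_potential (hU : GoodCover U K) (hc : IsPathCocycle c) :
    ∃ V : X → A, ∀ e : C(ℝ, X), c (piece e 0 1) = V (e 0) * (V (e 1))⁻¹ := by
  obtain ⟨V, hV⟩ := hU.exists_potential hc
  refine ⟨V, fun e => ?_⟩
  have hconst : ∀ t : ℝ, c (piece e t t) = 1 := fun t => by
    rw [← hc.const (e t)]
    congr 1
    ext s
    simp [piece]
  have hloc : IsLocallyConstant fun t => c (piece e 0 t) * V (e t) := by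
    rw [IsLocallyConstant.iff_eventually_eq]
    intro t
    obtain ⟨j, hj⟩ := hU.cover (e t)
    obtain ⟨δ, hδ, hball⟩ := Metric.mem_nhds_iff.1
      (((hU.isOpen j).preimage e.continuous).mem_nhds (show t ∈ e ⁻¹' U j from hj))
    filter_upwards [Metric.ball_mem_nhds t hδ] with s hs
    have h := hV j (piece e t s) fun u => by
      refine hball ((convex_ball t δ).add_smul_sub_mem (Metric.mem_ball_self hδ) hs
        ⟨clamp_nonneg u, clamp_le_one u⟩)
    rw [← hc.piece_mul e 0 t s, h]
    simp [piece, mul_assoc]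
  have := hloc.apply_eq_of_isPreconnected isPreconnected_univ (mem_univ 0) (mem_univ 1)
  rw [hconst, one_mul] at this
  rw [this, mul_inv_cancel_right]

end PathCocycle

section

open CategoryTheory

section Transport

variable {X : Type*} [TopologicalSpace X] {x₀ : X}

/-- The morphism of the fundamental groupoid given by a path parametrized by the real line. -/
def homOf (e : C(ℝ, X)) : FundamentalGroupoid.mk (e 0) ⟶ FundamentalGroupoid.mk (e 1) :=
  Path.Homotopic.Quotient.mk ⟨⟨fun t => e (t : ℝ), by fun_prop⟩, by simp, by simp⟩

lemma homOf_square (σ : C(ℝ × ℝ, X)) :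
    homOf ⟨fun t => σ (t, 0), by fun_prop⟩ ≫ homOf ⟨fun t => σ (1, t), by fun_prop⟩ =
      homOf ⟨fun t => σ (0, t), by fun_prop⟩ ≫ homOf ⟨fun t => σ (t, 1), by fun_prop⟩ := by
  have key : homOf (⟨fun t => (t, 0), by fun_prop⟩ : C(ℝ, ℝ × ℝ)) ≫
      homOf (⟨fun t => (1, t), by fun_prop⟩ : C(ℝ, ℝ × ℝ)) =
      homOf ⟨fun t => (0, t), by fun_prop⟩ ≫ homOf ⟨fun t => (t, 1), by fun_prop⟩ :=
    Subsingleton.elim (α := Path.Homotopic.Quotient ((0 : ℝ), (0 : ℝ)) (1, 1)) _ _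
  have := congrArg (FundamentalGroupoid.map σ).map key
  rw [Functor.map_comp, Functor.map_comp] at this
  exact this

lemma homOf_const (x : X) : homOf (ContinuousMap.const ℝ x) = 𝟙 (FundamentalGroupoid.mk x) := rfl

/-- The path between two points, extended to the real line, as a morphism. -/
lemma homOf_extend {x y : X} (p : Path x y) (e : C(ℝ, X)) (h : ∀ t : unitInterval, e t = p t)
    (h0 : e 0 = x) (h1 : e 1 = y) :
    homOf e = eqToHom (congrArg FundamentalGroupoid.mk h0) ≫
      (show FundamentalGroupoid.mk x ⟶ FundamentalGroupoid.mk y from Path.Homotopic.Quotient.mk p) ≫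
        eqToHom (congrArg FundamentalGroupoid.mk h1.symm) := by
  subst h0 h1
  simp only [eqToHom_refl, Category.comp_id, Category.id_comp]
  exact congrArg Path.Homotopic.Quotient.mk (Path.ext (funext h))

/-- Transport of a path to a loop by a choice of morphisms to the base point. -/
noncomputable def transport (T : ∀ x : X, FundamentalGroupoid.mk x ⟶ FundamentalGroupoid.mk x₀) (e : C(ℝ, X)) :
    FundamentalGroupoid.mk x₀ ⟶ FundamentalGroupoid.mk x₀ :=
  inv (T (e 0)) ≫ homOf e ≫ T (e 1)

lemma isPathCocycle_transport (T : ∀ x : X, FundamentalGroupoid.mk x ⟶ FundamentalGroupoid.mk x₀) :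
    IsPathCocycle (transport T) where
  const x := by
    rw [transport, homOf_const]
    exact (congrArg _ (Category.id_comp _)).trans (IsIso.inv_hom_id _)
  square σ := by
    have h := homOf_square σ
    have key : ∀ {a b b' d : FundamentalGroupoid X} (p : a ⟶ b) (q : b ⟶ d) (p' : a ⟶ b') (q' : b' ⟶ d)
        (ta : a ⟶ FundamentalGroupoid.mk x₀) (tb : b ⟶ FundamentalGroupoid.mk x₀)
        (tb' : b' ⟶ FundamentalGroupoid.mk x₀) (td : d ⟶ FundamentalGroupoid.mk x₀),
        p ≫ q = p' ≫ q' → (inv ta ≫ p ≫ tb) ≫ (inv tb ≫ q ≫ td) =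
          (inv ta ≫ p' ≫ tb') ≫ (inv tb' ≫ q' ≫ td) := by
      intro a b b' d p q p' q' ta tb tb' td h
      simp only [Category.assoc, IsIso.hom_inv_id_assoc]
      rw [← Category.assoc p q, h, Category.assoc]
    exact key _ _ _ _ (T _) (T _) (T _) (T _) h

variable {U : Fin 3 → Set X} {K : Fin 3 → X → ℤ}

lemma GoodCover.joinedIn_of_eq (hU : GoodCover U K) {j : Fin 3} {x y : X} (hx : x ∈ U j)
    (hy : y ∈ U j) (h : K j x = K j y) : JoinedIn (U j) x y := by
  obtain ⟨H, hH⟩ := hU.contractible {j} (Finset.singleton_nonempty j)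
  simp only [Finset.mem_singleton, forall_eq] at hH
  have aux : ∀ x ∈ U j, JoinedIn (U j) x (H (1, x)) := fun x hx => by
    have hc : Continuous fun s => H (s, x) :=
      hH.continuous_comp continuous_id continuous_const fun _ => hx
    exact ⟨⟨⟨fun t => H (t, x), hc.comp continuous_subtype_val⟩, hH.zero x hx, rfl⟩,
      fun t => hH.mem t x hx⟩
  have h1 := hH.one x hx y hy (by
    funext i
    split_ifs with hi
    · rw [hi, h]
    · rfl)
  exact ((aux x hx).trans (h1 ▸ (aux y hy).symm))

lemma GoodCover.joined_of_eq (hU : GoodCover U K) {j : Fin 3} {x y : X} (hx : x ∈ U j)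
    (hy : y ∈ U j) (h : K j x = K j y) : Joined x y :=
  (hU.joinedIn_of_eq hx hy h).joined

lemma GoodCover.joined (hU : GoodCover U K) (x y : X) : Joined x y := by
  choose P hP using hU.nonempty
  have h1 : ∀ j k k', k j = k' j → Joined (P k) (P k') := fun j k k' h =>
    hU.joined_of_eq (hP k j).1 (hP k' j).1 (by rw [(hP k j).2, (hP k' j).2, h])
  have h2 : ∀ k, Joined (P k) (P 0) := fun k =>
    (h1 0 k ![k 0, 0, 0] rfl).trans (h1 1 ![k 0, 0, 0] 0 rfl)
  have h3 : ∀ x, Joined x (P 0) := fun x => by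
    obtain ⟨j, hj⟩ := hU.cover x
    exact (hU.joined_of_eq hj (hP (fun _ => K j x) j).1 (hP (fun _ => K j x) j).2.symm).trans (h2 _)
  exact (h3 x).trans (h3 y).symm

theorem GoodCover.simplyConn (hU : GoodCover U K) (x₀ : X) : SimplyConn X x₀ where
  path x := by
    obtain ⟨p⟩ := hU.joined x x₀
    exact ⟨⟨p.extend, by fun_prop⟩, by simp, by simp⟩
  null γ h0 h1 := by
    let T : ∀ x : X, FundamentalGroupoid.mk x ⟶ FundamentalGroupoid.mk x₀ := fun x =>
      Path.Homotopic.Quotient.mk (hU.joined x x₀).some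
    obtain ⟨V, hV⟩ := hU.exists_global_potential (isPathCocycle_transport T)
    let p : Path x₀ x₀ := ⟨⟨fun t => γ (t : ℝ), by fun_prop⟩, by simpa using h0, by simpa using h1⟩
    have e1 : transport T (piece γ 0 1) = 1 := by
      rw [hV, h0, h1, mul_inv_cancel]
    have hp0 : piece γ 0 1 0 = x₀ := by simp [piece, h0]
    have hp1 : piece γ 0 1 1 = x₀ := by simp [piece, h1]
    rw [transport, homOf_extend p (piece γ 0 1) (fun t => by
      simp only [piece, ContinuousMap.coe_mk]
      rw [clamp, min_eq_right t.2.2, max_eq_right t.2.1]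
      simp [p]) hp0 hp1] at e1
    have e2 : ∀ {a b : X} (ha : a = x₀) (hb : b = x₀)
        (q : FundamentalGroupoid.mk x₀ ⟶ FundamentalGroupoid.mk x₀),
        inv (T a) ≫ (eqToHom (congrArg FundamentalGroupoid.mk ha) ≫ q ≫
          eqToHom (congrArg FundamentalGroupoid.mk hb.symm)) ≫ T b = 𝟙 _ → q = 𝟙 _ := by
      rintro a b rfl rfl q hq
      simpa [IsIso.inv_comp_eq, cancel_mono_id] using hq
    obtain ⟨F⟩ := Path.Homotopic.Quotient.exact (e2 hp0 hp1 _ e1)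
    refine ⟨⟨fun q => F (projIcc 0 1 zero_le_one q.1, projIcc 0 1 zero_le_one q.2), by
      have := continuous_projIcc (a := (0 : ℝ)) (b := 1) (h := zero_le_one)
      fun_prop⟩, fun t ht => ⟨?_, ?_⟩, fun s hs => ⟨?_, ?_⟩⟩
    · simp only [ContinuousMap.coe_mk, projIcc_left]
      rw [projIcc_of_mem _ ht]
      exact F.apply_zero _
    · simp only [ContinuousMap.coe_mk, projIcc_right]
      exact F.apply_one _
    · simp only [ContinuousMap.coe_mk, projIcc_left]
      exact F.source _
    · simp only [ContinuousMap.coe_mk, projIcc_right]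
      exact F.target _

end Transport

end

section Sheets

/-- The sheet of the logarithm containing `a`. -/
noncomputable def sheet (a : ℂ) : ℤ := round ((a.im - (Complex.log (Complex.exp a)).im) / (2 * Real.pi))

lemma sheet_eq {a : ℂ} {n : ℤ}
    (h : Complex.log (Complex.exp a) + n * (2 * Real.pi * Complex.I) = a) : sheet a = n := by
  have h' : a.im - (Complex.log (Complex.exp a)).im = n * (2 * Real.pi) := by
    conv_lhs => enter [1]; rw [← h]
    simp
  rw [sheet, h', mul_div_cancel_right₀ _ (by positivity), round_intCast]

lemma log_exp_add_sheet (a : ℂ) :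
    Complex.log (Complex.exp a) + sheet a * (2 * Real.pi * Complex.I) = a := by
  obtain ⟨n, hn⟩ := Complex.log_exp_exists a
  have h : Complex.log (Complex.exp a) + (-n : ℤ) * (2 * Real.pi * Complex.I) = a := by
    rw [hn]; push_cast; ring
  rwa [sheet_eq h]

lemma exp_log_add {z : ℂ} (hz : z ≠ 0) (n : ℤ) :
    Complex.exp (Complex.log z + n * (2 * Real.pi * Complex.I)) = z := by
  rw [Complex.exp_add, Complex.exp_log hz, Complex.exp_int_mul_two_pi_mul_I, mul_one]

lemma sheet_log_add {z : ℂ} (hz : z ≠ 0) (n : ℤ) :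
    sheet (Complex.log z + n * (2 * Real.pi * Complex.I)) = n :=
  sheet_eq (by rw [exp_log_add hz])

lemma continuousOn_sheet : ContinuousOn sheet {a | 0 < (Complex.exp a).re} := by
  rw [Int.isClosedEmbedding_coe_real.isInducing.continuousOn_iff]
  have h : ContinuousOn (fun a : ℂ => (a.im - (Complex.log (Complex.exp a)).im) / (2 * Real.pi))
      {a | 0 < (Complex.exp a).re} := by
    refine (Complex.continuous_im.continuousOn.sub (Complex.continuous_im.comp_continuousOn
      (Complex.continuous_exp.continuousOn.clog fun a ha => Or.inl ha))).div_const _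
  refine h.congr fun a _ => ?_
  have := congrArg Complex.im (log_exp_add_sheet a)
  simp only [Complex.add_im, Complex.mul_im, Complex.intCast_re, Complex.intCast_im, Complex.mul_re,
    Complex.I_re, Complex.I_im, Complex.ofReal_re, Complex.ofReal_im, Complex.re_ofNat,
    Complex.im_ofNat] at this
  simp only [Function.comp_apply]
  field_simp
  linarith

end Sheets

section Universal

/-- The universal covering of the complement of the arrangement. -/
abbrev Cov : Type := {a : Fin 3 → ℂ // ∑ i, Complex.exp (a i) = 1}

/-- The region of `Cov` where the real part of the `j`-th exponential is large. -/
def region (j : Fin 3) : Set Cov := {a | 1 / 4 < (Complex.exp (a.1 j)).re}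

/-- The sheet of the `j`-th coordinate. -/
noncomputable def covSheet (j : Fin 3) (a : Cov) : ℤ := sheet (a.1 j)

variable (J : Finset (Fin 3))

/-- The time needed to move the coordinates outside `J` far to the left. -/
noncomputable def time (a : Fin 3 → ℂ) : ℝ := ∑ l ∈ Jᶜ, |(a l).re| + 10

/-- The sum of the exponentials of the coordinates outside `J`. -/
noncomputable def weight (a : Fin 3 → ℂ) : ℂ := ∑ l ∈ Jᶜ, Complex.exp (a l)

/-- The motion of the coordinates outside `J`. -/
noncomputable def motion (p q : ℝ) (a : Fin 3 → ℂ) (l : Fin 3) : ℂ :=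
  (1 - q) * (a l - p * time J a) - 10 * q

/-- The rate of contraction. -/
noncomputable def rate (p q : ℝ) (a : Fin 3 → ℂ) : ℝ := (1 - q) * Real.exp (-(p * time J a))

/-- The part of the sum `1` which is not used by the lower bounds. -/
noncomputable def excess : ℝ := 1 - J.card / 4

/-- The motion of the exponentials of the coordinates in `J`. -/
noncomputable def expMotion (p q : ℝ) (a : Fin 3 → ℂ) (j : Fin 3) : ℂ :=
  1 / 4 + rate J p q a * (Complex.exp (a j) - 1 / 4) +
    (excess J - weight J (motion J p q a) - rate J p q a * (excess J - weight J a)) / J.card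

/-- The contraction of the intersection of the regions in `J`, in coordinates. -/
noncomputable def rawContraction (p q : ℝ) (a : Fin 3 → ℂ) (j : Fin 3) : ℂ :=
  if j ∈ J then Complex.log (expMotion J p q a j) + sheet (a j) * (2 * Real.pi * Complex.I)
  else motion J p q a j

variable {J} {p q : ℝ} {a : Fin 3 → ℂ}

lemma sum_expMotion (hJ : J.Nonempty) (ha : ∑ i, Complex.exp (a i) = 1) :
    ∑ j ∈ J, expMotion J p q a j + weight J (motion J p q a) = 1 := by
  have hc : (J.card : ℂ) ≠ 0 := by exact_mod_cast hJ.card_pos.ne'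
  rw [← Finset.sum_add_sum_compl J] at ha
  change _ + weight J a = 1 at ha
  simp only [expMotion, Finset.sum_add_distrib, ← Finset.mul_sum, Finset.sum_sub_distrib,
    Finset.sum_const, nsmul_eq_mul, excess]
  rw [mul_div_cancel₀ _ hc, eq_sub_of_add_eq ha]
  push_cast
  ring

lemma excess_ge : 1 / 4 ≤ excess J := by
  have h : J.card ≤ 3 := J.card_le_univ
  rify at h
  unfold excess
  linarith

lemma time_ge : 10 ≤ time J a :=
  le_add_of_nonneg_left (Finset.sum_nonneg fun _ _ => abs_nonneg _)

lemma exp_neg_ten : Real.exp (-10) ≤ 1 / 100 := by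
  have h : (2 : ℝ) ^ 10 ≤ Real.exp 1 ^ 10 :=
    pow_le_pow_left₀ zero_le_two (by linarith [Real.exp_one_gt_d9]) 10
  rw [Real.exp_one_pow] at h
  rw [Real.exp_neg, inv_le_comm₀ (Real.exp_pos _) (by norm_num)]
  norm_num at h ⊢
  linarith

lemma norm_weight_le {b : Fin 3 → ℂ} (hJ : J.Nonempty) {ε : ℝ}
    (h : ∀ l ∉ J, ‖Complex.exp (b l)‖ ≤ ε) (hε : 0 ≤ ε) : ‖weight J b‖ ≤ 2 * ε := by
  refine (norm_sum_le_of_le Jᶜ fun l hl => h l (Finset.mem_compl.1 hl)).trans ?_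
  rw [Finset.sum_const, nsmul_eq_mul]
  refine mul_le_mul_of_nonneg_right ?_ hε
  have := hJ.card_pos
  have h : Jᶜ.card ≤ 2 := by
    rw [Finset.card_compl, Fintype.card_fin]; omega
  exact_mod_cast h

lemma re_le_time {l : Fin 3} (hl : l ∉ J) : (a l).re ≤ time J a - 10 := by
  rw [time, add_sub_cancel_right]
  exact (le_abs_self _).trans (Finset.single_le_sum (f := fun l => |(a l).re|)
    (fun _ _ => abs_nonneg _) (Finset.mem_compl.2 hl))

lemma expMotion_re (hJ : J.Nonempty) (hp : 0 ≤ p) (hq : 0 ≤ q) (hq1 : q ≤ 1)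
    (hpq : q = 0 ∨ p = 1) {j : Fin 3} (hj : 1 / 4 < (Complex.exp (a j)).re) :
    1 / 4 < (expMotion J p q a j).re := by
  have hc : (0 : ℝ) < J.card := by exact_mod_cast hJ.card_pos
  have hr : 0 ≤ rate J p q a := mul_nonneg (by linarith) (Real.exp_pos _).le
  have hre : (expMotion J p q a j).re = 1 / 4 + rate J p q a * ((Complex.exp (a j)).re - 1 / 4) +
      (excess J - (weight J (motion J p q a)).re - rate J p q a * (excess J - (weight J a).re)) /
        J.card := by
    rw [expMotion, ← Complex.ofReal_natCast, Complex.add_re, Complex.div_ofReal_re]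
    simp
  have hd := excess_ge (J := J)
  have ht := time_ge (J := J) (a := a)
  rw [hre]
  rcases hpq with rfl | rfl
  · have hr' : rate J p 0 a = Real.exp (-(p * time J a)) := by simp [rate]
    have hw : weight J (motion J p 0 a) = rate J p 0 a * weight J a := by
      rw [weight, weight, Finset.mul_sum, hr']
      refine Finset.sum_congr rfl fun l _ => ?_
      push_cast
      rw [← Complex.exp_add, motion]
      congr 1
      push_cast
      ring
    have hr1 : rate J p 0 a ≤ 1 := by
      rw [hr', Real.exp_le_one_iff]
      nlinarith
    have hpos : 0 < rate J p 0 a := hr' ▸ Real.exp_pos _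
    rw [hw, Complex.re_ofReal_mul]
    have h1 : 0 ≤ (excess J - rate J p 0 a * (weight J a).re - rate J p 0 a * (excess J - (weight J a).re)) /
        J.card := by
      refine div_nonneg ?_ hc.le
      nlinarith
    nlinarith [mul_pos hpos (sub_pos.2 hj)]
  · have he := exp_neg_ten
    have hrl : rate J 1 q a ≤ Real.exp (-10) := by
      rw [rate, one_mul]
      have : Real.exp (-time J a) ≤ Real.exp (-10) := Real.exp_le_exp.2 (by linarith)
      nlinarith [Real.exp_pos (-time J a)]
    have hw : ‖weight J (motion J 1 q a)‖ ≤ 2 * Real.exp (-10) := by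
      refine norm_weight_le hJ (fun l hl => ?_) (Real.exp_pos _).le
      rw [Complex.norm_exp, Real.exp_le_exp]
      have : (motion J 1 q a l).re = (1 - q) * ((a l).re - time J a) - 10 * q := by
        simp [motion]
      rw [this]
      nlinarith [re_le_time (a := a) hl]
    have hw' : ‖(rate J 1 q a : ℂ) * weight J a‖ ≤ 2 * Real.exp (-10) := by
      rw [norm_mul, Complex.norm_real, Real.norm_of_nonneg hr]
      have h1 : ‖weight J a‖ ≤ 2 * Real.exp (time J a - 10) :=
        norm_weight_le hJ (fun l hl => by
          rw [Complex.norm_exp, Real.exp_le_exp]; exact re_le_time hl) (Real.exp_pos _).le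
      have h2 : rate J 1 q a ≤ Real.exp (-time J a) := by
        rw [rate, one_mul]
        nlinarith [Real.exp_pos (-time J a)]
      calc _ ≤ Real.exp (-time J a) * (2 * Real.exp (time J a - 10)) :=
            mul_le_mul h2 h1 (norm_nonneg _) (Real.exp_pos _).le
        _ = 2 * (Real.exp (-time J a) * Real.exp (time J a - 10)) := by ring
        _ = _ := by rw [← Real.exp_add]; ring_nf
    have h1 := (abs_le.1 (Complex.abs_re_le_norm (weight J (motion J 1 q a)))).2
    have h2 := (abs_le.1 (Complex.abs_re_le_norm ((rate J 1 q a : ℂ) * weight J a))).1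
    rw [Complex.re_ofReal_mul] at h2
    have h3 : 0 < (excess J - (weight J (motion J 1 q a)).re -
        rate J 1 q a * (excess J - (weight J a).re)) / J.card := by
      refine div_pos ?_ hc
      nlinarith
    nlinarith [mul_nonneg hr (sub_pos.2 hj).le]

end Universal

section Universal

variable {J : Finset (Fin 3)} {p q : ℝ} {a : Fin 3 → ℂ}

lemma mem_region {j : Fin 3} {x : Cov} : x ∈ region j ↔ 1 / 4 < (Complex.exp (x.1 j)).re := Iff.rfl

lemma exp_re_pos {j : Fin 3} {x : Cov} (h : x ∈ region j) : 0 < (Complex.exp (x.1 j)).re :=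
  lt_trans (by norm_num) (mem_region.1 h)

@[fun_prop]
lemma continuous_coord (j : Fin 3) : Continuous fun x : Cov => x.1 j :=
  (continuous_apply j).comp continuous_subtype_val

lemma continuousOn_covSheet (j : Fin 3) : ContinuousOn (covSheet j) (region j) :=
  continuousOn_sheet.comp (continuous_coord j).continuousOn fun _ hx => exp_re_pos hx

lemma exp_rawContraction (hJ : J.Nonempty) (hp : 0 ≤ p) (hq : 0 ≤ q) (hq1 : q ≤ 1)
    (hpq : q = 0 ∨ p = 1) (ha : ∀ j ∈ J, 1 / 4 < (Complex.exp (a j)).re) {j : Fin 3} (hj : j ∈ J) :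
    Complex.exp (rawContraction J p q a j) = expMotion J p q a j := by
  have h := expMotion_re hJ hp hq hq1 hpq (ha j hj)
  rw [rawContraction, if_pos hj, exp_log_add]
  intro h0
  rw [h0, Complex.zero_re] at h
  linarith

lemma sum_exp_rawContraction (hJ : J.Nonempty) (hp : 0 ≤ p) (hq : 0 ≤ q) (hq1 : q ≤ 1)
    (hpq : q = 0 ∨ p = 1) (ha : ∀ j ∈ J, 1 / 4 < (Complex.exp (a j)).re)
    (h : ∑ i, Complex.exp (a i) = 1) : ∑ i, Complex.exp (rawContraction J p q a i) = 1 := by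
  rw [← sum_expMotion (p := p) (q := q) hJ h, ← Finset.sum_add_sum_compl J, weight]
  congr 1
  · exact Finset.sum_congr rfl fun j hj => exp_rawContraction hJ hp hq hq1 hpq ha hj
  · refine Finset.sum_congr rfl fun j hj => ?_
    rw [rawContraction, if_neg (Finset.mem_compl.1 hj)]

lemma rawContraction_zero : rawContraction J 0 0 a = a := by
  funext j
  have hm : motion J 0 0 a = a := by funext l; simp [motion]
  rw [rawContraction]
  split_ifs with hj
  · have : expMotion J 0 0 a j = Complex.exp (a j) := by
      simp [expMotion, hm, rate]
    rw [this, log_exp_add_sheet]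
  · rw [hm]

lemma rawContraction_one {b : Fin 3 → ℂ} (h : ∀ j ∈ J, sheet (a j) = sheet (b j)) :
    rawContraction J 1 1 a = rawContraction J 1 1 b := by
  have hm : motion J 1 1 a = motion J 1 1 b := by funext l; simp [motion]
  funext j
  simp only [rawContraction, hm, expMotion, rate, sub_self, zero_mul, Complex.ofReal_zero]
  split_ifs with hj
  · rw [h j hj]
  · rfl

open Classical in
/-- The contraction of the intersection of the regions in `J`. -/
noncomputable def contraction (J : Finset (Fin 3)) (x : ℝ × Cov) : Cov :=
  if h : ∑ i, Complex.exp (rawContraction J (clamp (2 * x.1)) (clamp (2 * x.1 - 1)) x.2.1 i) = 1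
  then ⟨_, h⟩ else x.2

lemma clamp_phase (s : ℝ) : clamp (2 * s - 1) = 0 ∨ clamp (2 * s) = 1 := by
  simp only [clamp]
  rcases le_total (2 * s) 1 with h | h
  · left; rw [max_eq_left]; exact min_le_of_right_le (by linarith)
  · right; rw [min_eq_left h, max_eq_right zero_le_one]

lemma contraction_val (hJ : J.Nonempty) (s : ℝ) {a : Cov} (ha : ∀ j ∈ J, a ∈ region j) :
    (contraction J (s, a)).1 =
      rawContraction J (clamp (2 * s)) (clamp (2 * s - 1)) a.1 := by
  have h := sum_exp_rawContraction hJ (clamp_nonneg (2 * s)) (clamp_nonneg (2 * s - 1)) (clamp_le_one _)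
    (clamp_phase s) ha a.2
  rw [contraction, dif_pos h]

lemma continuousOn_expMotion (j : Fin 3) :
    Continuous fun x : ℝ × Cov => expMotion J (clamp (2 * x.1)) (clamp (2 * x.1 - 1)) x.2.1 j := by
  have := continuous_clamp
  have h (l : Fin 3) : Continuous fun x : ℝ × Cov => x.2.1 l :=
    (continuous_coord l).comp continuous_snd
  simp only [expMotion, rate, weight, motion, time]
  fun_prop

lemma contractibleFibers_region (hJ : J.Nonempty) :
    ContractibleFibers {x | ∀ j ∈ J, x ∈ region j}
      (fun x j => if j ∈ J then covSheet j x else 0) (contraction J) where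
  cont := by
    refine continuousOn_pi.2 fun j => ?_
    by_cases hj : j ∈ J
    · simp only [if_pos hj]
      exact (continuousOn_covSheet j).mono fun x hx => hx j hj
    · simp only [if_neg hj]
      exact continuousOn_const
  contH := by
    refine Topology.IsInducing.subtypeVal.continuousOn_iff.2 ?_
    have h : ContinuousOn (fun x : ℝ × Cov =>
        rawContraction J (clamp (2 * x.1)) (clamp (2 * x.1 - 1)) x.2.1)
        (univ ×ˢ {x | ∀ j ∈ J, x ∈ region j}) := by
      refine continuousOn_pi.2 fun j => ?_
      simp only [rawContraction]
      by_cases hj : j ∈ J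
      · simp only [if_pos hj]
        refine ((continuousOn_expMotion j).continuousOn.clog fun x hx => Or.inl ?_).add
          (ContinuousOn.mul ?_ continuousOn_const)
        · exact lt_trans (by norm_num) (expMotion_re hJ (clamp_nonneg _) (clamp_nonneg _)
            (clamp_le_one _) (clamp_phase x.1) (hx.2 j hj))
        · have hs : ContinuousOn (fun x : ℝ × Cov => sheet (x.2.1 j))
              (univ ×ˢ {x | ∀ j ∈ J, x ∈ region j}) :=
            (continuousOn_covSheet j).comp continuousOn_snd fun x hx => hx.2 j hj
          exact (continuous_of_discreteTopology (f := fun n : ℤ => (n : ℂ))).comp_continuousOn hs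
      · simp only [if_neg hj, motion, time]
        have := continuous_clamp
        have h (l : Fin 3) : Continuous fun x : ℝ × Cov => x.2.1 l :=
          (continuous_coord l).comp continuous_snd
        fun_prop
    exact h.congr fun x hx => contraction_val hJ x.1 hx.2
  zero x hx := Subtype.ext <| by
    rw [contraction_val hJ 0 hx, mul_zero, clamp_zero, zero_sub]
    have : clamp (-1) = 0 := by simp [clamp]
    rw [this, rawContraction_zero]
  one x hx x' hx' h := Subtype.ext <| by
    rw [contraction_val hJ 1 hx, contraction_val hJ 1 hx']
    have h1 : clamp (2 * 1) = 1 := by norm_num [clamp]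
    have h2 : clamp (2 * 1 - 1) = 1 := by norm_num [clamp]
    rw [h1, h2]
    refine rawContraction_one fun j hj => ?_
    simpa [hj, covSheet] using congrFun h j
  mem s x hx j hj := by
    rw [mem_region, contraction_val hJ s hx, exp_rawContraction hJ (clamp_nonneg _) (clamp_nonneg _)
      (clamp_le_one _) (clamp_phase s) hx hj]
    exact expMotion_re hJ (clamp_nonneg _) (clamp_nonneg _) (clamp_le_one _) (clamp_phase s) (hx j hj)

lemma exists_mem_region (a : Cov) : ∃ j, a ∈ region j := by
  by_contra! h
  have h' : ∀ j, (Complex.exp (a.1 j)).re ≤ 1 / 4 := fun j => not_lt.1 (h j)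
  have := congrArg Complex.re a.2
  rw [Complex.re_sum, Fin.sum_univ_three, Complex.one_re] at this
  linarith [h' 0, h' 1, h' 2]

lemma goodCover_region : GoodCover region covSheet where
  isOpen j := isOpen_lt continuous_const
    (Complex.continuous_re.comp (Complex.continuous_exp.comp (continuous_coord j)))
  cover := exists_mem_region
  cont := continuousOn_covSheet
  contractible J hJ := ⟨_, contractibleFibers_region hJ⟩
  nonempty k := by
    have h3 : (1 / 3 : ℂ) ≠ 0 := by norm_num
    refine ⟨⟨fun j => Complex.log (1 / 3) + k j * (2 * Real.pi * Complex.I), ?_⟩, fun j => ⟨?_, ?_⟩⟩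
    · simp only [exp_log_add h3, Fin.sum_univ_three]
      norm_num
    · simp only [mem_region, exp_log_add h3]
      norm_num
    · simp only [covSheet, sheet_log_add h3]

end Universal

section Lifting

variable {X Y : Type*} [TopologicalSpace X] [TopologicalSpace Y]

/-- Maps from simply connected spaces lift uniquely along `p`. -/
structure UniqueLifts (p : C(X, Y)) : Prop where
  exists_lift : ∀ {A : Type} [TopologicalSpace A] [SimplyConnectedSpace A]
    [LocallyPathConnectedSpace A] (f : C(A, Y)) (a : A) (x : X), p x = f a →
    ∃ F : C(A, X), F a = x ∧ ∀ b, p (F b) = f b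
  unique : ∀ {A : Type} [TopologicalSpace A] [PreconnectedSpace A] (F G : C(A, X)) (a : A),
    F a = G a → (∀ b, p (F b) = p (G b)) → F = G

variable {p : C(X, Y)} {x₀ : X} {y₀ : Y}

lemma UniqueLifts.eq_of_mem (hp : UniqueLifts p) {A : Type} [TopologicalSpace A] {F : C(A, X)}
    {C : Set A} (hC : IsPreconnected C) (hF : ∀ c ∈ C, p (F c) = p x₀) {c b : A} (hc : c ∈ C)
    (hFc : F c = x₀) (hb : b ∈ C) : F b = x₀ := by
  have := Subtype.preconnectedSpace hC
  have h := hp.unique (A := C) ⟨fun a => F a, by fun_prop⟩ (ContinuousMap.const C x₀) ⟨c, hc⟩ hFc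
    fun a => hF _ a.2
  exact congrArg (fun G : C(C, X) => G ⟨b, hb⟩) h

lemma isPreconnected_outside :
    IsPreconnected {q : ℝ × ℝ | q.1 ≤ 0 ∨ 1 ≤ q.1 ∨ q.2 ≤ 0 ∨ 1 ≤ q.2} := by
  have hx : IsLinearMap ℝ (Prod.fst : ℝ × ℝ → ℝ) := LinearMap.isLinear (LinearMap.fst ℝ ℝ ℝ)
  have hy : IsLinearMap ℝ (Prod.snd : ℝ × ℝ → ℝ) := LinearMap.isLinear (LinearMap.snd ℝ ℝ ℝ)
  have h1 := (convex_halfSpace_le hx 0).isPreconnected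
  have h2 := (convex_halfSpace_ge hx 1).isPreconnected
  have h3 := (convex_halfSpace_le hy 0).isPreconnected
  have h4 := (convex_halfSpace_ge hy 1).isPreconnected
  have h34 := h3.union (0, 0) (by simp) (by simp) h1
  have h342 := h34.union (1, 0) (by simp) (by simp) h2
  convert h342.union (0, 1) (by simp) (by simp) h4 using 1
  ext q
  simp only [mem_union, mem_ofPred_eq]
  tauto

/-- The image of a generalized loop. -/
def mapLoop (hp : p x₀ = y₀) (f : GenLoop (Fin 2) X x₀) : GenLoop (Fin 2) Y y₀ :=
  ⟨p.comp f.1, fun t ht => (congrArg p (f.2 t ht)).trans hp⟩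

/-- The map induced on `π₂`, as a function. -/
def mapPiFun (hp : p x₀ = y₀) (A : Additive (π_ 2 X x₀)) : Additive (π_ 2 Y y₀) :=
  Additive.ofMul (Quotient.map (mapLoop hp)
    (fun _ _ h => ContinuousMap.HomotopicRel.comp_continuousMap h p) A.toMul)

/-- The map induced on `π₂`. -/
noncomputable def mapPi (hp : p x₀ = y₀) : Additive (π_ 2 X x₀) →+ Additive (π_ 2 Y y₀) :=
  AddMonoidHom.mk' (mapPiFun hp) <| by
    rintro ⟨f⟩ ⟨g⟩
    have h : mapLoop hp (GenLoop.transAt 0 f g) =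
        GenLoop.transAt 0 (mapLoop hp f) (mapLoop hp g) := by
      ext t
      change p (ite _ _ _) = ite _ _ _
      split_ifs <;> rfl
    exact (congrArg (mapPiFun hp) (piMk_transAt 0 f g)).symm.trans
      ((congrArg piMk h).trans (piMk_transAt 0 _ _))

lemma mapPi_piMk (hp : p x₀ = y₀) (f : GenLoop (Fin 2) X x₀) :
    mapPi hp (piMk f) = piMk (mapLoop hp f) := rfl

lemma UniqueLifts.mapPi_bijective (h : UniqueLifts p) (hp : p x₀ = y₀) :
    Function.Bijective (mapPi (p := p) hp) := by
  subst hp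
  refine ⟨(injective_iff_map_eq_zero _).2 ?_, ?_⟩
  · rintro ⟨f⟩ hf
    change piMk f = 0
    have hf' : piMk (mapLoop rfl f) = (piMk GenLoop.const : Additive (π_ 2 Y (p x₀))) :=
      Eq.trans hf piMk_const.symm
    obtain ⟨G, hG, G0, G1⟩ := exists_extend_homotopy (Quotient.exact hf')
    obtain ⟨F, F0, hF⟩ := h.exists_lift G (0, 0, 0) x₀ (hG _ _ _ (by simp)).symm
    have hout : ∀ s x y, (x ≤ 0 ∨ 1 ≤ x ∨ y ≤ 0 ∨ 1 ≤ y) → F (s, x, y) = x₀ := fun s x y hxy =>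
      h.eq_of_mem (isPreconnected_univ.prod isPreconnected_outside)
        (fun c hc => (hF c).trans (hG _ _ _ hc.2)) ⟨mem_univ 0, Or.inl le_rfl⟩ F0
        (show (s, x, y) ∈ _ from ⟨mem_univ _, hxy⟩)
    have e0 : (⟨fun q => F (0, q), by fun_prop⟩ : C(ℝ × ℝ, X)) = extend f := by
      refine h.unique _ _ (0, 0) ?_ fun q => ?_
      · exact F0.trans (constOutside_extend f _ _ (by simp)).symm
      · exact (hF _).trans (G0 q)
    have e1 : ∀ q, F (1, q) = x₀ := fun q => by
      refine h.eq_of_mem (C := {1} ×ˢ univ) (isPreconnected_singleton.prod isPreconnected_univ)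
        (fun c hc => ?_) (c := (1, 0, 0)) (by simp) (hout _ _ _ (by simp)) (by simp)
      obtain ⟨s, c⟩ := c
      obtain rfl : s = 1 := hc.1
      exact (hF _).trans (G1 c)
    rw [← cl_extend, ← e0, cl_homotopy F (fun s _ x _ y _ hxy => hout s x y ?_) _
      (ContinuousMap.const _ x₀) (fun _ _ _ _ => rfl) fun x _ y _ => (e1 _).symm]
    · exact cl_const _ fun _ _ _ _ => rfl
    · rcases hxy with rfl | rfl | rfl | rfl <;> simp
  · rintro ⟨f⟩
    change ∃ a, mapPi rfl a = piMk f
    have hG := constOutside_extend f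
    obtain ⟨F, F0, hF⟩ := h.exists_lift (extend f) (0, 0) x₀ (hG _ _ (by simp)).symm
    have hout : ConstOutside x₀ F := fun x y hxy =>
      h.eq_of_mem isPreconnected_outside (fun c hc => (hF c).trans (hG _ _ hc))
        (Or.inl (le_refl (0 : ℝ))) F0 hxy
    refine ⟨piMk (toGenLoop F hout.bdryConst), ?_⟩
    rw [mapPi_piMk, ← cl_extend f, cl_eq _ hG.bdryConst]
    congr 1
    ext t
    exact hF _

end Lifting

section Projection

/-- The complement of the arrangement. -/
abbrev arrCompl : Set (ℂ × ℂ) := {p : ℂ × ℂ | p.1 ≠ 0 ∧ p.2 ≠ 0 ∧ p.1 + p.2 ≠ 1}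

/-- The values of the defining linear forms, up to sign. -/
def forms (z : ℂ × ℂ) : Fin 3 → ℂ := ![z.1, z.2, 1 - z.1 - z.2]

@[fun_prop]
lemma continuous_forms (i : Fin 3) : Continuous fun z => forms z i := by
  fin_cases i
  · exact continuous_fst
  · exact continuous_snd
  · exact (continuous_const.sub continuous_fst).sub continuous_snd

lemma forms_ne_zero (z : arrCompl) (i : Fin 3) : forms z i ≠ 0 := by
  obtain ⟨z, h1, h2, h3⟩ := z
  fin_cases i
  · exact h1
  · exact h2
  · intro h
    apply h3
    change 1 - z.1 - z.2 = 0 at h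
    linear_combination -h

lemma sum_forms (z : ℂ × ℂ) : ∑ i, forms z i = 1 := by
  rw [Fin.sum_univ_three]
  change z.1 + z.2 + (1 - z.1 - z.2) = 1
  ring

lemma forms_injective : Function.Injective forms := fun _ _ h =>
  Prod.ext (congrFun h 0) (congrFun h 1)

lemma exp_perm (σ : Equiv.Perm (Fin 3)) (a : Cov) :
    1 - Complex.exp (a.1 (σ 0)) - Complex.exp (a.1 (σ 1)) = Complex.exp (a.1 (σ 2)) := by
  have h := a.2
  rw [← Equiv.sum_comp σ, Fin.sum_univ_three] at h
  linear_combination -h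

/-- The covering projection, with permuted coordinates. -/
noncomputable def proj (σ : Equiv.Perm (Fin 3)) : C(Cov, arrCompl) :=
  ⟨fun a => ⟨(Complex.exp (a.1 (σ 0)), Complex.exp (a.1 (σ 1))), Complex.exp_ne_zero _,
    Complex.exp_ne_zero _, fun h => Complex.exp_ne_zero (a.1 (σ 2)) <| by
      rw [← exp_perm]; linear_combination -h⟩, by
    have h := continuous_coord
    exact Continuous.subtype_mk ((Complex.continuous_exp.comp (h _)).prodMk
      (Complex.continuous_exp.comp (h _))) _⟩

lemma forms_proj (σ : Equiv.Perm (Fin 3)) (a : Cov) (i : Fin 3) :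
    forms (proj σ a) i = Complex.exp (a.1 (σ i)) := by
  fin_cases i
  · rfl
  · rfl
  · exact exp_perm σ a

lemma proj_eq_iff (σ : Equiv.Perm (Fin 3)) (a : Cov) (z : arrCompl) :
    proj σ a = z ↔ ∀ i, Complex.exp (a.1 i) = forms z (σ.symm i) := by
  rw [← Subtype.val_inj, ← forms_injective.eq_iff, funext_iff, ← σ.symm.forall_congr_right]
  simp only [forms_proj, Equiv.apply_symm_apply]

lemma uniqueLifts_proj (σ : Equiv.Perm (Fin 3)) : UniqueLifts (proj σ) where
  exists_lift {A} _ _ _ f a x hx := by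
    rw [proj_eq_iff] at hx
    have key (i : Fin 3) : ∃ F : C(A, ℂ), F a = x.1 i ∧
        ∀ b, Complex.exp (F b) = forms (f b) (σ.symm i) := by
      let g : C(A, {z : ℂ // z ≠ 0}) :=
        ⟨fun b => ⟨forms (f b) (σ.symm i), forms_ne_zero _ _⟩,
          ((continuous_forms _).comp (continuous_subtype_val.comp f.continuous)).subtype_mk _⟩
      obtain ⟨F, ⟨h1, h2⟩, -⟩ := Complex.isCoveringMap_exp.existsUnique_continuousMap_lifts g a
        (x.1 i) (Subtype.ext (hx i))
      exact ⟨F, h1, fun b => congrArg Subtype.val (congrFun h2 b)⟩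
    choose F h1 h2 using key
    refine ⟨⟨fun b => ⟨fun i => F i b, ?_⟩, ?_⟩, ?_, fun b => ?_⟩
    · simp only [h2]
      rw [Equiv.sum_comp σ.symm, sum_forms]
    · exact (continuous_pi fun i => (F i).continuous).subtype_mk _
    · exact Subtype.ext (funext h1)
    · exact (proj_eq_iff _ _ _).2 fun i => h2 i b
  unique {A} _ _ F G a h0 h := by
    refine ContinuousMap.ext fun b => ?_
    refine Subtype.ext (funext fun i => ?_)
    have hF : Continuous fun b => (F b).1 i := (continuous_coord i).comp F.continuous
    have hG : Continuous fun b => (G b).1 i := (continuous_coord i).comp G.continuous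
    refine congrFun (Complex.isCoveringMap_exp.eq_of_comp_eq hF hG (funext fun c => ?_) a
      (by rw [h0])) b
    refine Subtype.ext ?_
    change Complex.exp _ = Complex.exp _
    rw [(proj_eq_iff σ _ _).1 (h c) i, (proj_eq_iff σ _ _).1 rfl i]

lemma exists_proj_eq (m : arrCompl) : ∃ σ x, proj σ x = m ∧ x ∈ region 0 := by
  obtain ⟨j, hj⟩ : ∃ j, 1 / 4 < (forms m j).re := by
    by_contra! h
    have := congrArg Complex.re (sum_forms m)
    rw [Complex.re_sum, Fin.sum_univ_three, Complex.one_re] at this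
    linarith [h 0, h 1, h 2]
  let σ := Equiv.swap 0 j
  have hx : ∀ i, Complex.exp (Complex.log (forms m (σ.symm i))) = forms m (σ.symm i) :=
    fun i => Complex.exp_log (forms_ne_zero _ _)
  refine ⟨σ, ⟨fun i => Complex.log (forms m (σ.symm i)), ?_⟩, (proj_eq_iff _ _ _).2 hx, ?_⟩
  · simp only [hx]
    rw [Equiv.sum_comp σ.symm, sum_forms]
  · rw [mem_region, hx]
    simpa [σ] using hj

end Projection

section Subgroups

/-- The elements of `N` supported in `{0, …, n}`. -/
noncomputable def initialPart (N : Submodule ℤ (ℕ →₀ ℤ)) (n : ℕ) : Submodule ℤ (ℕ →₀ ℤ) :=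
  N ⊓ Finsupp.supported ℤ ℤ {i | i ≤ n}

lemma mem_initialPart {N : Submodule ℤ (ℕ →₀ ℤ)} {n : ℕ} {x : ℕ →₀ ℤ} :
    x ∈ initialPart N n ↔ x ∈ N ∧ ∀ i, n < i → x i = 0 := by
  rw [initialPart, Submodule.mem_inf, Finsupp.mem_supported']
  simp

lemma exists_leading (N : Submodule ℤ (ℕ →₀ ℤ)) (n : ℕ) :
    ∃ b ∈ initialPart N n, ∀ x ∈ initialPart N n, b n ∣ x n := by
  obtain ⟨d, hd⟩ := (IsPrincipalIdealRing.principal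
    ((initialPart N n).map (Finsupp.lapply (R := ℤ) n : (ℕ →₀ ℤ) →ₗ[ℤ] ℤ))).principal
  obtain ⟨b, hb, rfl⟩ : ∃ b ∈ initialPart N n, b n = d := by
    have : d ∈ (initialPart N n).map (Finsupp.lapply (R := ℤ) n : (ℕ →₀ ℤ) →ₗ[ℤ] ℤ) :=
      hd ▸ Submodule.mem_span_singleton_self d
    simpa using this
  refine ⟨b, hb, fun x hx => ?_⟩
  have : x n ∈ (initialPart N n).map (Finsupp.lapply (R := ℤ) n : (ℕ →₀ ℤ) →ₗ[ℤ] ℤ) :=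
    ⟨x, hx, rfl⟩
  rw [hd] at this
  exact Ideal.mem_span_singleton.1 this

lemma linearIndependent_leading {J : Set ℕ} {b : J → ℕ →₀ ℤ} (h0 : ∀ j : J, b j j ≠ 0)
    (h : ∀ (j : J) i, (j : ℕ) < i → b j i = 0) : LinearIndependent ℤ b := by
  rw [linearIndependent_iff]
  intro l hl
  by_contra hne
  have hs := Finsupp.support_nonempty_iff.2 hne
  set m := l.support.max' hs
  have hm := l.support.max'_mem hs
  have key := DFunLike.congr_fun hl (m : ℕ)
  rw [Finsupp.linearCombination_apply, Finsupp.sum_apply, Finsupp.sum,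
    Finset.sum_eq_single m] at key
  · rw [Finsupp.smul_apply, Finsupp.zero_apply, smul_eq_mul, mul_eq_zero] at key
    exact key.elim (Finsupp.mem_support_iff.1 hm) (h0 m)
  · intro j hj hjm
    have : j < m := lt_of_le_of_ne (l.support.le_max' j hj) hjm
    rw [Finsupp.smul_apply, h j m this, smul_zero]
  · exact fun hn => absurd hm hn

lemma exists_basis_initial (N : Submodule ℤ (ℕ →₀ ℤ)) : ∃ (J : Set ℕ) (b : J → ℕ →₀ ℤ),
    LinearIndependent ℤ b ∧ Submodule.span ℤ (range b) = N ∧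
      ∀ (j : J) i, (j : ℕ) < i → b j i = 0 := by
  choose b hb hdvd using exists_leading N
  have hbN n := mem_initialPart.1 (hb n)
  refine ⟨{n | b n n ≠ 0}, fun j => b j, linearIndependent_leading (fun j => j.2)
    fun j => (hbN j).2, le_antisymm ?_ ?_, fun j => (hbN j).2⟩
  · rw [Submodule.span_le]
    rintro _ ⟨j, rfl⟩
    exact (hbN j).1
  · have key : ∀ n, ∀ x ∈ N, (∀ i, n ≤ i → x i = 0) →
        x ∈ Submodule.span ℤ (range fun j : {n | b n n ≠ 0} => b j) := by
      intro n
      induction n with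
      | zero =>
        intro x _ hx
        have : x = 0 := Finsupp.ext fun i => hx i (Nat.zero_le i)
        exact this ▸ Submodule.zero_mem _
      | succ n ih =>
        intro x hxN hx
        obtain ⟨k, hk⟩ := hdvd n x (mem_initialPart.2 ⟨hxN, hx⟩)
        by_cases h0 : b n n = 0
        · refine ih x hxN fun i hi => ?_
          rcases hi.eq_or_lt with rfl | hi
          · rw [hk, h0, zero_mul]
          · exact hx i hi
        · rw [← sub_add_cancel x (k • b n)]
          refine Submodule.add_mem _ (ih _ (N.sub_mem hxN (N.smul_mem k (hbN n).1)) fun i hi => ?_)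
            (Submodule.smul_mem _ _ (Submodule.subset_span ⟨⟨n, h0⟩, rfl⟩))
          rw [Finsupp.sub_apply, Finsupp.smul_apply, smul_eq_mul]
          rcases hi.eq_or_lt with rfl | hi
          · rw [hk]; ring
          · rw [hx i hi, (hbN n).2 i hi]; ring
    intro x hx
    obtain ⟨n, hn⟩ := x.support.bddAbove
    refine key (n + 1) x hx fun i hi => ?_
    by_contra h
    have := hn (Finset.mem_coe.2 (Finsupp.mem_support_iff.2 h))
    omega

/-- A subgroup of a free abelian group of countable rank, whose elements do not have uniformly
bounded supports, is free of countably infinite rank. -/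
theorem nonempty_addEquiv_finsupp {ι A : Type*} [Countable ι] [AddCommGroup A]
    (Φ : A →+ (ι →₀ ℤ)) (hΦ : Function.Injective Φ)
    (h : ∀ F : Set ι, F.Finite → ∃ a, ∃ i ∉ F, Φ a i ≠ 0) : Nonempty (A ≃+ (ℕ →₀ ℤ)) := by
  have : Infinite ι := by
    refine ⟨fun _ => ?_⟩
    obtain ⟨_, i, hi, -⟩ := h univ finite_univ
    exact hi (mem_univ i)
  obtain ⟨e⟩ : Nonempty (ι ≃ ℕ) := by
    obtain ⟨_⟩ := nonempty_denumerable ι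
    exact ⟨Denumerable.eqv ι⟩
  let E : (ι →₀ ℤ) ≃ₗ[ℤ] (ℕ →₀ ℤ) := Finsupp.domLCongr e
  let Ψ : A →ₗ[ℤ] (ℕ →₀ ℤ) := E.toLinearMap ∘ₗ Φ.toIntLinearMap
  have hΨ : Function.Injective Ψ := E.injective.comp hΦ
  obtain ⟨J, b, hb, hspan, hJ⟩ := exists_basis_initial (LinearMap.range Ψ)
  have hJinf : J.Infinite := by
    intro hfin
    obtain ⟨n, hn⟩ := hfin.bddAbove
    obtain ⟨a, i, hi, hai⟩ := h (e ⁻¹' Iic n) ((finite_Iic n).preimage e.injective.injOn)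
    have hle : LinearMap.range Ψ ≤ Finsupp.supported ℤ ℤ (Iic n) := by
      rw [← hspan, Submodule.span_le]
      rintro _ ⟨j, rfl⟩
      refine (Finsupp.mem_supported' _ _).2 fun i hi => hJ j i ?_
      exact lt_of_le_of_lt (hn j.2) (not_le.1 hi)
    have := (Finsupp.mem_supported' _ _).1 (hle ⟨a, rfl⟩) (e i) hi
    apply hai
    simpa [Ψ, E] using this
  have : Infinite J := hJinf.to_subtype
  obtain ⟨e'⟩ : Nonempty (J ≃ ℕ) := by
    obtain ⟨_⟩ := nonempty_denumerable J
    exact ⟨Denumerable.eqv J⟩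
  exact ⟨((LinearEquiv.ofInjective Ψ hΨ).trans (((LinearEquiv.ofEq _ _ hspan.symm).trans
    hb.linearCombinationEquiv.symm).trans (Finsupp.domLCongr e'))).toAddEquiv⟩

end Subgroups

section CubeMap

/-- The point of the unit circle with the given argument, in turns. -/
noncomputable def spin (t : ℝ) : ℂ := Complex.exp (t * (2 * Real.pi * Complex.I))

lemma continuous_spin : Continuous spin := by unfold spin; fun_prop

lemma spin_add (s t : ℝ) : spin (s + t) = spin s * spin t := by
  rw [spin, spin, spin, ← Complex.exp_add]
  push_cast
  ring_nf

lemma norm_spin (t : ℝ) : ‖spin t‖ = 1 := by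
  have : spin t = Complex.exp ((t * (2 * Real.pi) : ℝ) * Complex.I) := by
    rw [spin]; push_cast; ring_nf
  rw [this, Complex.norm_exp_ofReal_mul_I]

lemma spin_intCast (n : ℤ) : spin n = 1 := by
  rw [spin, Complex.ofReal_intCast, Complex.exp_int_mul_two_pi_mul_I]

lemma spin_neg_mul (t : ℝ) : spin (-t) * spin t = 1 := by
  rw [← spin_add, neg_add_cancel]
  exact_mod_cast spin_intCast 0

lemma spin_neg_re (t : ℝ) : (spin (-t)).re = (spin t).re := by
  simp [spin, Complex.exp_re]

lemma spin_re_le (t : ℝ) : (spin t).re ≤ 1 :=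
  (Complex.re_le_norm _).trans_eq (norm_spin t)

/-- A function of period one, equal to one at the integers. -/
noncomputable def bump (t : ℝ) : ℝ := max 0 (2 * (spin t).re - 1)

lemma bump_nonneg (t : ℝ) : 0 ≤ bump t := le_max_left _ _

lemma bump_le_one (t : ℝ) : bump t ≤ 1 :=
  max_le zero_le_one (by linarith [spin_re_le t])

lemma bump_intCast (n : ℤ) : bump n = 1 := by
  rw [bump, spin_intCast, Complex.one_re]
  norm_num

/-- The part of the sum `1` distributed among the coordinates. -/
noncomputable def remainder (t : Fin 3 → ℝ) : ℂ := 1 - (∑ i, spin (t i)) / 6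

/-- The share of the remainder obtained by the coordinate `j`. -/
noncomputable def share (t : Fin 3 → ℝ) (j : Fin 3) : ℝ := bump (t j) / max 1 (∑ i, bump (t i))

variable {t : Fin 3 → ℝ} {j : Fin 3}

lemma share_nonneg (t : Fin 3 → ℝ) (j : Fin 3) : 0 ≤ share t j :=
  div_nonneg (bump_nonneg _) (le_max_of_le_left zero_le_one)

lemma sum_share (hj : bump (t j) = 1) : ∑ i, share t i = 1 := by
  have h : 1 ≤ ∑ i, bump (t i) :=
    hj.symm.trans_le (Finset.single_le_sum (fun i _ => bump_nonneg (t i)) (Finset.mem_univ j))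
  simp only [share, max_eq_right h]
  rw [← Finset.sum_div, div_self (by linarith)]

lemma share_ge (hj : bump (t j) = 1) : 1 / 3 ≤ share t j := by
  rw [share, hj]
  refine one_div_le_one_div_of_le (by positivity) (max_le (by norm_num) ?_)
  rw [Fin.sum_univ_three]
  linarith [bump_le_one (t 0), bump_le_one (t 1), bump_le_one (t 2)]

lemma remainder_re (t : Fin 3 → ℝ) : 1 / 2 ≤ (remainder t).re := by
  have : (remainder t).re = 1 - ((spin (t 0)).re + (spin (t 1)).re + (spin (t 2)).re) / 6 := by
    rw [remainder, Fin.sum_univ_three, Complex.sub_re, Complex.div_ofNat_re]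
    simp
  rw [this]
  linarith [spin_re_le (t 0), spin_re_le (t 1), spin_re_le (t 2)]

lemma remainder_mul_spin_re (s : ℝ) (hs : 1 / 2 ≤ (spin s).re) :
    0 ≤ (remainder t * spin (-s)).re := by
  have : remainder t * spin (-s) =
      spin (-s) - (spin (t 0 + -s) + spin (t 1 + -s) + spin (t 2 + -s)) / 6 := by
    simp only [remainder, Fin.sum_univ_three, spin_add]
    ring
  rw [this, Complex.sub_re, Complex.div_ofNat_re, spin_neg_re, Complex.add_re, Complex.add_re]
  linarith [spin_re_le (t 0 + -s), spin_re_le (t 1 + -s), spin_re_le (t 2 + -s)]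

/-- The quotient of a coordinate by the point of the unit circle with the same argument. -/
noncomputable def modulus (t : Fin 3 → ℝ) (j : Fin 3) : ℂ :=
  1 / 6 + share t j * (remainder t * spin (-t j))

lemma modulus_re : 0 < (modulus t j).re := by
  have : (modulus t j).re = 1 / 6 + share t j * (remainder t * spin (-t j)).re := by
    rw [modulus, Complex.add_re, Complex.re_ofReal_mul]
    norm_num
  rw [this]
  rcases le_total (1 / 2) (spin (t j)).re with h | h
  · have := mul_nonneg (share_nonneg t j) (remainder_mul_spin_re (t := t) (t j) h)
    linarith
  · have : share t j = 0 := by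
      rw [share, bump, max_eq_left (by linarith), zero_div]
    rw [this]
    norm_num

lemma modulus_ne_zero : modulus t j ≠ 0 := fun h => by
  have := modulus_re (t := t) (j := j)
  rw [h, Complex.zero_re] at this
  exact this.false

/-- The coordinates of the map from the boundary of a cube. -/
noncomputable def cubeCoord (k : Fin 3 → ℤ) (t : Fin 3 → ℝ) (j : Fin 3) : ℂ :=
  Complex.log (modulus t j) + (t j + k j) * (2 * Real.pi * Complex.I)

lemma exp_cubeCoord (k : Fin 3 → ℤ) : Complex.exp (cubeCoord k t j) =
    spin (t j) / 6 + share t j * remainder t := by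
  have : cubeCoord k t j = t j * (2 * Real.pi * Complex.I) +
      (Complex.log (modulus t j) + k j * (2 * Real.pi * Complex.I)) := by
    rw [cubeCoord]; ring
  rw [this, Complex.exp_add, exp_log_add modulus_ne_zero, ← spin, modulus]
  linear_combination share t j * remainder t * spin_neg_mul (t j)

lemma sum_exp_cubeCoord (k : Fin 3 → ℤ) (hj : bump (t j) = 1) :
    ∑ i, Complex.exp (cubeCoord k t i) = 1 := by
  simp only [exp_cubeCoord]
  rw [Finset.sum_add_distrib, ← Finset.sum_mul, ← Complex.ofReal_sum, sum_share hj, remainder,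
    ← Finset.sum_div]
  push_cast
  ring

lemma continuous_bump : Continuous bump := by
  have := continuous_spin
  unfold bump
  exact continuous_const.max (by fun_prop)

lemma continuous_cubeCoord (k : Fin 3 → ℤ) (j : Fin 3) :
    Continuous fun t => cubeCoord k t j := by
  have h1 := continuous_spin
  have h2 := continuous_bump
  have h3 : Continuous fun t => share t j := by
    unfold share
    refine Continuous.div (by fun_prop) (continuous_const.max (by fun_prop)) fun t => ?_
    exact (lt_max_of_lt_left one_pos).ne'
  have h4 : Continuous fun t => modulus t j := by
    unfold modulus remainder
    fun_prop
  unfold cubeCoord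
  exact (h4.clog fun t => Or.inl modulus_re).add (by fun_prop)

/-- The points with an integral coordinate. -/
abbrev CubeGrid : Type := {t : Fin 3 → ℝ // ∃ j, ∃ i : ℤ, t j = i}

/-- A map to the universal covering from the set of points with an integral coordinate. -/
noncomputable def cubeMap (k : Fin 3 → ℤ) : C(CubeGrid, Cov) :=
  ⟨fun t => ⟨cubeCoord k t, by
    obtain ⟨t, j, i, h⟩ := t
    exact sum_exp_cubeCoord (j := j) k ((congrArg bump h).trans (bump_intCast i))⟩,
    (continuous_pi fun j => (continuous_cubeCoord k j).comp continuous_subtype_val).subtype_mk _⟩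

lemma cubeMap_mem (k : Fin 3 → ℤ) {t : CubeGrid} {i : ℤ} (h : t.1 j = i) :
    cubeMap k t ∈ region j := by
  have hb : bump (t.1 j) = 1 := h ▸ bump_intCast i
  rw [mem_region]
  change _ < (Complex.exp (cubeCoord k t.1 j)).re
  rw [exp_cubeCoord, h, spin_intCast, Complex.add_re, Complex.re_ofReal_mul]
  have := share_ge hb
  have := remainder_re t.1
  norm_num
  nlinarith

lemma covSheet_cubeMap (k : Fin 3 → ℤ) {t : CubeGrid} {i : ℤ} (h : t.1 j = i) :
    covSheet j (cubeMap k t) = i + k j := by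
  change sheet (cubeCoord k t.1 j) = _
  rw [cubeCoord, h, ← sheet_log_add (modulus_ne_zero (t := t.1) (j := j)) (i + k j)]
  push_cast
  rfl

end CubeMap

section Sphere

lemma clamp_of_le {t : ℝ} (h : t ≤ 0) : clamp t = 0 :=
  max_eq_left (min_le_of_right_le h)

lemma clamp_of_ge {t : ℝ} (h : 1 ≤ t) : clamp t = 1 := by
  rw [clamp, min_eq_left h, max_eq_right zero_le_one]

/-- The norm on the plane whose balls are squares. -/
noncomputable def radius (p : ℝ × ℝ) : ℝ := max |p.1| |p.2|

lemma continuous_radius : Continuous radius :=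
  (continuous_abs.comp continuous_fst).max (continuous_abs.comp continuous_snd)

/-- A parametrization of the boundary of the unit cube by the square of radius `3`, up to a
square with two sides collapsed. -/
noncomputable def cubePoint (p : ℝ × ℝ) : Fin 3 → ℝ :=
  ![clamp (2 - radius p), 1 / 2 + clamp (3 - radius p) * (clamp ((p.1 + 1) / 2) - 1 / 2),
    1 / 2 + clamp (3 - radius p) * (clamp ((p.2 + 1) / 2) - 1 / 2)]

variable {p : ℝ × ℝ}

lemma cubePoint_zero_of_le (h : radius p ≤ 1) : cubePoint p 0 = 1 :=
  clamp_of_ge (by linarith)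

lemma cubePoint_zero_of_ge (h : 2 ≤ radius p) : cubePoint p 0 = 0 :=
  clamp_of_le (by linarith)

lemma cubePoint_one (h : radius p ≤ 2) : cubePoint p 1 = clamp ((p.1 + 1) / 2) := by
  change 1 / 2 + clamp (3 - radius p) * _ = _
  rw [clamp_of_ge (by linarith)]
  ring

lemma cubePoint_two (h : radius p ≤ 2) : cubePoint p 2 = clamp ((p.2 + 1) / 2) := by
  change 1 / 2 + clamp (3 - radius p) * _ = _
  rw [clamp_of_ge (by linarith)]
  ring

lemma clamp_half_of_abs {x : ℝ} (h : 1 ≤ |x|) : ∃ i : ℤ, clamp ((x + 1) / 2) = i := by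
  rcases le_abs.1 h with h | h
  · exact ⟨1, by rw [clamp_of_ge (by linarith), Int.cast_one]⟩
  · exact ⟨0, by rw [clamp_of_le (by linarith), Int.cast_zero]⟩

lemma exists_cubePoint_eq (p : ℝ × ℝ) : ∃ j, ∃ i : ℤ, cubePoint p j = i := by
  rcases le_total (radius p) 1 with h1 | h1
  · exact ⟨0, 1, by rw [cubePoint_zero_of_le h1, Int.cast_one]⟩
  rcases le_total (radius p) 2 with h2 | h2
  · rcases le_max_iff.1 h1 with h | h
    · exact ⟨1, by rw [cubePoint_one h2]; exact clamp_half_of_abs h⟩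
    · exact ⟨2, by rw [cubePoint_two h2]; exact clamp_half_of_abs h⟩
  · exact ⟨0, 0, by rw [cubePoint_zero_of_ge h2, Int.cast_zero]⟩

lemma cubePoint_of_ge (h : 3 ≤ radius p) : cubePoint p = ![0, 1 / 2, 1 / 2] := by
  rw [cubePoint, clamp_of_le (by linarith), clamp_of_le (by linarith), zero_mul, zero_mul, add_zero]

lemma continuous_cubePoint : Continuous cubePoint := by
  have h1 := continuous_clamp
  have h2 := continuous_radius
  refine continuous_pi fun i => ?_
  unfold cubePoint
  fin_cases i
  · exact h1.comp (continuous_const.sub h2)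
  · change Continuous fun p : ℝ × ℝ => 1 / 2 + clamp (3 - radius p) * (clamp ((p.1 + 1) / 2) - 1 / 2)
    fun_prop
  · change Continuous fun p : ℝ × ℝ => 1 / 2 + clamp (3 - radius p) * (clamp ((p.2 + 1) / 2) - 1 / 2)
    fun_prop

/-- A sphere in the universal covering which winds around the boundary of a cube. -/
noncomputable def sphere (k : Fin 3 → ℤ) : C(ℝ × ℝ, Cov) :=
  (cubeMap k).comp ⟨fun p => ⟨cubePoint p, exists_cubePoint_eq p⟩, continuous_cubePoint.subtype_mk _⟩

variable {k : Fin 3 → ℤ} {j : Fin 3} {i : ℤ}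

lemma sphere_mem (h : cubePoint p j = i) : sphere k p ∈ region j := cubeMap_mem k h

lemma covSheet_sphere (h : cubePoint p j = i) : covSheet j (sphere k p) = i + k j :=
  covSheet_cubeMap k h

lemma sphere_mem_zero_of_le (h : radius p ≤ 1) : sphere k p ∈ region 0 :=
  sphere_mem (i := 1) (by rw [cubePoint_zero_of_le h, Int.cast_one])

lemma sphere_mem_zero_of_ge (h : 2 ≤ radius p) : sphere k p ∈ region 0 :=
  sphere_mem (i := 0) (by rw [cubePoint_zero_of_ge h, Int.cast_zero])

lemma sphere_mem_one (h : radius p ≤ 2) (h' : 1 ≤ |p.1|) : sphere k p ∈ region 1 := by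
  obtain ⟨i, hi⟩ := clamp_half_of_abs h'
  exact sphere_mem ((cubePoint_one h).trans hi)

lemma sphere_mem_two (h : radius p ≤ 2) (h' : 1 ≤ |p.2|) : sphere k p ∈ region 2 := by
  obtain ⟨i, hi⟩ := clamp_half_of_abs h'
  exact sphere_mem ((cubePoint_two h).trans hi)

/-- The sphere, joined to a base point by a path. -/
noncomputable def basedSphere (k : Fin 3 → ℤ) {x₀ : Cov} (γ : Path (sphere k (3, 3)) x₀) :
    C(ℝ × ℝ, Cov) :=
  ⟨fun p => if radius p ≤ 3 then sphere k p else γ.extend (radius p - 3), by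
    have h := continuous_radius
    refine Continuous.if_le (by fun_prop) (by fun_prop) h continuous_const fun p hp => ?_
    rw [hp, sub_self, Path.extend_zero]
    have h3 : radius (3, 3) = 3 := by norm_num [radius]
    change cubeMap k _ = cubeMap k _
    congr 1
    exact Subtype.ext ((cubePoint_of_ge hp.ge).trans (cubePoint_of_ge h3.ge).symm)⟩

variable {x₀ : Cov} {γ : Path (sphere k (3, 3)) x₀}

lemma basedSphere_of_le (h : radius p ≤ 3) : basedSphere k γ p = sphere k p := if_pos h

lemma basedSphere_of_ge (h : 4 ≤ radius p) : basedSphere k γ p = x₀ :=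
  (if_neg (by linarith)).trans (γ.extend_of_one_le (by linarith))

lemma basedSphere_mem_zero (hγ : ∀ t, γ t ∈ region 0) (h : 2 ≤ radius p) :
    basedSphere k γ p ∈ region 0 := by
  rcases le_or_gt (radius p) 3 with h3 | h3
  · rw [basedSphere_of_le h3]
    exact sphere_mem_zero_of_ge h
  · have : basedSphere k γ p = γ.extend (radius p - 3) := if_neg (not_le.2 h3)
    rw [this]
    exact hγ _

/-- The labeling of the sphere. -/
def sphereLabel (m n : ℤ) : Fin 3 :=
  if (m = 3 ∨ m = 4) ∧ (n = 3 ∨ n = 4) then 0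
  else if (2 ≤ m ∧ m ≤ 5) ∧ 2 ≤ n ∧ n ≤ 5 then if m = 2 ∨ m = 5 then 1 else 2
  else 0

/-- The sphere, rescaled to the unit square. -/
noncomputable def squareSphere (k : Fin 3 → ℤ) {x₀ : Cov} (γ : Path (sphere k (3, 3)) x₀) :
    C(ℝ × ℝ, Cov) :=
  ⟨fun p => basedSphere k γ (8 * p.1 - 4, 8 * p.2 - 4), by fun_prop⟩

lemma constOutside_squareSphere : ConstOutside x₀ (squareSphere k γ) := fun x y h => by
  refine basedSphere_of_ge (le_max_iff.2 ?_)
  simp only [le_abs]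
  rcases h with h | h | h | h
  · left; right; linarith
  · left; left; linarith
  · right; right; linarith
  · right; left; linarith

lemma isLabeling_squareSphere (hγ : ∀ t, γ t ∈ region 0) :
    IsLabeling region (squareSphere k γ) 8 8 sphereLabel where
  pos_fst := by norm_num
  pos_snd := by norm_num
  mem m n x y a b c d := by
    push_cast at a b c d
    change basedSphere k γ (8 * x - 4, 8 * y - 4) ∈ _
    unfold sphereLabel
    split_ifs with h1 h2 h3
    · have hr : radius (8 * x - 4, 8 * y - 4) ≤ 1 := by
        simp only [radius, max_le_iff, abs_le]
        obtain ⟨rfl | rfl, rfl | rfl⟩ := h1 <;> norm_num at a b c d <;>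
          exact ⟨⟨by linarith, by linarith⟩, by linarith, by linarith⟩
      rw [basedSphere_of_le (by linarith)]
      exact sphere_mem_zero_of_le hr
    all_goals try
      have hr : radius (8 * x - 4, 8 * y - 4) ≤ 2 := by
        rify at h2
        simp only [radius, max_le_iff, abs_le]
        exact ⟨⟨by linarith, by linarith⟩, by linarith, by linarith⟩
    · rw [basedSphere_of_le (by linarith)]
      refine sphere_mem_one hr (le_abs.2 ?_)
      rcases h3 with rfl | rfl <;> norm_num at a b
      · right; change 1 ≤ -(8 * x - 4); linarith
      · left; change 1 ≤ 8 * x - 4; linarith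
    · rw [basedSphere_of_le (by linarith)]
      refine sphere_mem_two hr (le_abs.2 ?_)
      obtain rfl | rfl : n = 2 ∨ n = 5 := by omega
      · right; change 1 ≤ -(8 * y - 4); norm_num at c d; linarith
      · left; change 1 ≤ 8 * y - 4; norm_num at c d; linarith
    · refine basedSphere_mem_zero hγ (le_max_iff.2 ?_)
      simp only [le_abs]
      have : m ≤ 1 ∨ 6 ≤ m ∨ n ≤ 1 ∨ 6 ≤ n := by omega
      rify at this
      rcases this with h | h | h | h
      · left; right; linarith
      · left; left; linarith
      · right; right; linarith
      · right; left; linarith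
  ring m n h := by
    have : (2 ≤ m ∧ m ≤ 5) ∧ 2 ≤ n ∧ n ≤ 5 := by
      by_contra h'
      apply h
      rw [sphereLabel, if_neg h', ite_self]
    push_cast
    omega

lemma vturn_sphereLabel {m n : ℤ} (hm : 0 < m ∧ m < 8) (hn : 0 < n ∧ n < 8)
    (h : vturn sphereLabel m n ≠ 0) : (2 ≤ m ∧ m ≤ 6 ∧ (n = 2 ∨ n = 6)) ∨
      (m = 3 ∧ 2 ≤ n ∧ n ≤ 6) ∨ (n = 3 ∧ 2 ≤ m ∧ m ≤ 6) ∨ (m = 5 ∧ n = 5) := by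
  obtain ⟨m1, m2⟩ := hm
  obtain ⟨n1, n2⟩ := hn
  revert h
  interval_cases m <;> interval_cases n <;> decide

lemma radius_grid_le {m n : ℤ} (hm : 2 ≤ m ∧ m ≤ 6) (hn : 2 ≤ n ∧ n ≤ 6) :
    radius ((m : ℝ) - 4, (n : ℝ) - 4) ≤ 2 := by
  rify at hm hn
  simp only [radius, max_le_iff, abs_le]
  exact ⟨⟨by linarith, by linarith⟩, by linarith, by linarith⟩

lemma squareSphere_grid {m n : ℤ} (hm : 2 ≤ m ∧ m ≤ 6) (hn : 2 ≤ n ∧ n ≤ 6) :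
    squareSphere k γ (m / (8 : ℕ), n / (8 : ℕ)) = sphere k ((m : ℝ) - 4, (n : ℝ) - 4) := by
  rw [← basedSphere_of_le (γ := γ) ((radius_grid_le hm hn).trans (by norm_num))]
  change basedSphere k γ _ = _
  congr 2 <;> push_cast <;> field_simp

lemma chain_squareSphere (hγ : ∀ t, γ t ∈ region 0) :
    chain covSheet (squareSphere k γ) 8 8 sphereLabel (fun j => 1 + k j) ≠ 0 := by
  have hL := isLabeling_squareSphere (k := k) hγ
  have h5 : (fun j => covSheet j (squareSphere k γ (((5 : ℤ) : ℝ) / (8 : ℕ), ((5 : ℤ) : ℝ) / (8 : ℕ)))) =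
      fun j => 1 + k j := by
    rw [squareSphere_grid (by norm_num) (by norm_num)]
    have hr : radius (((5 : ℤ) : ℝ) - 4, ((5 : ℤ) : ℝ) - 4) = 1 := by norm_num [radius]
    funext j
    refine covSheet_sphere ?_
    fin_cases j
    · exact (cubePoint_zero_of_le hr.le).trans Int.cast_one.symm
    · refine (cubePoint_one (by linarith)).trans ?_
      norm_num [clamp]
    · refine (cubePoint_two (by linarith)).trans ?_
      norm_num [clamp]
  have key : chain covSheet (squareSphere k γ) 8 8 sphereLabel (fun j => 1 + k j) =
      vturn sphereLabel 5 5 := by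
    rw [chain]
    change Finsupp.applyAddHom (fun j => 1 + k j) _ = _
    rw [AddMonoidHom.map_finsum _ (finite_support_chain hL), finsum_eq_single _ (5, 5)]
    · change Finsupp.single _ _ _ = _
      rw [h5, Finsupp.single_eq_same]
    · rintro ⟨m, n⟩ hne
      change Finsupp.single _ _ _ = _
      refine Finsupp.single_apply_eq_zero.2 fun h => ?_
      by_contra hv
      have hbox := hL.box_of_vturn hv
      push_cast at hbox
      rcases vturn_sphereLabel ⟨hbox.1, hbox.2.1⟩ hbox.2.2 hv with h' | h' | h' | h'
      · have h0 := congrFun h 0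
        dsimp only at h0
        rw [squareSphere_grid (by omega) (by omega), covSheet_sphere (i := 0)] at h0
        · omega
        · refine (cubePoint_zero_of_ge (le_max_of_le_right (le_abs.2 ?_))).trans Int.cast_zero.symm
          rcases h'.2.2 with rfl | rfl <;> norm_num
      · have h0 := congrFun h 1
        dsimp only at h0
        rw [squareSphere_grid (by omega) (by omega), covSheet_sphere (i := 0)] at h0
        · omega
        · refine (cubePoint_one (radius_grid_le (by omega) (by omega))).trans ?_
          rw [h'.1]
          norm_num [clamp]
      · have h0 := congrFun h 2
        dsimp only at h0
        rw [squareSphere_grid (by omega) (by omega), covSheet_sphere (i := 0)] at h0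
        · omega
        · refine (cubePoint_two (radius_grid_le (by omega) (by omega))).trans ?_
          rw [h'.1]
          norm_num [clamp]
      · exact hne (Prod.ext h'.1 h'.2)
  rw [key]
  decide

end Sphere

theorem nonempty_pi_cov {x₀ : Cov} (h0 : x₀ ∈ region 0) :
    Nonempty (Additive (π_ 2 Cov x₀) ≃+ (ℕ →₀ ℤ)) := by
  obtain ⟨Φ, hΦ, hch⟩ := exists_chain_hom goodCover_region h0 (goodCover_region.simplyConn x₀)
  refine nonempty_addEquiv_finsupp Φ hΦ fun F hF => ?_
  have hinj : Function.Injective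
      fun n : ℤ => fun j : Fin 3 => 1 + (![covSheet 0 x₀, n, 0] : Fin 3 → ℤ) j := fun a b h => by
    simpa using congrFun h 1
  obtain ⟨n, hn⟩ := (hF.preimage hinj.injOn).exists_notMem
  have h3 : (2 : ℝ) ≤ radius (3, 3) := by norm_num [radius]
  have hs : covSheet 0 (sphere ![covSheet 0 x₀, n, 0] (3, 3)) = covSheet 0 x₀ := by
    rw [covSheet_sphere (i := 0) (by simpa using cubePoint_zero_of_ge h3)]
    simp
  have hJ := goodCover_region.joinedIn_of_eq (sphere_mem_zero_of_ge h3) h0 hs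
  refine ⟨cl x₀ (squareSphere _ hJ.somePath), _, hn, ?_⟩
  rw [hch _ 8 8 _ constOutside_squareSphere (isLabeling_squareSphere hJ.somePath_mem)]
  exact chain_squareSphere hJ.somePath_mem

end HattoriPiTwo

/-- The second homotopy group of the complement
`M = {(z,w) ∈ ℂ² : z ≠ 0, w ≠ 0, z + w ≠ 1}` of the arrangement of the three
lines `x = 0`, `y = 0`, `x + y = 1` in `ℂ²` is, as an abelian group, free
abelian of countably infinite rank, i.e. isomorphic to the group of finitely
supported functions `ℕ → ℤ`. -/
theorem pi2_of_hattori_complement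
    (M : Set (ℂ × ℂ))
    (hM : M = {p : ℂ × ℂ | p.1 ≠ 0 ∧ p.2 ≠ 0 ∧ p.1 + p.2 ≠ 1})
    (m : M) :
    Nonempty ((π_ 2 M m) ≃* Multiplicative (ℕ →₀ ℤ)) := by
  subst hM
  obtain ⟨σ, x, hx, h0⟩ := HattoriPiTwo.exists_proj_eq m
  obtain ⟨e⟩ := HattoriPiTwo.nonempty_pi_cov h0
  exact ⟨AddEquiv.toMultiplicativeRight ((AddEquiv.ofBijective (HattoriPiTwo.mapPi hx)
    ((HattoriPiTwo.uniqueLifts_proj σ).mapPi_bijective hx)).symm.trans e)⟩
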